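/- Let k be a perfect field of characteristic p > 2, let r ≥ 1 and m,n ≥ p^r, and let S := S(m|n,p^r) and M₀ be as in the context. Then the space Ext^{2p^{r−1}}_S(M₀,M₀) is one-dimensional, and every nonzero element e ∈ Ext^{2p^{r−1}}_S(M₀,M₀) satisfies e^ℓ ≠ 0 (ℓ-fold Yoneda product) for every ℓ ≥ 1; in particular Ext^•_S(M₀,M₀) contains non-nilpotent elements of positive degree. -/

import Mathlib

open CategoryTheory Finset

set_option synthInstance.maxHeartbeats 1000000
set_option maxHeartbeats 4000000

namespace Stmt7

variable (k : Type) [Field k]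

/-- index set for the standard homogeneous basis of the superspace `k^{m|n}` -/
abbrev BIdx (m n : ℕ) := Fin m ⊕ Fin n

/-- parity of a standard basis vector of `k^{m|n}` (`false` = even, `true` = odd) -/
def bpar {m n : ℕ} : BIdx m n → Bool := Sum.elim (fun _ => false) (fun _ => true)

/-- the `d`-th tensor power `(k^{m|n})^{⊗d}`, modelled on its standard monomial basis -/
def W (m n d : ℕ) : Type := (Fin d → BIdx m n) → k

instance (m n d : ℕ) : AddCommGroup (W k m n d) :=
  inferInstanceAs (AddCommGroup ((Fin d → BIdx m n) → k))

instance (m n d : ℕ) : Module k (W k m n d) :=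
  inferInstanceAs (Module k ((Fin d → BIdx m n) → k))

/-- the number of inversions of the permutation `σ` in which both entries involved are
odd, for a tensor whose `i`-th slot has parity `ε i`; the Koszul sign is `(-1)` to this count -/
def signExp {d : ℕ} (σ : Equiv.Perm (Fin d)) (ε : Fin d → Bool) : ℕ :=
  ((univ ×ˢ univ).filter fun q : Fin d × Fin d =>
    q.1 < q.2 ∧ σ q.2 < σ q.1 ∧ ε (σ q.1) = true ∧ ε (σ q.2) = true).card

/-- the signed (right) permutation action of `σ ∈ 𝔖_d` on `(k^{m|n})^{⊗d}`:
on a basis tensor, the transposition `(i, i+1)` acts by exchanging the `i`-th and `(i+1)`-th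
factors and multiplying by `(-1)` if both are odd -/
def act {m n d : ℕ} (σ : Equiv.Perm (Fin d)) : W k m n d →ₗ[k] W k m n d where
  toFun x := fun g => (-1 : k) ^ signExp σ (fun i => bpar (g (σ⁻¹ i))) * x (g ∘ ⇑σ⁻¹)
  map_add' x y := funext fun g => mul_add _ _ _
  map_smul' c x := funext fun g => mul_left_comm _ _ _

/-- the Schur superalgebra `S(m|n, d) = End_{k𝔖_d}((k^{m|n})^{⊗d})`, i.e. the algebra of
`k`-linear endomorphisms of `(k^{m|n})^{⊗d}` commuting with the signed `𝔖_d`-action -/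
def Schur (m n d : ℕ) : Subalgebra k (Module.End k (W k m n d)) :=
  Subalgebra.centralizer k (Set.range (act k (m := m) (n := n) (d := d)))

/-- the Schur superalgebra, as a type -/
def SAlg (m n d : ℕ) : Type := Schur k m n d

instance (m n d : ℕ) : Ring (SAlg k m n d) :=
  inferInstanceAs (Ring (Schur k m n d))

instance (m n d : ℕ) : Algebra k (SAlg k m n d) :=
  inferInstanceAs (Algebra k (Schur k m n d))

instance (m n d : ℕ) : Module (SAlg k m n d) (W k m n d) :=
  Module.compHom _ (Subalgebra.val (Schur k m n d)).toRingHom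

variable (m n d : ℕ)

/-- the pure tensor `v 0 ⊗ v 1 ⊗ ⋯ ⊗ v (d-1)` in `(k^{m|n})^{⊗d}` -/
def ptensor (v : Fin d → (BIdx m n → k)) : W k m n d := fun f => ∏ i, v i (f i)

/-- the pure tensor power `v^{⊗d}` -/
def tpow (v : BIdx m n → k) : W k m n d := ptensor k m n d (fun _ => v)

/-- a vector of `k^{m|n}` is even if it lies in `k^m = (k^{m|n})₀` -/
def IsEven {m n : ℕ} (v : BIdx m n → k) : Prop := ∀ j : Fin n, v (Sum.inr j) = 0

/-- a vector of `k^{m|n}` is odd if it lies in `k^n = (k^{m|n})₁` -/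
def IsOdd {m n : ℕ} (v : BIdx m n → k) : Prop := ∀ i : Fin m, v (Sum.inl i) = 0

/-- the relations `z - z·σ` defining the coinvariant space `𝐒^d(k^{m|n})` -/
def symRel : Submodule (SAlg k m n d) (W k m n d) :=
  Submodule.span _ {x | ∃ (z : W k m n d) (σ : Equiv.Perm (Fin d)), x = z - act k σ z}

/-- the coinvariant space `𝐒^d(k^{m|n})` -/
def SymQ : Type := W k m n d ⧸ symRel k m n d

instance : AddCommGroup (SymQ k m n d) :=
  inferInstanceAs (AddCommGroup (W k m n d ⧸ symRel k m n d))

instance : Module (SAlg k m n d) (SymQ k m n d) :=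
  inferInstanceAs (Module (SAlg k m n d) (W k m n d ⧸ symRel k m n d))

/-- the class of a tensor `z` in `𝐒^d(k^{m|n})`; for `z = v^{⊗d}` this is `v^d` -/
def symMk (z : W k m n d) : SymQ k m n d :=
  Submodule.Quotient.mk z

/-- `M₀`: the span of the `d`-th powers `v^d` of even vectors `v`, inside `𝐒^d(k^{m|n})`;
this is the evaluation at `k^{m|n}` of the Frobenius twist functor `I₀^{(r)}` when `d = p^r` -/
def M0 : Submodule (SAlg k m n d) (SymQ k m n d) :=
  Submodule.span _ {x | ∃ v, IsEven k v ∧ x = symMk k m n d (tpow k m n d v)}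

/-- `M₁`: the span of the tensor powers `y^{⊗d}` of odd vectors `y`, inside `(k^{m|n})^{⊗d}`;
this is the evaluation at `k^{m|n}` of the Frobenius twist functor `I₁^{(r)}` when `d = p^r` -/
def M1 : Submodule (SAlg k m n d) (W k m n d) :=
  Submodule.span _ {x | ∃ v, IsOdd k v ∧ x = tpow k m n d v}

/-- the category of left modules over the Schur superalgebra `S(m|n,d)` -/
abbrev SMod := ModuleCat.{0} (SAlg k m n d)

/-- `M₀` as an object of the module category of `S(m|n,d)` -/
noncomputable abbrev M0cat : SMod k m n d := ModuleCat.of _ (M0 k m n d)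

/-- `M₁` as an object of the module category of `S(m|n,d)` -/
noncomputable abbrev M1cat : SMod k m n d := ModuleCat.of _ (M1 k m n d)

noncomputable instance : HasDerivedCategory.{1} (ModuleCat.{0} (SAlg k m n d)) :=
  HasDerivedCategory.standard _

instance : HasExt.{1} (ModuleCat.{0} (SAlg k m n d)) :=
  CategoryTheory.hasExt_of_hasDerivedCategory _

open Abelian in
lemma Ext_mk₀_add {X Y : SMod k m n d} (f g : X ⟶ Y) :
    Ext.mk₀ (f + g) = Ext.mk₀ f + Ext.mk₀ g := by
  apply Ext.ext
  rw [Ext.add_hom, Ext.mk₀_hom, Ext.mk₀_hom, Ext.mk₀_hom, Functor.map_add]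
  simp [ShiftedHom.mk₀, Preadditive.add_comp]

open Abelian in
/-- the `k`-vector space structure on the Ext-groups for the Schur superalgebra, where
`c • x` is the Yoneda composite of `x` with `c • 𝟙` -/
noncomputable instance extModule (X Y : SMod k m n d) (N : ℕ) :
    Module k (Ext X Y N) where
  smul c x := (Ext.mk₀ (c • 𝟙 X)).comp x (zero_add N)
  one_smul x := by
    show (Ext.mk₀ ((1 : k) • 𝟙 X)).comp x (zero_add N) = x
    rw [one_smul]
    exact Ext.mk₀_id_comp x
  mul_smul a b x := by
    show (Ext.mk₀ ((a * b) • 𝟙 X)).comp x (zero_add N) =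
      (Ext.mk₀ (a • 𝟙 X)).comp ((Ext.mk₀ (b • 𝟙 X)).comp x (zero_add N)) (zero_add N)
    rw [Ext.mk₀_comp_mk₀_assoc (a • 𝟙 X) (b • 𝟙 X) x]
    congr 2
    simp [smul_smul, mul_comm a b]
  smul_zero a := Ext.comp_zero _ _ _ _ _
  smul_add a x y := Ext.comp_add _ _ _ _
  add_smul a b x := by
    show (Ext.mk₀ ((a + b) • 𝟙 X)).comp x (zero_add N) =
      (Ext.mk₀ (a • 𝟙 X)).comp x (zero_add N) + (Ext.mk₀ (b • 𝟙 X)).comp x (zero_add N)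
    rw [add_smul, Ext_mk₀_add, Ext.add_comp]
  zero_smul x := by
    show (Ext.mk₀ ((0 : k) • 𝟙 X)).comp x (zero_add N) = 0
    rw [zero_smul, Ext.mk₀_zero, Ext.zero_comp]

end Stmt7

namespace Stmt7

open CategoryTheory Abelian

/-- the `ℓ`-fold Yoneda power of an extension class of degree `e` -/
noncomputable def extPow {k : Type} [Field k] {m n d : ℕ} {X : SMod k m n d} {e : ℕ}
    (x : Ext X X e) : (ℓ : ℕ) → Ext X X (e * ℓ)
  | 0 => Ext.mk₀ (𝟙 X)
  | ℓ + 1 => (extPow x ℓ).comp x rfl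

end Stmt7

open CategoryTheory Finset
set_option synthInstance.maxHeartbeats 1000000
set_option maxHeartbeats 4000000
set_option linter.all false
namespace Stmt7
open CategoryTheory Abelian

section ET
variable {A : Type} [Ring A] [HasExt.{1} (ModuleCat.{0} A)] (L : ModuleCat.{0} A)
variable {X Y Z : Type} [AddCommGroup X] [AddCommGroup Y] [AddCommGroup Z]
  [Module A X] [Module A Y] [Module A Z]

/-- contravariant Ext groups into the fixed module -/
abbrev HH (X : Type) [AddCommGroup X] [Module A X] (t : ℕ) := Ext (ModuleCat.of A X) L t

/-- pull back -/
noncomputable def pull {X Y : Type} [AddCommGroup X] [AddCommGroup Y] [Module A X] [Module A Y]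
    (f : X →ₗ[A] Y) {t : ℕ} (x : HH L Y t) : HH L X t :=
  (Ext.mk₀ (ModuleCat.ofHom f)).comp x (zero_add t)

/-- vanishing of Ext in degree `t` -/
def Van (X : Type) [AddCommGroup X] [Module A X] (t : ℕ) : Prop := ∀ x : HH L X t, x = 0

/-- vanishing in all degrees -/
def Acyc (X : Type) [AddCommGroup X] [Module A X] : Prop := ∀ t, Van L X t

variable {L}

lemma pull_add (f : X →ₗ[A] Y) {t : ℕ} (x y : HH L Y t) :
    pull L f (x + y) = pull L f x + pull L f y := Ext.comp_add _ _ _ _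

lemma pull_zero (f : X →ₗ[A] Y) {t : ℕ} : pull L f (0 : HH L Y t) = 0 := Ext.comp_zero _ _ _ _ _

lemma pull_id {t : ℕ} (x : HH L X t) : pull L (LinearMap.id) x = x := Ext.mk₀_id_comp x

lemma pull_pull (f : X →ₗ[A] Y) (g : Y →ₗ[A] Z) {t : ℕ} (x : HH L Z t) :
    pull L f (pull L g x) = pull L (g ∘ₗ f) x := by
  unfold pull
  rw [Ext.mk₀_comp_mk₀_assoc]
  rfl

lemma pull_zero_map {t : ℕ} (x : HH L Y t) : pull L (0 : X →ₗ[A] Y) x = 0 := by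
  unfold pull
  have : ModuleCat.ofHom (0 : X →ₗ[A] Y) = 0 := rfl
  rw [this, Ext.mk₀_zero, Ext.zero_comp]

lemma pull_add_map (f g : X →ₗ[A] Y) {t : ℕ} (x : HH L Y t) :
    pull L (f + g) x = pull L f x + pull L g x := by
  unfold pull
  have : ModuleCat.ofHom (f + g) = ModuleCat.ofHom f + ModuleCat.ofHom g := rfl
  rw [this, Ext.mk₀_add, Ext.add_comp]

lemma pull_sum_map {ι : Type} (s : Finset ι) (f : ι → (X →ₗ[A] Y)) {t : ℕ} (x : HH L Y t) :
    pull L (∑ i ∈ s, f i) x = ∑ i ∈ s, pull L (f i) x := by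
  classical
  induction s using Finset.induction_on with
  | empty => simp [pull_zero_map]
  | insert a s ha ih => rw [Finset.sum_insert ha, Finset.sum_insert ha, pull_add_map, ih]

lemma pull_comp (f : X →ₗ[A] Y) {t u v : ℕ} (x : HH L Y t) (y : Ext L L u) (h : t + u = v) :
    pull L f (x.comp y h) = (pull L f x).comp y h := by
  unfold pull
  rw [Ext.comp_assoc _ _ _ (zero_add t) h (by omega)]

lemma pull_bij_of_equiv (e : X ≃ₗ[A] Y) (t : ℕ) :
    Function.Bijective (pull L e.toLinearMap : HH L Y t → HH L X t) := by
  refine ⟨fun x y h => ?_, fun x => ⟨pull L e.symm.toLinearMap x, ?_⟩⟩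
  · have := congrArg (pull L e.symm.toLinearMap) h
    rw [pull_pull, pull_pull] at this
    simpa [pull_id] using this
  · rw [pull_pull]; simp [pull_id]

lemma Van.of_equiv (e : X ≃ₗ[A] Y) {t : ℕ} (h : Van L Y t) : Van L X t := by
  intro x
  obtain ⟨y, rfl⟩ := (pull_bij_of_equiv e t).2 x
  rw [h y, pull_zero]

lemma Acyc.of_equiv (e : X ≃ₗ[A] Y) (h : Acyc L Y) : Acyc L X := fun t => (h t).of_equiv e

lemma Van.of_subsingleton [Subsingleton X] (t : ℕ) : Van L X t := by
  intro x
  rw [← pull_id x]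
  have : (LinearMap.id : X →ₗ[A] X) = 0 := by ext x; exact Subsingleton.elim _ _
  rw [this, pull_zero_map]

lemma Van.of_projective [Module.Projective A X] (t : ℕ) : Van L X (t+1) := by
  intro x
  haveI : CategoryTheory.Projective (ModuleCat.of A X) :=
    (IsProjective.iff_projective (R := A) X).1 inferInstance
  exact Ext.eq_zero_of_projective x

lemma van_zero_iff : Van L X 0 ↔ ∀ f : X →ₗ[A] L, f = 0 := by
  constructor
  · intro h f
    have := h (Ext.mk₀ (ModuleCat.ofHom f))
    rw [Ext.mk₀_eq_zero_iff] at this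
    have h2 := congrArg ModuleCat.Hom.hom this
    simpa using h2
  · intro h x
    obtain ⟨f, rfl⟩ := (Ext.mk₀_bijective _ _).2 x
    rw [Ext.mk₀_eq_zero_iff]
    ext1
    exact h f.hom

/-- direct sums -/
lemma Van.of_decomp {ι : Type} [Fintype ι] {M : ι → Type} [∀ i, AddCommGroup (M i)]
    [∀ i, Module A (M i)] (a : ∀ i, M i →ₗ[A] X) (b : ∀ i, X →ₗ[A] M i)
    (hab : ∀ x, ∑ i, a i (b i x) = x) {t : ℕ} (h : ∀ i, Van L (M i) t) : Van L X t := by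
  intro x
  rw [← pull_id x]
  have : (LinearMap.id : X →ₗ[A] X) = ∑ i, (a i) ∘ₗ (b i) := by
    ext y; simp [hab]
  rw [this, pull_sum_map]
  refine Finset.sum_eq_zero fun i _ => ?_
  rw [← pull_pull, h i (pull L (a i) x), pull_zero]

variable (L) in
lemma les (f : X →ₗ[A] Y) (g : Y →ₗ[A] Z) (hf : Function.Injective f) (hfg : Function.Exact f g)
    (hg : Function.Surjective g) :
    ∃ θ : Ext (ModuleCat.of A Z) (ModuleCat.of A X) 1,
      (∀ s t (h : 1 + s = t) (x : HH L X s), θ.comp x h = 0 → ∃ y, pull L f y = x) ∧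
      (∀ t (x : HH L Y t), pull L f x = 0 → ∃ z, pull L g z = x) ∧
      (∀ s t (h : 1 + s = t) (z : HH L Z t), pull L g z = 0 → ∃ x : HH L X s, θ.comp x h = z) ∧
      (∀ s t (h : 1 + s = t) (y : HH L Y s), θ.comp (pull L f y) h = 0) := by
  have hS : (ShortComplex.mk (ModuleCat.ofHom f) (ModuleCat.ofHom g) (by
      ext x; exact hfg.apply_apply_eq_zero x)).ShortExact := by
    apply ModuleCat.shortComplex_shortExact
    · exact hfg
    · exact hf
    · exact hg
  refine ⟨hS.extClass, ?_, ?_, ?_, ?_⟩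
  · intro s t h x hx
    exact Ext.contravariant_sequence_exact₁ hS L x h hx
  · intro t x hx
    exact Ext.contravariant_sequence_exact₂ hS L x hx
  · intro s t h z hz
    exact Ext.contravariant_sequence_exact₃ hS L z hz h
  · intro s t h y
    exact hS.extClass_comp_assoc y

lemma pull_inj_zero (g : Y →ₗ[A] Z) (hg : Function.Surjective g) (x y : HH L Z 0)
    (h : pull L g x = pull L g y) : x = y := by
  haveI : Epi (ModuleCat.ofHom g) := (ModuleCat.epi_iff_surjective _).2 hg
  exact Ext.precomp_mk₀_injective_of_epi L (ModuleCat.ofHom g) h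

section ses
variable (f : X →ₗ[A] Y) (g : Y →ₗ[A] Z) (hf : Function.Injective f) (hfg : Function.Exact f g)
    (hg : Function.Surjective g)
include hf hfg hg

lemma Van.mid {t : ℕ} (hX : Van L X t) (hZ : Van L Z t) : Van L Y t := by
  obtain ⟨θ, h1, h2, h3, h4⟩ := les L f g hf hfg hg
  intro x
  obtain ⟨z, rfl⟩ := h2 t x (hX _)
  rw [hZ z, pull_zero]

lemma Van.right {s t : ℕ} (h : 1 + s = t) (hX : Van L X s) (hY : Van L Y t) : Van L Z t := by
  obtain ⟨θ, h1, h2, h3, h4⟩ := les L f g hf hfg hg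
  intro z
  obtain ⟨x, rfl⟩ := h3 s t h z (hY _)
  rw [hX x, Ext.comp_zero]

lemma Van.left {s t : ℕ} (h : 1 + s = t) (hY : Van L Y s) (hZ : Van L Z t) : Van L X s := by
  obtain ⟨θ, h1, h2, h3, h4⟩ := les L f g hf hfg hg
  intro x
  obtain ⟨y, rfl⟩ := h1 s t h x (hZ _)
  rw [hY y, pull_zero]
end ses

lemma Van.right_zero (g : Y →ₗ[A] Z) (hg : Function.Surjective g) (hY : Van L Y 0) : Van L Z 0 := by
  intro z
  apply pull_inj_zero g hg
  rw [hY (pull L g z), pull_zero]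

/-- natural additive degree `a` shift isomorphism -/
def Sh (L : ModuleCat.{0} A) (a : ℕ) (X Y : Type) [AddCommGroup X] [AddCommGroup Y] [Module A X]
    [Module A Y] : Prop :=
  ∃ β : ∀ s t : ℕ, s + a = t → HH L X s → HH L Y t,
    (∀ s t h, Function.Bijective (β s t h)) ∧ (∀ s t h, β s t h 0 = 0) ∧
    (∀ s t h u s' t' (hs : s + u = s') (ht : t + u = t') (h' : s' + a = t') (x : HH L X s)
      (y : Ext L L u), β s' t' h' (x.comp y hs) = (β s t h x).comp y ht)

lemma Sh.van {a : ℕ} (H : Sh L a X Y) {s t : ℕ} (h : s + a = t) : Van L X s ↔ Van L Y t := by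
  obtain ⟨β, b, z, n⟩ := H
  constructor
  · intro hX y
    obtain ⟨x, rfl⟩ := (b s t h).2 y
    rw [hX x, z]
  · intro hY x
    apply (b s t h).1
    rw [z]; exact hY _

lemma Sh.trans {a b c : ℕ} (H : Sh L a X Y) (H' : Sh L b Y Z) (hc : a + b = c) : Sh L c X Z := by
  obtain ⟨β, b, z, n⟩ := H
  obtain ⟨β', b', z', n'⟩ := H'
  refine ⟨fun s t h x => β' (s+a) t (by omega) (β s (s+a) rfl x), ?_, ?_, ?_⟩
  · intro s t h
    exact (b' _ _ _).comp (b _ _ _)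
  · intro s t h
    simp only [z, z']
  · intro s t h u s' t' hs ht h' x y
    simp only
    rw [n s (s+a) rfl u s' (s'+a) hs (by omega) rfl, n' (s+a) t]

lemma Sh.of_pull (f : X →ₗ[A] Y) (h : ∀ t, Function.Bijective (pull L f : HH L Y t → HH L X t)) :
    Sh L 0 Y X := by
  refine ⟨fun s t h x => pull L f (h ▸ x), ?_, ?_, ?_⟩
  · intro s t e
    cases e
    exact h s
  · intro s t e
    cases e
    exact pull_zero f
  · intro s t e u s' t' hs ht h' x y
    cases e
    cases hs
    cases h'
    exact pull_comp f x y _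

lemma Sh.symm0 (H : Sh L 0 X Y) : Sh L 0 Y X := by
  obtain ⟨β, b, z, n⟩ := H
  choose γ hγ using fun (s t : ℕ) (h : s + 0 = t) => (b t s h.symm).surjective
  refine ⟨γ, ?_, ?_, ?_⟩
  · intro s t h
    refine ⟨?_, ?_⟩
    · intro x y hxy
      rw [← hγ s t h x, hxy, hγ]
    · intro x
      refine ⟨β t s h.symm x, ?_⟩
      apply (b t s h.symm).1
      rw [hγ]
  · intro s t h
    apply (b t s h.symm).1
    rw [hγ, z]
  · intro s t h u s' t' hs ht h' x y
    apply (b t' s' h'.symm).1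
    rw [hγ, n t s h.symm u t' s' ht hs h'.symm, hγ]

lemma Sh.of_equiv (e : X ≃ₗ[A] Y) : Sh L 0 X Y :=
  (Sh.of_pull e.toLinearMap (pull_bij_of_equiv e)).symm0

section ses
variable (f : X →ₗ[A] Y) (g : Y →ₗ[A] Z) (hf : Function.Injective f) (hfg : Function.Exact f g)
    (hg : Function.Surjective g)
include hf hfg hg

lemma Sh.one (H : ∀ s, Van L Y (s+1)) (H' : ∀ s, Van L Y s ∨ Van L X s) : Sh L 1 X Z := by
  obtain ⟨θ, h1, h2, h3, h4⟩ := les L f g hf hfg hg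
  refine ⟨fun s t h x => θ.comp x (by omega), ?_, ?_, ?_⟩
  · intro s t h
    subst h
    refine ⟨?_, ?_⟩
    · have key : ∀ x : HH L X s, θ.comp x (by omega : 1 + s = s + 1) = 0 → x = 0 := by
        intro x hx
        rcases H' s with h | h
        · obtain ⟨y, rfl⟩ := h1 _ _ _ x hx
          rw [h y, pull_zero]
        · exact h x
      intro x y hxy
      have := key (x - y) (by
        rw [sub_eq_add_neg, Ext.comp_add, Ext.comp_neg]
        simpa [sub_eq_zero, ← sub_eq_add_neg] using hxy)
      exact sub_eq_zero.1 this
    · intro z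
      exact h3 s (s+1) (by omega) z (H s _)
  · intro s t h
    exact Ext.comp_zero _ _ _ _ _
  · intro s t h u s' t' hs ht h' x y
    simp only
    rw [Ext.comp_assoc _ _ _ (by omega) hs (by omega)]

lemma pull_g_bij {t : ℕ} (h0 : Van L X t) (h1 : ∀ s, 1 + s = t → Van L X s) :
    Function.Bijective (pull L g : HH L Z t → HH L Y t) := by
  obtain ⟨θ, e1, e2, e3, e4⟩ := les L f g hf hfg hg
  refine ⟨?_, fun x => e2 t x (h0 _)⟩
  cases t with
  | zero => exact fun x y h => pull_inj_zero g hg x y h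
  | succ s =>
    have key : ∀ z : HH L Z (s+1), pull L g z = 0 → z = 0 := by
      intro z hz
      obtain ⟨x, rfl⟩ := e3 s (s+1) (by omega) z hz
      rw [h1 s (by omega) x, Ext.comp_zero]
    intro x y hxy
    have := key (x - y) (by
      rw [sub_eq_add_neg, pull_add, hxy, ← pull_add, ← sub_eq_add_neg, sub_self, pull_zero])
    exact sub_eq_zero.1 this

lemma Sh.quot (h0 : Acyc L X) : Sh L 0 Z Y :=
  Sh.of_pull g fun t => pull_g_bij f g hf hfg hg (h0 t) (fun s _ => h0 s)
end ses
end ET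
end Stmt7

open CategoryTheory Finset
set_option synthInstance.maxHeartbeats 1000000
set_option maxHeartbeats 4000000
set_option linter.all false
namespace Stmt7
open CategoryTheory Abelian

section signs
variable {k : Type} [Field k] {m n d : ℕ}

lemma perm_inv_apply_self {α : Type*} (σ : Equiv.Perm α) (x : α) : σ⁻¹ (σ x) = x := by simp
lemma perm_apply_inv_self {α : Type*} (σ : Equiv.Perm α) (x : α) : σ (σ⁻¹ x) = x := by simp

/-- pair inversion sign -/
def iot {d : ℕ} (σ : Equiv.Perm (Fin d)) (a b : Fin d) : ℤ :=
  if (a < b) ↔ (σ a < σ b) then 1 else -1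

/-- pair sign with parities -/
def prs {d : ℕ} (σ : Equiv.Perm (Fin d)) (ε : Fin d → Bool) (a b : Fin d) : ℤ :=
  if ε a = true ∧ ε b = true then iot σ a b else 1

/-- Koszul sign -/
def sgz {d : ℕ} (σ : Equiv.Perm (Fin d)) (ε : Fin d → Bool) : ℤ :=
  ∏ q ∈ univ.filter (fun q : Fin d × Fin d => q.1 < q.2), prs σ ε q.1 q.2

lemma prod_pairs_perm (σ : Equiv.Perm (Fin d)) (F : Fin d → Fin d → ℤ) (hF : ∀ a b, F a b = F b a) :
    ∏ q ∈ univ.filter (fun q : Fin d × Fin d => q.1 < q.2), F (σ q.1) (σ q.2) =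
    ∏ q ∈ univ.filter (fun q : Fin d × Fin d => q.1 < q.2), F q.1 q.2 := by
  refine Finset.prod_nbij' (fun q => if σ q.1 < σ q.2 then (σ q.1, σ q.2) else (σ q.2, σ q.1))
    (fun q => if σ⁻¹ q.1 < σ⁻¹ q.2 then (σ⁻¹ q.1, σ⁻¹ q.2) else (σ⁻¹ q.2, σ⁻¹ q.1)) ?_ ?_ ?_ ?_ ?_
  · rintro ⟨a, b⟩ h
    simp only [mem_filter, mem_univ, true_and] at h ⊢
    split_ifs with h1
    · exact h1
    · have : σ a ≠ σ b := fun e => h.ne (σ.injective e)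
      exact lt_of_le_of_ne (not_lt.1 h1) this.symm
  · rintro ⟨a, b⟩ h
    simp only [mem_filter, mem_univ, true_and] at h ⊢
    split_ifs with h1
    · exact h1
    · have : σ⁻¹ a ≠ σ⁻¹ b := fun e => h.ne (σ⁻¹.injective e)
      exact lt_of_le_of_ne (not_lt.1 h1) this.symm
  · rintro ⟨a, b⟩ h
    simp only [mem_filter, mem_univ, true_and] at h ⊢
    split_ifs with h1 h2 h2 <;> simp_all [not_lt.2 h.le]
  · rintro ⟨a, b⟩ h
    simp only [mem_filter, mem_univ, true_and] at h ⊢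
    split_ifs with h1 h2 h2 <;> simp_all [not_lt.2 h.le]
  · rintro ⟨a, b⟩ h
    simp only
    split_ifs with h1
    · rfl
    · exact hF _ _

lemma iot_comm (σ : Equiv.Perm (Fin d)) (a b : Fin d) : iot σ a b = iot σ b a := by
  rcases eq_or_ne a b with rfl | hab
  · rfl
  · have h2 : σ a ≠ σ b := fun e => hab (σ.injective e)
    unfold iot
    rcases lt_or_gt_of_ne hab with h | h <;> rcases lt_or_gt_of_ne h2 with h' | h' <;>
      simp [h, h', not_lt.2 h.le, not_lt.2 h'.le]

lemma prs_comm (σ : Equiv.Perm (Fin d)) (ε : Fin d → Bool) (a b : Fin d) :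
    prs σ ε a b = prs σ ε b a := by
  unfold prs; rw [iot_comm]; simp only [and_comm]

lemma iot_mul (σ τ : Equiv.Perm (Fin d)) (a b : Fin d) :
    iot (τ * σ) a b = iot σ a b * iot τ (σ a) (σ b) := by
  unfold iot
  simp only [Equiv.Perm.mul_apply]
  by_cases h1 : a < b <;> by_cases h2 : σ a < σ b <;> by_cases h3 : τ (σ a) < τ (σ b) <;>
    simp [h1, h2, h3]

lemma sgz_mul (σ τ : Equiv.Perm (Fin d)) (ε : Fin d → Bool) :
    sgz (τ * σ) ε = sgz σ ε * sgz τ (fun i => ε (σ⁻¹ i)) := by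
  unfold sgz
  rw [← prod_pairs_perm σ (prs τ (fun i => ε (σ⁻¹ i))) (prs_comm _ _), ← Finset.prod_mul_distrib]
  refine Finset.prod_congr rfl fun q _ => ?_
  simp only [prs, perm_inv_apply_self, iot_mul]
  split_ifs <;> simp

lemma sgz_sq (σ : Equiv.Perm (Fin d)) (ε : Fin d → Bool) : sgz σ ε * sgz σ ε = 1 := by
  unfold sgz
  rw [← Finset.prod_mul_distrib]
  refine Finset.prod_eq_one fun q _ => ?_
  unfold prs iot
  split_ifs <;> simp

lemma sgz_even (σ : Equiv.Perm (Fin d)) (ε : Fin d → Bool) (h : ∀ i, ε i = false) :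
    sgz σ ε = 1 := by
  unfold sgz
  refine Finset.prod_eq_one fun q _ => ?_
  simp [prs, h]

lemma sgz_one (ε : Fin d → Bool) : sgz 1 ε = 1 := by
  unfold sgz
  refine Finset.prod_eq_one fun q _ => ?_
  simp [prs, iot]

lemma sgz_swap (a b : Fin d) (hab : a ≠ b) (ε : Fin d → Bool) (ha : ε a = true) (hb : ε b = true) :
    sgz (Equiv.swap a b) ε = -1 := by
  wlog h : a < b generalizing a b with H
  · rw [Equiv.swap_comm]
    exact H b a hab.symm hb ha (lt_of_le_of_ne (not_lt.1 h) hab.symm)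
  unfold sgz
  have hm : (a, b) ∈ univ.filter (fun q : Fin d × Fin d => q.1 < q.2) := by simp [h]
  rw [← Finset.mul_prod_erase _ _ hm]
  have h1 : prs (Equiv.swap a b) ε a b = -1 := by
    simp [prs, ha, hb, iot, h, not_lt.2 h.le]
  simp only [h1]
  rw [neg_one_mul]
  congr 1
  set τ := Equiv.swap a b
  have hττ : ∀ x, τ (τ x) = x := Equiv.swap_apply_self a b
  have hετ : ∀ x, ε (τ x) = ε x := by
    intro x
    by_cases hxa : x = a
    · subst hxa; simp [τ, ha, hb]
    · by_cases hxb : x = b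
      · subst hxb; simp [τ, ha, hb]
      · simp [τ, Equiv.swap_apply_of_ne_of_ne hxa hxb]
  have key : ∀ x y, prs τ ε (τ x) (τ y) = prs τ ε x y := by
    intro x y
    simp only [prs, hετ, iot, hττ]
    split_ifs <;> first | rfl | (exfalso; tauto)
  have sq : ∀ x y, prs τ ε x y * prs τ ε x y = 1 := by
    intro x y; unfold prs iot; split_ifs <;> simp
  refine Finset.prod_involution
    (fun q _ => if τ q.1 < τ q.2 then (τ q.1, τ q.2) else (τ q.2, τ q.1)) ?_ ?_ ?_ ?_
  · rintro ⟨x, y⟩ hq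
    simp only
    split_ifs with h2
    · rw [key, sq]
    · simp only; rw [prs_comm τ ε (τ y), key, sq]
  · rintro ⟨x, y⟩ hq hne heq
    simp only [mem_erase, mem_filter, mem_univ, true_and] at hq
    simp only at heq hne
    apply hne
    split_ifs at heq with h2
    · simp only [Prod.mk.injEq] at heq
      simp [prs, iot, heq.1, heq.2]
    · simp only [Prod.mk.injEq] at heq
      exfalso
      have hxy : x ≠ y := hq.2.ne
      have hx : x = a ∨ x = b := by
        by_contra hc
        push Not at hc
        have := Equiv.swap_apply_of_ne_of_ne hc.1 hc.2
        exact hxy (this.symm.trans heq.2)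
      rcases hx with rfl | rfl
      · have : τ x = b := Equiv.swap_apply_left _ _
        apply hq.1
        rw [← this, heq.2]
      · have : τ x = a := Equiv.swap_apply_right _ _
        have h3 : y = a := by rw [← this, heq.2]
        subst h3
        exact absurd hq.2 (not_lt.2 h.le)
  · rintro ⟨x, y⟩ hq
    simp only [mem_erase, mem_filter, mem_univ, true_and] at hq ⊢
    have hne : τ x ≠ τ y := fun e => hq.2.ne (τ.injective e)
    split_ifs with h2
    · refine ⟨?_, h2⟩
      intro heq
      simp only [Prod.mk.injEq] at heq
      have e1 : x = b := by rw [← hττ x, heq.1]; exact Equiv.swap_apply_left _ _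
      have e2 : y = a := by rw [← hττ y, heq.2]; exact Equiv.swap_apply_right _ _
      subst e1 e2
      exact absurd hq.2 (not_lt.2 h.le)
    · refine ⟨?_, lt_of_le_of_ne (not_lt.1 h2) hne.symm⟩
      intro heq
      simp only [Prod.mk.injEq] at heq
      have e1 : y = b := by rw [← hττ y, heq.1]; exact Equiv.swap_apply_left _ _
      have e2 : x = a := by rw [← hττ x, heq.2]; exact Equiv.swap_apply_right _ _
      exact hq.1 (by rw [e1, e2])
  · rintro ⟨x, y⟩ hq
    simp only [mem_erase, mem_filter, mem_univ, true_and] at hq ⊢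
    by_cases h2 : τ x < τ y
    · simp [h2, hττ, hq.2]
    · simp [h2, hττ, hq.2, not_lt.2 hq.2.le]

lemma sgz_const_odd (σ : Equiv.Perm (Fin d)) (ε : Fin d → Bool) (h : ∀ i, ε i = true) :
    sgz σ ε = (Equiv.Perm.sign σ : ℤ) := by
  have hε : ε = fun _ => true := funext h
  subst hε
  induction σ using Equiv.Perm.swap_induction_on with
  | one => simp [sgz_one]
  | swap_mul f x y hxy ih =>
    rw [sgz_mul, ih, sgz_swap x y hxy _ rfl rfl]
    simp [Equiv.Perm.sign_swap hxy, mul_comm]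

lemma signExp_eq (σ : Equiv.Perm (Fin d)) (ε : Fin d → Bool) :
    ((-1 : ℤ) ^ signExp σ (fun i => ε (σ⁻¹ i))) = sgz σ ε := by
  unfold sgz signExp
  rw [← Finset.prod_const, Finset.univ_product_univ]
  simp only [perm_inv_apply_self]
  rw [Finset.prod_filter, Finset.prod_filter]
  refine Finset.prod_congr rfl fun q _ => ?_
  unfold prs iot
  by_cases h1 : q.1 < q.2
  · have h2 : σ q.1 ≠ σ q.2 := fun e => h1.ne (σ.injective e)
    rcases lt_or_gt_of_ne h2 with h3 | h3
    · simp [h1, h3, not_lt.2 h3.le]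
    · simp [h1, h3, not_lt.2 h3.le]
  · simp [h1]

variable (k) in
/-- the sign in the field -/
def sg (σ : Equiv.Perm (Fin d)) (g : Fin d → BIdx m n) : k := (sgz σ (fun i => bpar (g i)) : ℤ)

lemma act_apply (σ : Equiv.Perm (Fin d)) (x : W k m n d) (g : Fin d → BIdx m n) :
    act k σ x g = sg k σ g * x (g ∘ ⇑σ⁻¹) := by
  unfold sg
  rw [← signExp_eq]
  push_cast
  rfl

lemma sg_mul (σ τ : Equiv.Perm (Fin d)) (g : Fin d → BIdx m n) :
    sg k (τ * σ) g = sg k σ g * sg k τ (g ∘ ⇑σ⁻¹) := by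
  unfold sg
  rw [sgz_mul]; push_cast; rfl

lemma sg_sq (σ : Equiv.Perm (Fin d)) (g : Fin d → BIdx m n) : sg k σ g * sg k σ g = 1 := by
  unfold sg
  rw [← Int.cast_mul, sgz_sq]; simp

lemma sg_one (g : Fin d → BIdx m n) : sg k 1 g = 1 := by simp [sg, sgz_one]

lemma sg_even (σ : Equiv.Perm (Fin d)) (g : Fin d → BIdx m n) (h : ∀ i, bpar (g i) = false) :
    sg k σ g = 1 := by simp [sg, sgz_even _ _ h]

lemma sg_swap (a b : Fin d) (hab : a ≠ b) (g : Fin d → BIdx m n) (ha : bpar (g a) = true)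
    (hb : bpar (g b) = true) : sg k (Equiv.swap a b) g = -1 := by
  simp [sg, sgz_swap a b hab (fun i => bpar (g i)) ha hb]

lemma sg_const_odd (σ : Equiv.Perm (Fin d)) (g : Fin d → BIdx m n) (h : ∀ i, bpar (g i) = true) :
    sg k σ g = ((Equiv.Perm.sign σ : ℤ) : k) := by simp [sg, sgz_const_odd _ _ h]

lemma sg_congr (σ : Equiv.Perm (Fin d)) (g : Fin d → BIdx m n) {m' n' : ℕ} (g' : Fin d → BIdx m' n')
    (h : ∀ i, bpar (g i) = bpar (g' i)) :
    sg k σ g = sg k σ g' := by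
  unfold sg; congr 2; funext i; exact h i

lemma act_act (σ τ : Equiv.Perm (Fin d)) (x : W k m n d) :
    act k σ (act k τ x) = act k (τ * σ) x := by
  funext g
  rw [act_apply, act_apply, act_apply, sg_mul, mul_assoc]
  congr 3

lemma act_one (x : W k m n d) : act k 1 x = x := by
  funext g
  rw [act_apply, sg_one, one_mul]; rfl

lemma act_mul_act (σ τ : Equiv.Perm (Fin d)) :
    (act k σ : W k m n d →ₗ[k] W k m n d) * act k τ = act k (τ * σ) := LinearMap.ext fun x => act_act σ τ x

variable (k) in
/-- basis vector -/
def wd (f : Fin d → BIdx m n) : W k m n d := Pi.single f (1 : k)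

lemma wd_apply (f g : Fin d → BIdx m n) : wd k f g = if g = f then 1 else 0 := by
  unfold wd; rw [Pi.single_apply]

variable (k) in
/-- evaluation -/
def wev (g : Fin d → BIdx m n) : W k m n d →ₗ[k] k :=
  (LinearMap.proj g : ((Fin d → BIdx m n) → k) →ₗ[k] k)

lemma wev_apply (g : Fin d → BIdx m n) (x : W k m n d) : wev k g x = x g := rfl

lemma w_sum_apply {ι : Type*} (s : Finset ι) (x : ι → W k m n d) (g) :
    (∑ i ∈ s, x i) g = ∑ i ∈ s, x i g := map_sum (wev k g) x s

lemma w_smul_apply (c : k) (x : W k m n d) (g) : (c • x) g = c * x g := rfl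
lemma w_add_apply (x y : W k m n d) (g) : (x + y) g = x g + y g := rfl

lemma w_sum (x : W k m n d) : x = ∑ f, x f • wd k f := by
  funext g
  rw [w_sum_apply, Finset.sum_eq_single g]
  · rw [w_smul_apply, wd_apply, if_pos rfl, mul_one]
  · intro f _ hf
    rw [w_smul_apply, wd_apply, if_neg hf.symm, mul_zero]
  · intro h; exact absurd (mem_univ _) h

lemma W_ext {M : Type*} [AddCommGroup M] [Module k M] {s t : W k m n d →ₗ[k] M}
    (h : ∀ f, s (wd k f) = t (wd k f)) : s = t := by
  ext x
  rw [w_sum x, map_sum, map_sum]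
  refine Finset.sum_congr rfl fun f _ => ?_
  rw [map_smul, map_smul, h]

/-- matrix coefficient -/
def mc (s : Module.End k (W k m n d)) (g f : Fin d → BIdx m n) : k := s (wd k f) g

lemma end_apply (s : Module.End k (W k m n d)) (x : W k m n d) (g) :
    s x g = ∑ f, mc s g f * x f := by
  conv_lhs => rw [w_sum x, map_sum]
  rw [w_sum_apply]
  refine Finset.sum_congr rfl fun f _ => ?_
  rw [map_smul]
  exact mul_comm _ _

lemma mc_mul (s t : Module.End k (W k m n d)) (g f) :
    mc (s * t) g f = ∑ h, mc s g h * mc t h f := by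
  unfold mc
  rw [Module.End.mul_apply, end_apply]; rfl

lemma act_wd (σ : Equiv.Perm (Fin d)) (f : Fin d → BIdx m n) :
    act k σ (wd k f) = sg k σ (f ∘ σ) • wd k (f ∘ σ) := by
  funext g
  rw [act_apply]
  change _ = sg k σ (f ∘ σ) * wd k (f ∘ σ) g
  rw [wd_apply, wd_apply]
  by_cases h : g = f ∘ σ
  · subst h
    rw [if_pos rfl, if_pos]
    funext i; simp
  · rw [if_neg h, if_neg]
    · simp
    · intro e; apply h; rw [← e]; funext i; simp

lemma mc_perm {s : Module.End k (W k m n d)} {σ : Equiv.Perm (Fin d)} (h : act k σ * s = s * act k σ)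
    (g f : Fin d → BIdx m n) :
    mc s (g ∘ σ) (f ∘ σ) = sg k σ (f ∘ σ) * sg k σ (g ∘ σ) * mc s g f := by
  have h1 := congrFun (LinearMap.congr_fun h (wd k f)) (g ∘ σ)
  rw [Module.End.mul_apply, Module.End.mul_apply, act_wd, map_smul, act_apply] at h1
  have h2 : (g ∘ σ) ∘ ⇑σ⁻¹ = g := by funext i; simp
  rw [h2] at h1
  change _ = sg k σ (f ∘ σ) * mc s (g ∘ σ) (f ∘ σ) at h1
  change sg k σ (g ∘ σ) * mc s g f = _ at h1
  rw [mul_assoc, h1, ← mul_assoc, sg_sq, one_mul]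

lemma commute_of_mc {s : Module.End k (W k m n d)} {σ : Equiv.Perm (Fin d)}
    (h : ∀ g f : Fin d → BIdx m n,
      mc s (g ∘ σ) (f ∘ σ) = sg k σ (f ∘ σ) * sg k σ (g ∘ σ) * mc s g f) :
    act k σ * s = s * act k σ := by
  apply W_ext
  intro f
  funext g
  rw [Module.End.mul_apply, Module.End.mul_apply, act_wd, map_smul, act_apply]
  have h2 : (g ∘ ⇑σ⁻¹) ∘ σ = g := by funext i; simp
  have h1 := h (g ∘ ⇑σ⁻¹) f
  rw [h2] at h1
  change sg k σ g * mc s (g ∘ ⇑σ⁻¹) f = sg k σ (f ∘ σ) * mc s g (f ∘ σ)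
  rw [h1, ← mul_assoc, ← mul_assoc, sg_sq, one_mul]

variable (k m n) in
/-- centralizer of a set of permutations -/
def cen (P : Set (Equiv.Perm (Fin d))) : Subalgebra k (Module.End k (W k m n d)) :=
  Subalgebra.centralizer k ((act k) '' P)

lemma mem_cen {P : Set (Equiv.Perm (Fin d))} {s : Module.End k (W k m n d)} :
    s ∈ cen k m n P ↔ ∀ σ ∈ P, act k σ * s = s * act k σ := by
  unfold cen
  rw [Subalgebra.mem_centralizer_iff]
  simp

lemma mem_schur {s : Module.End k (W k m n d)} :
    s ∈ Schur k m n d ↔ ∀ σ, act k σ * s = s * act k σ := by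
  unfold Schur
  rw [Subalgebra.mem_centralizer_iff]
  simp

lemma schur_le_cen (P : Set (Equiv.Perm (Fin d))) : Schur k m n d ≤ cen k m n P := by
  intro s hs
  rw [mem_cen]
  intro σ _
  exact mem_schur.1 hs σ

lemma cen_anti {P Q : Set (Equiv.Perm (Fin d))} (h : P ⊆ Q) : cen k m n Q ≤ cen k m n P := by
  intro s hs
  rw [mem_cen] at hs ⊢
  exact fun σ hσ => hs σ (h hσ)

end signs
end Stmt7

open CategoryTheory Finset
set_option synthInstance.maxHeartbeats 1000000
set_option maxHeartbeats 4000000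
set_option linter.all false
namespace Stmt7
open CategoryTheory Abelian

section rs
variable {A B : Type} [Ring A] [Ring B] (ι : A →+* B)

/-- restriction of scalars along `ι` -/
@[reducible] def rsmod (N : Type) [AddCommGroup N] [Module B N] : Module A N := Module.compHom N ι

/-- restriction of linear maps -/
@[reducible] def rsmap {N N' : Type} [AddCommGroup N] [Module B N] [AddCommGroup N'] [Module B N']
    (f : N →ₗ[B] N') : @LinearMap A A _ _ (RingHom.id A) N N' _ _ (rsmod ι N) (rsmod ι N') :=
  letI := rsmod ι N
  letI := rsmod ι N'
  { toFun := f
    map_add' := f.map_add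
    map_smul' := fun a x => f.map_smul (ι a) x }

variable [HasExt.{1} (ModuleCat.{0} A)] {L : ModuleCat.{0} A}

lemma projfs {A B N F : Type} [Ring A] [AddCommGroup B] {hB : Module A B} (h : Module.Projective A B) 
    [AddCommGroup F] {hF : Module A F} (e : (N →₀ B) ≃ₗ[A] F) : Module.Projective A F := by
  classical
  exact Module.Projective.of_equiv ((finsuppLequivDFinsupp A).symm.trans e)

lemma rs_van (hproj : @Module.Projective A _ B _ (rsmod ι B))
    (hhom : ∀ (N : Type) [AddCommGroup N] [Module B N], letI := rsmod ι N; ∀ f : N →ₗ[A] L, f = 0)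
    (t : ℕ) : ∀ (N : Type) [AddCommGroup N] [Module B N], letI := rsmod ι N; Van L N t := by
  induction t with
  | zero =>
    intro N _ _
    letI := rsmod ι N
    exact van_zero_iff.2 (hhom N)
  | succ t ih =>
    intro N _ _
    letI i1 := rsmod ι N
    let F := N →₀ B
    letI i2 : Module A F := rsmod ι F
    let g : F →ₗ[B] N := Finsupp.linearCombination B id
    have hg : Function.Surjective g := Finsupp.linearCombination_id_surjective B N
    let K := LinearMap.ker g
    letI i3 : Module A K := rsmod ι K
    refine Van.right (rsmap ι K.subtype) (rsmap ι g) ?_ ?_ hg (add_comm 1 t) (ih K) ?_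
    · exact Subtype.val_injective
    · intro x
      exact ⟨fun h => ⟨⟨x, h⟩, rfl⟩, by rintro ⟨y, rfl⟩; exact y.2⟩
    · have e : @LinearEquiv A A _ _ (RingHom.id A) (RingHom.id A) _ _ (N →₀ B) F _ _ 
          (@Finsupp.module N B A _ _ (rsmod ι B)) i2 :=
        letI i4 : Module A B := rsmod ι B
        { toFun := id
          invFun := id
          map_add' := fun _ _ => rfl
          map_smul' := fun a x => by
            ext y
            rfl
          left_inv := fun _ => rfl
          right_inv := fun _ => rfl }
      haveI := projfs hproj e
      exact Van.of_projective t

lemma rs_acyc (hproj : @Module.Projective A _ B _ (rsmod ι B))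
    (hhom : ∀ (N : Type) [AddCommGroup N] [Module B N], letI := rsmod ι N; ∀ f : N →ₗ[A] L, f = 0)
    {N N' : Type} [AddCommGroup N] [Module A N] [AddCommGroup N'] [Module B N'] (e : N ≃+ N')
    (he : ∀ (a : A) x, e (a • x) = ι a • e x) : Acyc L N := by
  intro t
  letI := rsmod ι N'
  let e' : N ≃ₗ[A] N' := { e with map_smul' := he }
  exact (rs_van ι hproj hhom t N').of_equiv e'

/-- projectivity from a finite dual basis -/
lemma rs_proj {κ : Type} [Fintype κ] (φ : κ → B → A) (R : κ → B)
    (hadd : ∀ i x y, φ i (x + y) = φ i x + φ i y)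
    (hsm : ∀ i a x, φ i (ι a * x) = a * φ i x)
    (hb : ∀ b, ∑ i, ι (φ i b) * R i = b) : @Module.Projective A _ B _ (rsmod ι B) := by
  letI := rsmod ι B
  let s : B →ₗ[A] (κ → A) :=
    { toFun := fun b i => φ i b
      map_add' := fun x y => funext fun i => hadd i x y
      map_smul' := fun a x => funext fun i => hsm i a x }
  let g : (κ → A) →ₗ[A] B :=
    { toFun := fun c => ∑ i, ι (c i) * R i
      map_add' := fun x y => by simp [add_mul, Finset.sum_add_distrib]
      map_smul' := fun a x => by
        change _ = ι a * _
        simp [Finset.mul_sum, mul_assoc] }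
  refine Module.Projective.of_split s g ?_
  ext b
  exact hb b

end rs

section trace
variable {G M : Type} [Group G] [Finite G] [AddCommGroup M] (ρ : G →* AddMonoid.End M)

open Classical in
/-- sum over cosets -/
noncomputable def trc (H : Subgroup G) (x : M) : M :=
  letI := Fintype.ofFinite (G ⧸ H)
  ∑ c : G ⧸ H, ρ c.out x

lemma rho_out (H : Subgroup G) (x : M) (hx : ∀ h ∈ H, ρ h x = x) (g : G) :
    ρ (QuotientGroup.mk g : G ⧸ H).out x = ρ g x := by
  obtain ⟨h, hh⟩ := QuotientGroup.mk_out_eq_mul H g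
  rw [hh, map_mul]
  change ρ g (ρ h x) = _
  rw [hx h h.2]

lemma trc_inv (H : Subgroup G) (x : M) (hx : ∀ h ∈ H, ρ h x = x) (g : G) :
    ρ g (trc ρ H x) = trc ρ H x := by
  classical
  unfold trc
  letI := Fintype.ofFinite (G ⧸ H)
  rw [map_sum]
  refine Fintype.sum_equiv (MulAction.toPerm g) _ _ fun c => ?_
  induction c using QuotientGroup.induction_on with
  | H a =>
    rw [rho_out ρ H x hx]
    have : (MulAction.toPerm g) (QuotientGroup.mk a : G ⧸ H) = QuotientGroup.mk (g * a) := rfl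
    rw [this, rho_out ρ H x hx, map_mul]
    rfl

lemma trc_add (H : Subgroup G) (x y : M) : trc ρ H (x + y) = trc ρ H x + trc ρ H y := by
  unfold trc
  rw [← Finset.sum_add_distrib]
  exact Finset.sum_congr rfl fun c _ => map_add _ _ _

lemma trc_map (H : Subgroup G) (x : M) (φ : AddMonoid.End M) (h : ∀ g x, ρ g (φ x) = φ (ρ g x)) :
    trc ρ H (φ x) = φ (trc ρ H x) := by
  unfold trc
  rw [map_sum]
  exact Finset.sum_congr rfl fun c _ => h _ _

/-- evaluating the trace when only the trivial coset contributes -/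
lemma trc_eval {M' : Type} [AddCommGroup M'] (H : Subgroup G) (x : M) (hx : ∀ h ∈ H, ρ h x = x)
    (φ : M →+ M') (h0 : ∀ g, g ∉ H → φ (ρ g x) = 0) : φ (trc ρ H x) = φ x := by
  classical
  unfold trc
  letI := Fintype.ofFinite (G ⧸ H)
  rw [map_sum, Finset.sum_eq_single (QuotientGroup.mk 1 : G ⧸ H)]
  · rw [rho_out ρ H x hx, map_one]; rfl
  · intro c _ hc
    apply h0
    intro hm
    apply hc
    rw [← QuotientGroup.out_eq' c, QuotientGroup.eq]
    simpa using hm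
  · intro h; exact absurd (Finset.mem_univ _) h
end trace

end Stmt7

open CategoryTheory Finset
set_option synthInstance.maxHeartbeats 1000000
set_option maxHeartbeats 4000000
set_option linter.all false
namespace Stmt7
open CategoryTheory Abelian

/-- rotation of blocks -/
def brot (X : Type) (N : ℕ) : Equiv.Perm (X × Fin N) := Equiv.prodCongr (Equiv.refl X) (finRotate N)

lemma finRotate_iter (N : ℕ) (M : ℕ) (i : Fin N) : (((finRotate N)^[M]) i).1 = (i.1 + M) % N := by
  cases N with
  | zero => exact i.elim0
  | succ N =>
    induction M with
    | zero => simp [Nat.mod_eq_of_lt i.2]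
    | succ M ih =>
      rw [Function.iterate_succ_apply', finRotate_succ_apply, Fin.val_add, ih]
      simp [Fin.val_one']
      ring_nf

lemma brot_iter (X : Type) (N M : ℕ) (x : X) (i : Fin N) : ((brot X N)^[M]) (x, i) = (x, ((finRotate N)^[M]) i) := by
  induction M generalizing i with
  | zero => rfl
  | succ M ih => rw [Function.iterate_succ_apply, Function.iterate_succ_apply]; exact ih _

section fix
variable (k : Type) [Field k] (p : ℕ) [Fact p.Prime] [CharP k p] {M : Type} [AddCommGroup M] [Module k M]
include k

lemma sum_fixed {Ω : Type} [Fintype Ω] [DecidableEq Ω] (ρ : Equiv.Perm Ω) (j : ℕ) (hρ : ∀ ω, (ρ^[p ^ j]) ω = ω)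
    (u : Ω → M) (hu : ∀ ω, u (ρ ω) = u ω) : ∑ ω, u ω = ∑ ω ∈ univ.filter (fun ω => ρ ω = ω), u ω := by
  classical
  have h1 : ∀ s : Finset Ω, ∑ ω ∈ s, u ω = ∑ c ∈ univ.image u, ((s.filter (fun ω => u ω = c)).card : k) • c := by
    intro s
    have : ∀ ω ∈ s, u ω ∈ univ.image u := fun ω _ => mem_image_of_mem _ (mem_univ _)
    rw [← Finset.sum_fiberwise_of_maps_to this]
    refine Finset.sum_congr rfl fun c _ => ?_
    rw [Nat.cast_smul_eq_nsmul, ← Finset.sum_const]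
    exact Finset.sum_congr rfl fun ω hω => (mem_filter.1 hω).2
  rw [h1, h1]
  refine Finset.sum_congr rfl fun c _ => ?_
  congr 1
  let f : Function.End {ω // u ω = c} := fun ω => ⟨ρ ω.1, by rw [hu]; exact ω.2⟩
  have hf1 : ∀ (N : ℕ) ω, ((f ^ N) ω).1 = (ρ^[N]) ω.1 := by
    intro N
    induction N with
    | zero => intro ω; rfl
    | succ N ih => 
      intro ω
      rw [pow_succ]
      change ((f ^ N) (f ω)).1 = _
      rw [ih]; rfl
  have hf : f ^ p ^ j = 1 := by
    funext ω
    apply Subtype.ext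
    rw [hf1, hρ]; rfl
  have h2 := Equiv.Perm.card_fixedPoints_modEq hf
  have h2 := (CharP.cast_eq_iff_mod_eq k p).2 h2
  have h3 : (univ.filter (fun ω => u ω = c)).card = Fintype.card {ω // u ω = c} := by
    rw [Fintype.card_subtype]
  rw [h3, h2]
  congr 1
  rw [Fintype.card_of_subtype (univ.filter (fun ω : {ω // u ω = c} => f ω = ω))]
  · refine Finset.card_bij (fun ω _ => ω.1) ?_ ?_ ?_
    · intro ω h
      simp only [mem_filter, mem_univ, true_and] at h ⊢
      exact ⟨congrArg Subtype.val h, ω.2⟩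
    · intro a _ b _ h
      exact Subtype.ext h
    · intro ω h
      simp only [mem_filter, mem_univ, true_and] at h
      exact ⟨⟨ω, h.2⟩, by simp only [mem_filter, mem_univ, true_and]; exact Subtype.ext h.1, rfl⟩
  · intro x
    simp [Function.IsFixedPt, Function.fixedPoints]

lemma sum_brot {X B : Type} [Fintype X] [DecidableEq X] [Fintype B] [DecidableEq B] (j : ℕ)
    (u : (X × Fin (p ^ j) → B) → M) (hu : ∀ h, u (h ∘ brot X (p ^ j)) = u h) :
    ∑ h, u h = ∑ h' : X → B, u (h' ∘ Prod.fst) := by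
  have hN : 0 < p ^ j := pow_pos (Fact.out : p.Prime).pos j
  let ρ : Equiv.Perm (X × Fin (p ^ j) → B) := Equiv.arrowCongr (brot X (p ^ j)).symm (Equiv.refl B)
  have hρ : ∀ h, ρ h = h ∘ brot X (p ^ j) := fun h => rfl
  have hρi : ∀ M h, (ρ^[M]) h = h ∘ (brot X (p ^ j))^[M] := by
    intro M
    induction M with
    | zero => intro h; rfl
    | succ M ih => 
      intro h
      rw [Function.iterate_succ_apply, ih, hρ, Function.comp_assoc, Function.iterate_succ']
  rw [sum_fixed k p ρ j ?_ u hu]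
  · refine (Finset.sum_bij (fun h' _ => h' ∘ Prod.fst) ?_ ?_ ?_ ?_).symm
    · intro h' _
      simp only [mem_filter, mem_univ, true_and]
      rfl
    · intro a _ b _ h
      funext x
      exact congrFun h (x, ⟨0, hN⟩)
    · intro h hh
      simp only [mem_filter, mem_univ, true_and] at hh
      refine ⟨fun x => h (x, ⟨0, hN⟩), mem_univ _, ?_⟩
      funext ⟨x, i⟩
      have h1 : ∀ M, (ρ^[M]) h = h := fun M => Function.iterate_fixed hh M
      have h2 := congrFun (h1 i.1) (x, ⟨0, hN⟩)
      rw [hρi] at h2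
      simp only [Function.comp_apply, brot_iter] at h2 ⊢
      rw [← h2]
      congr 2
      apply Fin.ext
      rw [finRotate_iter]
      simp [Nat.mod_eq_of_lt i.2]
    · intro a _; rfl
  · intro h
    rw [hρi]
    funext ⟨x, i⟩
    simp only [Function.comp_apply, brot_iter]
    congr 2
    apply Fin.ext
    rw [finRotate_iter]
    simp [Nat.mod_eq_of_lt i.2]
end fix

end Stmt7

open CategoryTheory Finset
set_option synthInstance.maxHeartbeats 1000000
set_option maxHeartbeats 4000000
set_option linter.all false
namespace Stmt7
open CategoryTheory Abelian

/-- coefficient systems -/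
structure Coef (k : Type) [Field k] (m n d : ℕ) (X : Type) where
  T : Type
  ag : AddCommGroup T
  mo : Module k T
  π : Fin d → X
  hπ : Function.Surjective π
  θ : Module.End k (W k m n d) →ₗ[k] Module.End k T
  R : Equiv.Perm X → Module.End k T
  θ_one : θ 1 = 1
  θ_mul : ∀ s t, s ∈ cen k m n {σ | ∀ i, π (σ i) = π i} → t ∈ cen k m n {σ | ∀ i, π (σ i) = π i} →
    θ (s * t) = θ s * θ t
  R_one : R 1 = 1
  R_mul : ∀ σ τ, R σ * R τ = R (τ * σ)
  comm : ∀ (σ : Equiv.Perm X) b, (∀ τ : Equiv.Perm (Fin d), (∀ i, π (τ i) = σ (π i)) →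
    act k τ * b = b * act k τ) → θ b * R σ = R σ * θ b

attribute [instance] Coef.ag Coef.mo

section
variable {k : Type} [Field k] {m n d : ℕ} {X : Type}

/-- underlying endomorphism -/
def SAlg.e (a : SAlg k m n d) : Module.End k (W k m n d) := Subtype.val (p := fun s => s ∈ Schur k m n d) a
/-- constructor -/
def SAlg.mk (s : Module.End k (W k m n d)) (hs : s ∈ Schur k m n d) : SAlg k m n d := ⟨s, hs⟩
lemma SAlg.mem (a : SAlg k m n d) : a.e ∈ Schur k m n d := Subtype.property (p := fun s => s ∈ Schur k m n d) a
lemma SAlg.e_mk (s : Module.End k (W k m n d)) (hs : s ∈ Schur k m n d) : (SAlg.mk s hs).e = s := rfl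
lemma SAlg.e_mul (a b : SAlg k m n d) : (a * b).e = a.e * b.e := rfl
lemma SAlg.e_add (a b : SAlg k m n d) : (a + b).e = a.e + b.e := rfl
lemma SAlg.e_one : (1 : SAlg k m n d).e = 1 := rfl
lemma SAlg.e_zero : (0 : SAlg k m n d).e = 0 := rfl
lemma SAlg.e_inj {a b : SAlg k m n d} (h : a.e = b.e) : a = b := Subtype.ext h
lemma SAlg.cen (a : SAlg k m n d) (P) : a.e ∈ cen k m n P := schur_le_cen P a.mem
lemma SAlg.comm (a : SAlg k m n d) (σ) : act k σ * a.e = a.e * act k σ := mem_schur.1 a.mem σ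

instance Coef.modA (c : Coef k m n d X) : Module (SAlg k m n d) c.T where
  smul a w := c.θ a.e w
  one_smul w := by change c.θ (1 : SAlg k m n d).e w = w; rw [SAlg.e_one, c.θ_one]; rfl
  mul_smul a b w := by
    change c.θ (a * b).e w = c.θ a.e (c.θ b.e w)
    rw [SAlg.e_mul, c.θ_mul _ _ (a.cen _) (b.cen _)]; rfl
  smul_zero a := map_zero _
  smul_add a x y := map_add _ _ _
  add_smul a b x := by change c.θ (a + b).e x = c.θ a.e x + c.θ b.e x; rw [SAlg.e_add, map_add]; rfl
  zero_smul x := by change c.θ (0 : SAlg k m n d).e x = 0; rw [SAlg.e_zero, map_zero]; rfl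

lemma Coef.smul_def (c : Coef k m n d X) (a : SAlg k m n d) (w : c.T) : a • w = c.θ a.e w := rfl

instance Coef.scc (c : Coef k m n d X) : SMulCommClass k (SAlg k m n d) c.T :=
  ⟨fun x a w => ((c.θ a.e).map_smul x w).symm⟩
instance Coef.scc' (c : Coef k m n d X) : SMulCommClass (SAlg k m n d) k c.T :=
  ⟨fun a x w => ((c.θ a.e).map_smul x w)⟩

lemma Coef.R_smul (c : Coef k m n d X) (a : SAlg k m n d) (σ) (w : c.T) : c.R σ (a • w) = a • c.R σ w := by
  rw [Coef.smul_def, Coef.smul_def, ← Module.End.mul_apply, ← c.comm σ a.e (fun τ _ => a.comm τ)]; rfl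

lemma Coef.R_R (c : Coef k m n d X) (σ τ) (w : c.T) : c.R σ (c.R τ w) = c.R (τ * σ) w := by
  rw [← c.R_mul]; rfl

lemma Coef.R_inv (c : Coef k m n d X) (σ) (w : c.T) : c.R σ (c.R σ⁻¹ w) = w := by
  rw [c.R_R, inv_mul_cancel, c.R_one]; rfl

variable (k m n d) in
/-- level zero -/
def coef0 : Coef k m n d (Fin d) where
  T := W k m n d
  ag := inferInstance
  mo := inferInstance
  π := id
  hπ := Function.surjective_id
  θ := LinearMap.id
  R := act k
  θ_one := rfl
  θ_mul := fun _ _ _ _ => rfl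
  R_one := LinearMap.ext act_one
  R_mul := act_mul_act
  comm := fun σ b h => (h σ (fun _ => rfl)).symm
end

section TT
variable {k : Type} [Field k] {m n d : ℕ} {X : Type} {p : ℕ} {j : ℕ}

/-- even block word -/
def hat (e : Fin d ≃ X × Fin (p ^ (j+1))) (g : X → Fin m) : Fin d → BIdx m n := fun i => Sum.inl (g (e i).1)

/-- general block word -/
def hatb (e : Fin d ≃ X × Fin (p ^ (j+1))) (g : X → BIdx m n) : Fin d → BIdx m n := fun i => g (e i).1

lemma hat_par (e : Fin d ≃ X × Fin (p ^ (j+1))) (g : X → Fin m) (i) : bpar (hat (n := n) e g i) = false := rfl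

variable [hp : Fact p.Prime] [CharP k p]

lemma two_ne (h2 : 2 < p) : (2 : k) ≠ 0 := by
  intro h
  have := (CharP.cast_eq_zero_iff k p 2).1 (by exact_mod_cast h)
  exact absurd (Nat.le_of_dvd (by norm_num) this) (by omega)

variable [Fintype X] [DecidableEq X]

lemma fib_zero {M : Type} [AddCommGroup M] [Module k M] (h2 : 2 < p) (e : Fin d ≃ X × Fin (p ^ (j+1)))
    (v : (Fin d → BIdx m n) → M)
    (hv : ∀ σ : Equiv.Perm (Fin d), (∀ i, (e (σ i)).1 = (e i).1) → ∀ h, v (h ∘ σ) = sg k σ (h ∘ σ) • v h)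
    (h : X → BIdx m n) (x : X) (hx : bpar (h x) = true) : v (hatb e h) = 0 := by
  have hN : 1 < p ^ (j+1) := Nat.one_lt_pow (by omega) hp.out.one_lt
  let a := e.symm (x, ⟨0, by omega⟩)
  let b := e.symm (x, ⟨1, hN⟩)
  have hab : a ≠ b := by
    intro h
    have := e.symm.injective h
    simp at this
  have hea : (e a).1 = x := by simp [a]
  have heb : (e b).1 = x := by simp [b]
  have hfib : ∀ i, (e (Equiv.swap a b i)).1 = (e i).1 := by
    intro i
    by_cases h1 : i = a
    · rw [h1, Equiv.swap_apply_left, hea, heb]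
    · by_cases h2 : i = b
      · rw [h2, Equiv.swap_apply_right, hea, heb]
      · rw [Equiv.swap_apply_of_ne_of_ne h1 h2]
  have h1 := hv (Equiv.swap a b) hfib (hatb e h)
  have h3 : hatb e h ∘ Equiv.swap a b = hatb e h := by
    funext i
    simp only [Function.comp_apply, hatb, hfib]
  rw [h3, sg_swap a b hab _ (by simp only [hatb, hea, hx]) (by simp only [hatb, heb, hx])] at h1
  have h4 : (2 : k) • v (hatb e h) = 0 := by 
    rw [two_smul]
    nth_rewrite 1 [h1]
    simp
  exact (smul_eq_zero.1 h4).resolve_left (two_ne h2)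

variable (k) in
lemma inv_sum {M : Type} [AddCommGroup M] [Module k M] (e : Fin d ≃ X × Fin (p ^ (j+1)))
    (u : (Fin d → BIdx m n) → M)
    (hu : ∀ σ : Equiv.Perm (Fin d), (∀ i, (e (σ i)).1 = (e i).1) → ∀ h, u (h ∘ σ) = u h)
    (h0 : ∀ (h : X → BIdx m n) (x : X), bpar (h x) = true → u (hatb e h) = 0) :
    ∑ h, u h = ∑ f : X → Fin m, u (hat e f) := by
  let E : (Fin d → BIdx m n) ≃ (X × Fin (p ^ (j+1)) → BIdx m n) := Equiv.arrowCongr e (Equiv.refl _)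
  rw [← Equiv.sum_comp E.symm]
  have hE : ∀ h, E.symm h = h ∘ e := fun h => rfl
  simp only [hE]
  rw [sum_brot k p (j+1) (fun h => u (h ∘ e))]
  · refine (Finset.sum_of_injOn (fun f => (Sum.inl ∘ f : X → BIdx m n)) ?_ ?_ ?_ ?_).symm
    · intro f _ f' _ h
      funext x
      exact Sum.inl_injective (congrFun h x)
    · intro _ _; exact mem_univ _
    · intro f _ hf
      have : ∃ x, bpar (f x) = true := by
        by_contra hc
        push Not at hc
        apply hf
        have : ∀ x, ∃ y, f x = Sum.inl y := by
          intro x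
          have := hc x
          cases hfx : f x with
          | inl y => exact ⟨y, rfl⟩
          | inr y => rw [hfx] at this; exact absurd rfl this
        choose F hF using this
        exact ⟨F, by simp, (funext hF).symm⟩
      obtain ⟨x, hx⟩ := this
      exact h0 f x hx
    · intro f _
      rfl
  · intro h
    let σ : Equiv.Perm (Fin d) := (e.trans (brot X (p ^ (j+1)))).trans e.symm
    have hσ : ∀ i, (e (σ i)).1 = (e i).1 := by
      intro i; simp [σ, brot]
    have h1 : (h ∘ brot X (p ^ (j+1))) ∘ e = (h ∘ e) ∘ σ := by
      funext i; simp [σ]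
    rw [h1, hu σ hσ]

lemma hat_sum (h2 : 2 < p) (e : Fin d ≃ X × Fin (p ^ (j+1))) (s : Module.End k (W k m n d))
    (hs : s ∈ cen k m n {σ | ∀ i, (e (σ i)).1 = (e i).1}) (v : (Fin d → BIdx m n) → k)
    (hv : ∀ σ : Equiv.Perm (Fin d), (∀ i, (e (σ i)).1 = (e i).1) → ∀ h, v (h ∘ σ) = sg k σ (h ∘ σ) * v h)
    (g : X → Fin m) : ∑ h, mc s (hat e g) h * v h = ∑ f : X → Fin m, mc s (hat e g) (hat e f) * v (hat e f) := by
  rw [mem_cen] at hs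
  refine inv_sum k e (fun h => mc s (hat e g) h * v h) ?_ ?_
  · intro σ hσ h
    have h3 : hat (n := n) e g = hat e g ∘ σ := by
      funext i; simp [hat, hσ]
    rw [hv σ hσ, h3, mc_perm (hs σ hσ), ← h3, sg_even σ (hat e g) (hat_par e g)]
    have := sg_sq (k := k) σ (h ∘ σ)
    linear_combination (mc s (hat e g) h * v h) * this
  · intro h x hx
    rw [fib_zero (k := k) h2 e v hv h x hx, mul_zero]

/-- block coefficient system -/
def coefT (h2 : 2 < p) (e : Fin d ≃ X × Fin (p ^ (j+1))) : Coef k m n d X where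
  T := (X → Fin m) → k
  ag := inferInstance
  mo := inferInstance
  π := fun i => (e i).1
  hπ := fun x => ⟨e.symm (x, ⟨0, pow_pos hp.out.pos _⟩), by simp⟩
  θ := 
    { toFun := fun s => 
        { toFun := fun F g => ∑ f : X → Fin m, mc s (hat e g) (hat e f) * F f
          map_add' := fun F G => funext fun g => by simp [mul_add, Finset.sum_add_distrib]
          map_smul' := fun c F => funext fun g => by simp [Finset.mul_sum, mul_left_comm] }
      map_add' := fun s t => LinearMap.ext fun F => funext fun g => by
        change ∑ f : X → Fin m, (mc s (hat e g) (hat e f) + mc t (hat e g) (hat e f)) * F f = 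
          (∑ f : X → Fin m, mc s (hat e g) (hat e f) * F f) + ∑ f : X → Fin m, mc t (hat e g) (hat e f) * F f
        simp [add_mul, Finset.sum_add_distrib]
      map_smul' := fun c s => LinearMap.ext fun F => funext fun g => by
        change ∑ f : X → Fin m, (c * mc s (hat e g) (hat e f)) * F f = 
          c * ∑ f : X → Fin m, mc s (hat e g) (hat e f) * F f
        simp [Finset.mul_sum, mul_assoc] }
  R := fun σ => 
    { toFun := fun F g => F (g ∘ ⇑σ⁻¹)
      map_add' := fun _ _ => rfl
      map_smul' := fun _ _ => rfl }
  θ_one := LinearMap.ext fun F => funext fun g => by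
    change ∑ f : X → Fin m, mc 1 (hat (n := n) e g) (hat e f) * F f = F g
    rw [Finset.sum_eq_single g]
    · have : mc (1 : Module.End k (W k m n d)) (hat e g) (hat e g) = 1 := by
        unfold mc; rw [Module.End.one_apply, wd_apply, if_pos rfl]
      rw [this, one_mul]
    · intro f _ hf
      have : mc (1 : Module.End k (W k m n d)) (hat e g) (hat e f) = 0 := by
        unfold mc; rw [Module.End.one_apply, wd_apply, if_neg]
        intro h
        apply hf
        funext x
        have := congrFun h (e.symm (x, ⟨0, pow_pos hp.out.pos _⟩))
        simp only [hat, Equiv.apply_symm_apply, Sum.inl.injEq] at this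
        exact this.symm
      rw [this, zero_mul]
    · intro h; exact absurd (mem_univ _) h
  θ_mul := fun s t hs ht => LinearMap.ext fun F => funext fun g => by
    change ∑ f : X → Fin m, mc (s * t) (hat (n := n) e g) (hat e f) * F f = 
      ∑ f' : X → Fin m, mc s (hat e g) (hat e f') * ∑ f : X → Fin m, mc t (hat e f') (hat e f) * F f
    simp only [Finset.mul_sum]
    rw [Finset.sum_comm]
    refine Finset.sum_congr rfl fun f _ => ?_
    rw [mc_mul, hat_sum h2 e s hs (fun h => mc t h (hat e f)), Finset.sum_mul]
    · simp only [mul_assoc]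
    · intro σ hσ h
      have h3 : hat (n := n) e f = hat e f ∘ σ := by
        funext i; simp [hat, hσ]
      conv_lhs => rw [h3]
      rw [mc_perm (mem_cen.1 ht σ hσ), ← h3, sg_even σ (hat e f) (hat_par e f), one_mul]
  R_one := rfl
  R_mul := fun _ _ => rfl
  comm := fun σ b hb => LinearMap.ext fun F => funext fun g => by
    change ∑ f : X → Fin m, mc b (hat (n := n) e g) (hat e f) * F (f ∘ ⇑σ⁻¹) = 
      ∑ f : X → Fin m, mc b (hat e (g ∘ ⇑σ⁻¹)) (hat e f) * F f
    rw [← Equiv.sum_comp (Equiv.arrowCongr σ (Equiv.refl (Fin m))) (fun f => mc b (hat e (g ∘ ⇑σ⁻¹)) (hat e f) * F f)]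
    refine Finset.sum_congr rfl fun f _ => ?_
    have hE : (Equiv.arrowCongr σ (Equiv.refl (Fin m))) f = f ∘ ⇑σ⁻¹ := rfl
    rw [hE]
    congr 1
    let τ : Equiv.Perm (Fin d) := (e.trans (Equiv.prodCongr σ (Equiv.refl _))).trans e.symm
    have hτ : ∀ i, (e (τ i)).1 = σ (e i).1 := by
      intro i; simp [τ]
    have h3 : ∀ g : X → Fin m, hat (n := n) e g = hat e (g ∘ ⇑σ⁻¹) ∘ τ := by
      intro g; funext i; simp [hat, hτ]
    rw [h3 g, h3 f, mc_perm (hb τ hτ), ← h3, ← h3, sg_even τ _ (hat_par e _), sg_even τ _ (hat_par e _)]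
    simp

lemma coefT_smul (h2 : 2 < p) (e : Fin d ≃ X × Fin (p ^ (j+1))) (a : SAlg k m n d) (F : (coefT (k := k) (m := m) (n := n) h2 e).T)
    (g : X → Fin m) : (a • F : (coefT (k := k) (m := m) (n := n) h2 e).T) g = ∑ f : X → Fin m, mc a.e (hat e g) (hat e f) * F f := rfl

lemma coefT_R (h2 : 2 < p) (e : Fin d ≃ X × Fin (p ^ (j+1))) (σ) (F : (coefT (k := k) (m := m) (n := n) h2 e).T)
    (g : X → Fin m) : ((coefT (k := k) (m := m) (n := n) h2 e).R σ F : (coefT (k := k) (m := m) (n := n) h2 e).T) g = F (g ∘ ⇑σ⁻¹) := rfl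
end TT

end Stmt7

open CategoryTheory Finset
set_option synthInstance.maxHeartbeats 1000000
set_option maxHeartbeats 4000000
set_option linter.all false
namespace Stmt7
open CategoryTheory Abelian

section M0
variable {k : Type} [Field k] {m n d : ℕ}

variable (k m n d) in
/-- the relations as a `k`-subspace -/
def symK : Submodule k (W k m n d) :=
  Submodule.span k {x | ∃ (z : W k m n d) (σ : Equiv.Perm (Fin d)), x = z - act k σ z}

lemma algW (c : k) (z : W k m n d) : (algebraMap k (SAlg k m n d) c) • z = c • z := rfl

lemma smulW (a : SAlg k m n d) (z : W k m n d) : a • z = a.e z := rfl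

lemma symK_iff (z : W k m n d) : z ∈ symRel k m n d ↔ z ∈ symK k m n d := by
  constructor
  · intro h
    unfold symRel at h
    induction h using Submodule.span_induction with
    | mem x h => exact Submodule.subset_span h
    | zero => exact zero_mem _
    | add x y _ _ hx hy => exact add_mem hx hy
    | smul a x hx0 hx =>
      clear hx0
      unfold symK at hx
      induction hx using Submodule.span_induction with
      | mem x h =>
        obtain ⟨z, σ, rfl⟩ := h
        refine Submodule.subset_span ⟨a • z, σ, ?_⟩
        rw [smul_sub, smulW, smulW, ← Module.End.mul_apply, ← a.comm]; rfl
      | zero => rw [smul_zero]; exact zero_mem _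
      | add x y _ _ hx hy => rw [smul_add]; exact add_mem hx hy
      | smul c x _ hx =>
        have : a • (c • x) = c • (a • x) := (a.e).map_smul c x
        rw [this]; exact Submodule.smul_mem _ _ hx
  · intro h
    unfold symK at h
    induction h using Submodule.span_induction with
    | mem x h => exact Submodule.subset_span h
    | zero => exact zero_mem _
    | add x y _ _ hx hy => exact add_mem hx hy
    | smul c x _ hx => rw [← algW]; exact Submodule.smul_mem _ _ hx

lemma symMk_eq_iff (z z' : W k m n d) : symMk k m n d z = symMk k m n d z' ↔
    (symK k m n d).mkQ z = (symK k m n d).mkQ z' := by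
  rw [Submodule.mkQ_apply, Submodule.mkQ_apply, Submodule.Quotient.eq, ← symK_iff]
  exact Submodule.Quotient.eq _

lemma mkQ_act (σ) (z : W k m n d) : (symK k m n d).mkQ (act k σ z) = (symK k m n d).mkQ z := by
  symm
  rw [Submodule.mkQ_apply, Submodule.mkQ_apply, Submodule.Quotient.eq]
  exact Submodule.subset_span ⟨z, σ, rfl⟩

lemma mkQ_wd (σ : Equiv.Perm (Fin d)) (h : Fin d → BIdx m n) : 
    (symK k m n d).mkQ (wd k (h ∘ σ)) = sg k σ (h ∘ σ) • (symK k m n d).mkQ (wd k h) := by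
  rw [← mkQ_act σ (wd k h), act_wd, map_smul, smul_smul, sg_sq, one_smul]

variable {p j : ℕ} [hp : Fact p.Prime] [CharP k p] (h2 : 2 < p) (e : Fin d ≃ Unit × Fin (p ^ (j+1)))

/-- the vector of `W` attached to a function -/
def phW : ((Unit → Fin m) → k) →ₗ[k] W k m n d where
  toFun F := ∑ g, F g • wd k (hat e g)
  map_add' F G := by simp [add_smul, Finset.sum_add_distrib]
  map_smul' c F := by simp [mul_smul, Finset.smul_sum]

include h2 in
omit [CharP k p] in
lemma wd_odd [CharP k p] (h : Unit → BIdx m n) (x : Unit) (hx : bpar (h x) = true) :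
    (symK k m n d).mkQ (wd k (hatb e h)) = 0 :=
  fib_zero (k := k) h2 e (fun h => (symK k m n d).mkQ (wd k h)) (fun σ _ h => mkQ_wd σ h) h x hx

/-- the map to `SymQ` -/
def phi : (coefT (k := k) (m := m) (n := n) h2 e).T →ₗ[SAlg k m n d] SymQ k m n d where
  toFun F := symMk k m n d (phW e F)
  map_add' F G := by
    have : phW (k := k) (n := n) e (F + G) = phW e F + phW e G := map_add _ _ _
    rw [this]; rfl
  map_smul' a F := by
    change symMk k m n d (phW e _) = symMk k m n d (a • phW e F)
    rw [symMk_eq_iff, smulW]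
    change (symK k m n d).mkQ (∑ g, (∑ f : Unit → Fin m, mc a.e (hat e g) (hat e f) * F f) • wd k (hat e g)) = 
      (symK k m n d).mkQ (a.e (∑ f, F f • wd k (hat e f)))
    simp only [map_sum, map_smul, Finset.sum_smul]
    rw [Finset.sum_comm]
    refine Finset.sum_congr rfl fun f _ => ?_
    simp only [mul_comm _ (F f), mul_smul]
    rw [← Finset.smul_sum]
    congr 1
    rw [w_sum (a.e (wd k (hat e f))), map_sum]
    simp only [map_smul]
    symm
    refine inv_sum k e (fun h => (a.e (wd k (hat e f))) h • (symK k m n d).mkQ (wd k h)) ?_ ?_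
    · intro σ hσ h
      change mc a.e (h ∘ σ) (hat e f) • _ = mc a.e h (hat e f) • _
      have h3 : hat (n := n) e f = hat e f ∘ σ := by
        funext i; simp [hat, hσ]
      conv_lhs => rw [h3]
      rw [mc_perm (a.comm σ), ← h3, sg_even σ (hat e f) (hat_par e f), mkQ_wd, smul_smul, one_mul, mul_right_comm, sg_sq, one_mul]
    · intro h x hx
      change _ • (symK k m n d).mkQ (wd k (hatb e h)) = 0
      rw [wd_odd h2 e h x hx, smul_zero]

lemma phi_inj : Function.Injective (phi (k := k) (m := m) (n := n) h2 e) := by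
  intro F G h
  change symMk k m n d (phW e F) = symMk k m n d (phW e G) at h
  rw [symMk_eq_iff, Submodule.mkQ_apply, Submodule.mkQ_apply, Submodule.Quotient.eq] at h
  funext g
  have hk : symK k m n d ≤ LinearMap.ker (wev k (hat e g)) := by
    unfold symK
    rw [Submodule.span_le]
    rintro x ⟨z, σ, rfl⟩
    simp only [SetLike.mem_coe, LinearMap.mem_ker, map_sub]
    rw [wev_apply, wev_apply, act_apply, sg_even _ _ (hat_par e g), one_mul]
    have : hat (n := n) e g ∘ ⇑σ⁻¹ = hat e g := by
      funext i; simp [hat]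
    rw [this, sub_self]
  have h1 := hk h
  rw [LinearMap.mem_ker, map_sub, sub_eq_zero] at h1
  have h3 : ∀ F : (Unit → Fin m) → k, wev k (hat (n := n) e g) (phW e F) = F g := by
    intro F
    change wev k (hat e g) (∑ g, F g • wd k (hat e g)) = F g
    rw [map_sum, Finset.sum_eq_single g]
    · rw [map_smul, wev_apply, wd_apply, if_pos rfl, smul_eq_mul, mul_one]
    · intro f _ hf
      rw [map_smul, wev_apply, wd_apply, if_neg, smul_zero]
      intro h
      apply hf
      funext x
      have := congrFun h (e.symm (x, ⟨0, pow_pos hp.out.pos _⟩))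
      simp only [hat, Equiv.apply_symm_apply, Sum.inl.injEq] at this
      exact this.symm
    · intro h; exact absurd (mem_univ _) h
  exact (h3 F).symm.trans (h1.trans (h3 G))

lemma phi_range : LinearMap.range (phi (k := k) (m := m) (n := n) h2 e) = M0 k m n d := by
  apply le_antisymm
  · rintro _ ⟨F, rfl⟩
    change symMk k m n d (∑ g, F g • wd k (hat e g)) ∈ _
    have : symMk k m n d (∑ g, F g • wd k (hat e g)) = ∑ g, (algebraMap k (SAlg k m n d) (F g)) • symMk k m n d (wd k (hat e g)) := 
      map_sum (symRel k m n d).mkQ _ _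
    rw [this]
    refine sum_mem fun g _ => Submodule.smul_mem _ _ (Submodule.subset_span ⟨Pi.single (Sum.inl (g ())) 1, ?_, ?_⟩)
    · intro i; simp
    · congr 1
      funext f
      rw [wd_apply]
      unfold tpow ptensor
      simp only [Pi.single_apply]
      rw [Finset.prod_ite_zero]
      simp only [Finset.prod_const_one]
      refine if_congr ?_ rfl rfl
      constructor
      · rintro rfl i _; rfl
      · intro h; funext i; exact h i (mem_univ _)
  · unfold M0
    rw [Submodule.span_le]
    rintro _ ⟨v, hv, rfl⟩
    refine ⟨fun g => ∏ i, v (hat e g i), ?_⟩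
    change symMk k m n d (∑ g, (∏ i, v (hat e g i)) • wd k (hat e g)) = _
    rw [symMk_eq_iff, w_sum (tpow k m n d v), map_sum, map_sum]
    simp only [map_smul]
    symm
    refine inv_sum k e (fun h => (∏ i, v (h i)) • (symK k m n d).mkQ (wd k h)) ?_ ?_
    · intro σ hσ h
      simp only [Function.comp_apply]
      rw [Equiv.prod_comp σ (fun i => v (h i)), mkQ_wd]
      by_cases hh : ∃ i, bpar (h i) = true
      · obtain ⟨i, hi⟩ := hh
        have : ∏ i, v (h i) = 0 := by
          apply Finset.prod_eq_zero (mem_univ i)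
          cases hhi : h i with
          | inl x => rw [hhi] at hi; exact absurd hi (by simp [bpar])
          | inr x => exact hv x
        rw [this, zero_smul, zero_smul]
      · push Not at hh
        rw [sg_even, one_smul]
        intro i
        simpa using hh (σ i)
    · intro h x hx
      change _ • (symK k m n d).mkQ (wd k (hatb e h)) = 0
      rw [wd_odd h2 e h x hx, smul_zero]

/-- the identification of `M₀` -/
noncomputable def M0equiv : (coefT (k := k) (m := m) (n := n) h2 e).T ≃ₗ[SAlg k m n d] M0 k m n d :=
  (LinearEquiv.ofInjective _ (phi_inj h2 e)).trans (LinearEquiv.ofEq _ _ (phi_range h2 e))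
end M0
end Stmt7

open CategoryTheory Finset
set_option synthInstance.maxHeartbeats 1000000
set_option maxHeartbeats 4000000
set_option linter.all false
namespace Stmt7
open CategoryTheory Abelian

section B
variable {k : Type} [Field k] {m n d : ℕ}

/-- endomorphism from a matrix -/
def ofm (M : (Fin d → BIdx m n) → (Fin d → BIdx m n) → k) : Module.End k (W k m n d) where
  toFun x := fun g => ∑ f, M g f * x f
  map_add' x y := funext fun g => by
    change ∑ f, M g f * (x f + y f) = (∑ f, M g f * x f) + ∑ f, M g f * y f
    simp [mul_add, Finset.sum_add_distrib]
  map_smul' c x := funext fun g => by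
    change ∑ f, M g f * (c * x f) = c * ∑ f, M g f * x f
    simp [Finset.mul_sum, mul_left_comm]

lemma mc_ofm (M : (Fin d → BIdx m n) → (Fin d → BIdx m n) → k) (g f) : mc (ofm M) g f = M g f := by
  change ∑ f', M g f' * wd k f f' = _
  rw [Finset.sum_eq_single f]
  · rw [wd_apply, if_pos rfl, mul_one]
  · intro f' _ h; rw [wd_apply, if_neg h, mul_zero]
  · intro h; exact absurd (mem_univ _) h

lemma mc_ext {s t : Module.End k (W k m n d)} (h : ∀ g f, mc s g f = mc t g f) : s = t :=
  W_ext fun f => funext fun g => h g f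

lemma end_wd (s : Module.End k (W k m n d)) (f) : s (wd k f) = ∑ g, mc s g f • wd k g := w_sum _

/-- block-preserving permutations -/
def stb (S : Set (Fin d)) : Set (Equiv.Perm (Fin d)) := {σ | ∀ i, σ i ∈ S ↔ i ∈ S}

/-- as a subgroup -/
def stbg (S : Set (Fin d)) : Subgroup (Equiv.Perm (Fin d)) where
  carrier := stb S
  mul_mem' {σ τ} hσ hτ := fun i => (hσ (τ i)).trans (hτ i)
  one_mem' := fun i => Iff.rfl
  inv_mem' {σ} hσ := fun i => by
    have := hσ (σ⁻¹ i)
    rw [perm_apply_inv_self] at this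
    exact this.symm

variable (k m n d) in
/-- conjugation -/
def cnj : Equiv.Perm (Fin d) →* AddMonoid.End (Module.End k (W k m n d)) where
  toFun σ := 
    { toFun := fun x => act k σ⁻¹ * x * act k σ
      map_zero' := by simp
      map_add' := fun x y => by simp [mul_add, add_mul] }
  map_one' := by
    ext x : 1
    change act k 1⁻¹ * x * act k 1 = x
    have : (act k (1 : Equiv.Perm (Fin d)) : Module.End k (W k m n d)) = 1 := LinearMap.ext act_one
    rw [inv_one, this, one_mul, mul_one]
  map_mul' σ τ := by
    ext x : 1
    change act k (σ * τ)⁻¹ * x * act k (σ * τ) = act k σ⁻¹ * (act k τ⁻¹ * x * act k τ) * act k σ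
    rw [mul_inv_rev, ← act_mul_act, ← act_mul_act]
    simp only [mul_assoc]

lemma cnj_apply (σ) (x : Module.End k (W k m n d)) : cnj k m n d σ x = act k σ⁻¹ * x * act k σ := rfl

lemma cnj_iff (σ) (x : Module.End k (W k m n d)) : cnj k m n d σ x = x ↔ act k σ * x = x * act k σ := by
  rw [cnj_apply]
  have h1 : (act k σ : Module.End k (W k m n d)) * act k σ⁻¹ = 1 := by
    rw [act_mul_act, inv_mul_cancel]; exact LinearMap.ext act_one
  have h2 : (act k σ⁻¹ : Module.End k (W k m n d)) * act k σ = 1 := by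
    rw [act_mul_act, mul_inv_cancel]; exact LinearMap.ext act_one
  constructor
  · intro h
    conv_lhs => rw [← h]
    rw [← mul_assoc, ← mul_assoc, h1, one_mul]
  · intro h
    rw [mul_assoc, ← h, ← mul_assoc, h2, one_mul]

lemma exists_tau (hm : d ≤ m) (hn : d ≤ n) (hd : 0 < d) (I : Finset (BIdx m n × Bool)) :
    ∃ τ : BIdx m n × Bool → BIdx m n, (∀ x, bpar (τ x) = bpar x.1) ∧ (I.card ≤ d → Set.InjOn τ I) := by
  classical
  by_cases hI : I.card ≤ d
  · have h1 : Nonempty (I ↪ Fin m) := Function.Embedding.nonempty_of_card_le (by simp; omega)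
    have h2 : Nonempty (I ↪ Fin n) := Function.Embedding.nonempty_of_card_le (by simp; omega)
    obtain ⟨u⟩ := h1
    obtain ⟨w⟩ := h2
    refine ⟨fun x => if bpar x.1 = true then Sum.inr (if h : x ∈ I then w ⟨x, h⟩ else ⟨0, by omega⟩)
      else Sum.inl (if h : x ∈ I then u ⟨x, h⟩ else ⟨0, by omega⟩), ?_, ?_⟩
    · intro x
      by_cases h : bpar x.1 = true
      · simp only [h, if_true]; rfl
      · rw [Bool.not_eq_true] at h; simp only [h]; rfl
    · intro _ x hx y hy hxy
      have hx' : x ∈ I := hx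
      have hy' : y ∈ I := hy
      simp only [hx', hy', dif_pos] at hxy
      split_ifs at hxy
      · have := w.injective (Sum.inr_injective hxy)
        exact congrArg Subtype.val this
      · have := u.injective (Sum.inl_injective hxy)
        exact congrArg Subtype.val this
  · exact ⟨Prod.fst, fun _ => rfl, fun h => absurd h hI⟩

open Classical in
/-- word with marking -/
noncomputable def mkd (S : Set (Fin d)) (f : Fin d → BIdx m n) : Fin d → BIdx m n × Bool :=
  fun i => (f i, decide (i ∈ S))

lemma mkd_comp (S : Set (Fin d)) (f : Fin d → BIdx m n) {σ} (hσ : σ ∈ stb S) : mkd S (f ∘ σ) = mkd S f ∘ σ := by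
  funext i
  simp only [mkd, Function.comp_apply]
  congr 2
  exact propext (hσ i).symm

lemma mkd_inj (S : Set (Fin d)) {f f' : Fin d → BIdx m n} (h : mkd S f = mkd S f') : f = f' :=
  funext fun i => congrArg Prod.fst (congrFun h i)

section
variable (S : Set (Fin d)) (τ : BIdx m n × Bool → BIdx m n) (I : Finset (BIdx m n × Bool))

open Classical in
/-- the matrix -/
noncomputable def RM (g f : Fin d → BIdx m n) : k :=
  if univ.image (mkd S f) = I ∧ g = τ ∘ mkd S f then 1 else 0

lemma RM_perm (hτ : ∀ x, bpar (τ x) = bpar x.1) {σ} (hσ : σ ∈ stb S) (g f : Fin d → BIdx m n) :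
    (RM S τ I (g ∘ σ) (f ∘ σ) : k) = sg k σ (f ∘ σ) * sg k σ (g ∘ σ) * RM S τ I g f := by
  unfold RM
  rw [mkd_comp S f hσ]
  have h1 : univ.image (mkd S f ∘ σ) = univ.image (mkd S f) := by
    ext x
    simp only [mem_image, mem_univ, true_and, Function.comp_apply]
    exact ⟨fun ⟨a, h⟩ => ⟨_, h⟩, fun ⟨a, h⟩ => ⟨σ⁻¹ a, by rw [perm_apply_inv_self]; exact h⟩⟩
  have h2 : g ∘ σ = τ ∘ mkd S f ∘ σ ↔ g = τ ∘ mkd S f := by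
    rw [← Function.comp_assoc]
    exact σ.surjective.injective_comp_right.eq_iff
  rw [h1]
  simp only [h2]
  split_ifs with h
  · have : sg k σ (g ∘ σ) = sg k σ (f ∘ σ) := by
      apply sg_congr
      intro i
      rw [h.2]
      exact hτ _
    rw [this, sg_sq, one_mul]
  · rw [mul_zero]

lemma RI_mem (hτ : ∀ x, bpar (τ x) = bpar x.1) : ofm (RM S τ I) ∈ cen k m n (stb S) := by
  rw [mem_cen]
  intro σ hσ
  apply commute_of_mc
  intro g f
  rw [mc_ofm, mc_ofm, RM_perm S τ I hτ hσ]

lemma RI'_mem (hτ : ∀ x, bpar (τ x) = bpar x.1) : ofm (fun g f => RM S τ I f g) ∈ cen k m n (stb S) := by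
  rw [mem_cen]
  intro σ hσ
  apply commute_of_mc
  intro g f
  rw [mc_ofm, mc_ofm, RM_perm S τ I hτ hσ, mul_comm (sg k σ (f ∘ σ))]

/-- coefficient functional -/
noncomputable def phiI (b : Module.End k (W k m n d)) : Module.End k (W k m n d) :=
  trc (cnj k m n d) (stbg S) (b * ofm (fun g f => RM S τ I f g))

lemma phiI_mem (hτ : ∀ x, bpar (τ x) = bpar x.1) {b} (hb : b ∈ cen k m n (stb S)) :
    phiI S τ I b ∈ Schur k m n d := by
  rw [mem_schur]
  intro σ
  rw [← cnj_iff]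
  apply trc_inv
  intro h hh
  rw [cnj_iff]
  exact mem_cen.1 (mul_mem hb (RI'_mem S τ I hτ)) h hh

lemma phiI_eval (hτ : ∀ x, bpar (τ x) = bpar x.1) {b} (hb : b ∈ cen k m n (stb S)) (f : Fin d → BIdx m n)
    (hf : univ.image (mkd S f) = I) (hinj : Set.InjOn τ I) : phiI S τ I b (wd k (τ ∘ mkd S f)) = b (wd k f) := by
  have key : ∀ σ : Equiv.Perm (Fin d), ∀ f', (RM S τ I ((τ ∘ mkd S f) ∘ σ) f' : k) ≠ 0 → mkd S f' = mkd S f ∘ σ := by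
    intro σ f' h
    unfold RM at h
    split_ifs at h with h'
    · funext i
      apply hinj
      · rw [← h'.1]; simp
      · rw [← hf]; simp
      · have := congrFun h'.2 i
        exact this.symm
    · exact absurd rfl h
  let ev : Module.End k (W k m n d) →+ W k m n d := 
    { toFun := fun s => s (wd k (τ ∘ mkd S f)), map_zero' := rfl, map_add' := fun _ _ => rfl }
  have h1 := trc_eval (cnj k m n d) (stbg S) (b * ofm (fun g f => RM S τ I f g)) (by
    intro h hh
    rw [cnj_iff]
    exact mem_cen.1 (mul_mem hb (RI'_mem S τ I hτ)) h hh) ev (by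
    intro σ hσ
    change (act k σ⁻¹ * (b * ofm (fun g f => RM S τ I f g)) * act k σ : Module.End k (W k m n d)) (wd k (τ ∘ mkd S f)) = 0
    rw [Module.End.mul_apply, act_wd, Module.End.mul_apply, Module.End.mul_apply, map_smul, end_wd]
    rw [Finset.sum_eq_zero]
    · simp
    · intro f' _
      rw [mc_ofm]
      by_contra hne
      have := key σ f' (fun h => hne (by rw [h, zero_smul]))
      apply hσ
      intro i
      have h3 := congrArg Prod.snd (congrFun this i)
      simp only [mkd, Function.comp_apply, decide_eq_decide] at h3
      exact h3.symm)
  change ev (phiI S τ I b) = _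
  unfold phiI
  rw [h1]
  change b (ofm _ (wd k (τ ∘ mkd S f))) = _
  congr 1
  rw [end_wd, Finset.sum_eq_single f]
  · rw [mc_ofm]
    unfold RM
    rw [if_pos ⟨hf, rfl⟩, one_smul]
  · intro f' _ hne
    rw [mc_ofm]
    by_contra h
    have := key 1 f' (fun h' => h (by 
      have : (τ ∘ mkd S f) ∘ (1 : Equiv.Perm (Fin d)) = τ ∘ mkd S f := rfl
      rw [this] at h'
      rw [h', zero_smul]))
    exact hne (mkd_inj S this)
  · intro h; exact absurd (mem_univ _) h
end

/-- inclusion of the Schur algebra -/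
def inB (S : Set (Fin d)) : SAlg k m n d →+* cen k m n (stb S) where
  toFun a := ⟨a.e, a.cen _⟩
  map_one' := rfl
  map_mul' _ _ := rfl
  map_zero' := rfl
  map_add' _ _ := rfl

lemma B_proj (hm : d ≤ m) (hn : d ≤ n) (S : Set (Fin d)) (hd : 0 < d) :
    @Module.Projective (SAlg k m n d) _ (cen k m n (stb S)) _ (rsmod (inB S) _) := by
  choose τ hτ hinj using exists_tau hm hn hd
  refine rs_proj (inB S) (κ := Finset (BIdx m n × Bool)) 
    (fun I b => SAlg.mk (phiI S (τ I) I b.1) (phiI_mem S (τ I) I (hτ I) b.2)) 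
    (fun I => ⟨ofm (RM S (τ I) I), RI_mem S (τ I) I (hτ I)⟩) ?_ ?_ ?_
  · intro I x y
    apply SAlg.e_inj
    change phiI S (τ I) I (x.1 + y.1) = phiI S (τ I) I x.1 + phiI S (τ I) I y.1
    unfold phiI
    rw [add_mul, trc_add]
  · intro I a x
    apply SAlg.e_inj
    change phiI S (τ I) I (a.e * x.1) = a.e * phiI S (τ I) I x.1
    unfold phiI
    rw [mul_assoc]
    refine trc_map (cnj k m n d) (stbg S) _ (AddMonoidHom.mulLeft a.e) ?_
    intro σ x
    change act k σ⁻¹ * (a.e * x) * act k σ = a.e * (act k σ⁻¹ * x * act k σ)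
    rw [← mul_assoc, a.comm]
    simp only [mul_assoc]
  · intro b
    apply Subtype.ext
    have : (∑ I, (inB S) (SAlg.mk (phiI S (τ I) I b.1) (phiI_mem S (τ I) I (hτ I) b.2)) * 
      (⟨ofm (RM S (τ I) I), RI_mem S (τ I) I (hτ I)⟩ : cen k m n (stb S))).1 = 
      ∑ I, phiI S (τ I) I b.1 * ofm (RM S (τ I) I) := map_sum (cen k m n (stb S)).val _ _
    rw [this]
    apply W_ext
    intro f
    classical
    rw [LinearMap.sum_apply, Finset.sum_eq_single (univ.image (mkd S f))]
    · rw [Module.End.mul_apply, end_wd (ofm _), Finset.sum_eq_single (τ (univ.image (mkd S f)) ∘ mkd S f)]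
      · rw [mc_ofm]
        unfold RM
        rw [if_pos ⟨rfl, rfl⟩, one_smul]
        apply phiI_eval _ _ _ (hτ _) b.2 f rfl
        apply hinj
        refine Finset.card_image_le.trans ?_
        simp
      · intro g _ hg
        rw [mc_ofm]
        unfold RM
        rw [if_neg (fun h => hg h.2), zero_smul]
      · intro h; exact absurd (mem_univ _) h
    · intro I _ hI
      rw [Module.End.mul_apply, end_wd (ofm _), Finset.sum_eq_zero, map_zero]
      intro g _
      rw [mc_ofm]
      unfold RM
      rw [if_neg (fun h => hI h.1.symm), zero_smul]
    · intro h; exact absurd (mem_univ _) h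

section
variable {p j : ℕ} [hp : Fact p.Prime] [CharP k p] (h2 : 2 < p) (e : Fin d ≃ Unit × Fin (p ^ (j+1)))
include h2 e

open Classical in
lemma B_hom (hm : d ≤ m) (S : Set (Fin d)) (hS1 : ∃ i, i ∈ S) (hS2 : ∃ i, i ∉ S)
    (N : Type) [AddCommGroup N] [Module (cen k m n (stb S)) N] :
    letI := rsmod (inB (k := k) (m := m) (n := n) S) N; ∀ f : N →ₗ[SAlg k m n d] M0cat k m n d, f = 0 := by
  letI := rsmod (inB (k := k) (m := m) (n := n) S) N
  intro f
  obtain ⟨a, ha⟩ := hS1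
  obtain ⟨b, hb⟩ := hS2
  have hm2 : 1 < m := by
    have hab : a ≠ b := fun h => hb (h ▸ ha)
    have : a.1 ≠ b.1 := fun h => hab (Fin.ext h)
    have := a.2
    have := b.2
    omega
  let f' : N →ₗ[SAlg k m n d] (coefT (k := k) (m := m) (n := n) h2 e).T := (M0equiv h2 e).symm.toLinearMap ∘ₗ f
  suffices h : ∀ x, f' x = 0 by
    ext1 x
    exact (M0equiv (k := k) (m := m) (n := n) h2 e).symm.map_eq_zero_iff.1 (h x)
  intro x
  funext i0
  obtain ⟨j, hj⟩ : ∃ j : Fin m, j ≠ i0 () := by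
    haveI : Nontrivial (Fin m) := Fin.nontrivial_iff_two_le.2 hm2
    exact exists_ne _
  let c : Fin d → BIdx m n := fun _ => Sum.inl (i0 ())
  have hc : hat (n := n) e i0 = c := rfl
  let w : Fin d → BIdx m n := fun l => if l ∈ S then Sum.inl (i0 ()) else Sum.inl j
  have hcp : ∀ l, bpar (c l) = false := fun _ => rfl
  have hwp : ∀ l, bpar (w l) = false := fun l => by simp only [w]; split_ifs <;> rfl
  have hcσ : ∀ (σ : Equiv.Perm (Fin d)) g, g ∘ σ = c ↔ g = c := by
    intro σ g
    have : c = c ∘ σ := rfl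
    rw [this]
    exact σ.surjective.injective_comp_right.eq_iff
  have hwσ : ∀ (σ : Equiv.Perm (Fin d)) (h : σ ∈ stb S) g, g ∘ σ = w ↔ g = w := by
    intro σ h g
    have : w = w ∘ σ := by
      funext l
      simp only [w, Function.comp_apply, h l]
    rw [this, σ.surjective.injective_comp_right.eq_iff, ← this]
  have evc : ∀ (σ : Equiv.Perm (Fin d)) (g : Fin d → BIdx m n), (∀ l, bpar (g l) = false) → sg k σ (g ∘ σ) = 1 := 
    fun σ g hg => sg_even σ _ (fun l => hg _)
  let C : (Fin d → BIdx m n) → Prop := fun h => (∀ l, bpar (h l) = false) ∧ (∃ l l', h l ≠ h l')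
  have hCσ : ∀ (σ : Equiv.Perm (Fin d)) g, C (g ∘ σ) ↔ C g := by
    intro σ g
    constructor
    · rintro ⟨h1, l, l', h⟩
      exact ⟨fun l => by simpa using h1 (σ⁻¹ l), _, _, h⟩
    · rintro ⟨h1, l, l', h⟩
      exact ⟨fun l => h1 _, σ⁻¹ l, σ⁻¹ l', by simpa using h⟩
  let V := ofm (k := k) (fun g f => if g = c ∧ C f then (1:k) else 0)
  have hV : V ∈ Schur k m n d := by
    rw [mem_schur]
    intro σ
    apply commute_of_mc
    intro g f
    rw [mc_ofm, mc_ofm]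
    simp only [hcσ, hCσ]
    split_ifs with h
    · rw [evc σ f h.2.1, evc σ g (by rw [h.1]; exact hcp)]; simp
    · simp
  let E := ofm (k := k) (fun g f => if g = c ∧ f = c then (1:k) else 0)
  have hE : E ∈ Schur k m n d := by
    rw [mem_schur]
    intro σ
    apply commute_of_mc
    intro g f
    rw [mc_ofm, mc_ofm]
    simp only [hcσ]
    split_ifs with h
    · rw [evc σ f (by rw [h.2]; exact hcp), evc σ g (by rw [h.1]; exact hcp)]; simp
    · simp
  let K := ofm (k := k) (fun g f => if g = w ∧ f = c then (1:k) else 0)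
  have hK : K ∈ cen k m n (stb S) := by
    rw [mem_cen]
    intro σ hσ
    apply commute_of_mc
    intro g f
    rw [mc_ofm, mc_ofm]
    simp only [hcσ, hwσ σ hσ]
    split_ifs with h
    · rw [evc σ f (by rw [h.2]; exact hcp), evc σ g (by rw [h.1]; exact hwp)]; simp
    · simp
  have hCw : C w := ⟨hwp, a, b, by simp [w, ha, hb, hj.symm]⟩
  have hEVK : E = V * K := by
    apply mc_ext
    intro g f
    rw [mc_mul, mc_ofm, Finset.sum_eq_single w]
    · rw [mc_ofm, mc_ofm]
      by_cases h1 : g = c <;> by_cases h2 : f = c <;> simp [h1, h2, hCw]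
    · intro h _ hh
      rw [mc_ofm, mc_ofm, if_neg (c := h = w ∧ f = c) (fun h' => hh h'.1), mul_zero]
    · intro h; exact absurd (mem_univ _) h
  have hEval : ∀ F : (coefT (k := k) (m := m) (n := n) h2 e).T, 
      ((SAlg.mk E hE) • F : (coefT (k := k) (m := m) (n := n) h2 e).T) i0 = F i0 := by
    intro F
    rw [coefT_smul, SAlg.e_mk, Finset.sum_eq_single i0]
    · rw [mc_ofm, if_pos ⟨hc, hc⟩, one_mul]
    · intro f _ hf
      rw [mc_ofm, if_neg, zero_mul]
      rintro ⟨_, h⟩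
      apply hf
      funext x
      exact Sum.inl_injective (congrFun h a)
    · intro h; exact absurd (mem_univ _) h
  have hVz : ∀ F : (coefT (k := k) (m := m) (n := n) h2 e).T, 
      ((SAlg.mk V hV) • F : (coefT (k := k) (m := m) (n := n) h2 e).T) i0 = 0 := by
    intro F
    rw [coefT_smul, SAlg.e_mk, Finset.sum_eq_zero]
    intro f _
    rw [mc_ofm, if_neg, zero_mul]
    rintro ⟨_, _, l, l', h⟩
    exact h rfl
  refine (hEval (f' x)).symm.trans ?_
  rw [← map_smul]
  have : (SAlg.mk E hE) • x = (SAlg.mk V hV) • ((⟨K, hK⟩ : cen k m n (stb S)) • x) := by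
    change (inB S (SAlg.mk E hE)) • x = (inB S (SAlg.mk V hV)) • ((⟨K, hK⟩ : cen k m n (stb S)) • x)
    rw [smul_smul]
    congr 1
    exact Subtype.ext hEVK
  rw [this, map_smul, hVz]
  rfl

theorem B_acyc (hm : d ≤ m) (hn : d ≤ n) (S : Set (Fin d)) (hS1 : ∃ i, i ∈ S) (hS2 : ∃ i, i ∉ S)
    {N N' : Type} [AddCommGroup N] [Module (SAlg k m n d) N] [AddCommGroup N']
    [Module (cen k m n (stb S)) N'] (E : N ≃+ N')
    (he : ∀ (a : SAlg k m n d) x, E (a • x) = inB S a • E x) : Acyc (M0cat k m n d) N := 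
  rs_acyc (inB S) (B_proj hm hn S (by obtain ⟨i, _⟩ := hS1; exact i.pos)) 
    (fun N _ _ => B_hom h2 e hm S hS1 hS2 N) E he

/-- isotypic pieces for stabilizers are acyclic -/
theorem Coef.acyc {X : Type} (c : Coef k m n d X) (hm : d ≤ m) (hn : d ≤ n) (S : Set X) (hS1 : ∃ x, x ∈ S) 
    (hS2 : ∃ x, x ∉ S) {ι : Type} (σ : ι → Equiv.Perm X) (hσ : ∀ i x, σ i x ∈ S ↔ x ∈ S) (χ : ι → k)
    {N : Type} [AddCommGroup N] [Module (SAlg k m n d) N] (f : N →ₗ[SAlg k m n d] c.T) 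
    (hf : Function.Injective f) (hr : ∀ w, (∃ x, f x = w) ↔ ∀ i, c.R (σ i) w = χ i • w) : 
    Acyc (M0cat k m n d) N := by
  have hcen : ∀ b ∈ cen k m n (stb (c.π ⁻¹' S)), b ∈ cen k m n {σ | ∀ i, c.π (σ i) = c.π i} := by
    intro b hb
    refine cen_anti ?_ hb
    intro τ hτ i
    change c.π (τ i) ∈ S ↔ c.π i ∈ S
    rw [hτ i]
  let N' : AddSubgroup c.T := 
    { carrier := {w | ∀ i, c.R (σ i) w = χ i • w}
      zero_mem' := fun i => by simp
      add_mem' := fun {a b} ha hb i => by rw [map_add, ha i, hb i, smul_add]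
      neg_mem' := fun {a} ha i => by rw [map_neg, ha i, smul_neg] }
  letI : Module (cen k m n (stb (c.π ⁻¹' S))) N' :=
    { smul := fun b w => ⟨c.θ b.1 w.1, fun i => by
        rw [← Module.End.mul_apply, ← c.comm, Module.End.mul_apply, w.2 i, map_smul]
        intro τ hτ
        apply mem_cen.1 b.2
        intro l
        change c.π (τ l) ∈ S ↔ c.π l ∈ S
        rw [hτ, hσ]⟩
      one_smul := fun w => Subtype.ext (by 
        change c.θ 1 w.1 = w.1
        rw [c.θ_one]; rfl)
      mul_smul := fun a b w => Subtype.ext (by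
        change c.θ (a.1 * b.1) w.1 = c.θ a.1 (c.θ b.1 w.1)
        rw [c.θ_mul _ _ (hcen _ a.2) (hcen _ b.2)]; rfl)
      smul_zero := fun a => Subtype.ext (map_zero _)
      smul_add := fun a x y => Subtype.ext (map_add _ _ _)
      add_smul := fun a b x => Subtype.ext (by
        change c.θ (a.1 + b.1) x.1 = c.θ a.1 x.1 + c.θ b.1 x.1
        rw [map_add]; rfl)
      zero_smul := fun x => Subtype.ext (by
        change c.θ 0 x.1 = 0
        rw [map_zero]; rfl) }
  let E0 : N →+ N' := 
    { toFun := fun x => ⟨f x, (hr (f x)).1 ⟨x, rfl⟩⟩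
      map_zero' := Subtype.ext (map_zero f)
      map_add' := fun x y => Subtype.ext (map_add f x y) }
  have hE0 : Function.Bijective E0 := by
    constructor
    · intro x y h
      exact hf (congrArg Subtype.val h)
    · intro w
      obtain ⟨x, hx⟩ := (hr w.1).2 w.2
      exact ⟨x, Subtype.ext hx⟩
  obtain ⟨x1, hx1⟩ := hS1
  obtain ⟨x2, hx2⟩ := hS2
  obtain ⟨i1, hi1⟩ := c.hπ x1
  obtain ⟨i2, hi2⟩ := c.hπ x2
  refine B_acyc h2 e hm hn (c.π ⁻¹' S) ⟨i1, ?_⟩ ⟨i2, ?_⟩ (AddEquiv.ofBijective E0 hE0) ?_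
  · change c.π i1 ∈ S; rw [hi1]; exact hx1
  · change ¬ (c.π i2 ∈ S); rw [hi2]; exact hx2
  · intro a x
    exact Subtype.ext (f.map_smul a x)
end
end B
end Stmt7

open CategoryTheory Finset
set_option synthInstance.maxHeartbeats 1000000
set_option maxHeartbeats 4000000
set_option linter.all false
namespace Stmt7
open CategoryTheory Abelian

section Alt
variable {k : Type} [Field k] {m n d : ℕ} {X : Type}

/-- equivariant alternating maps -/
def Alt (c : Coef k m n d X) (i : ℕ) : Submodule (SAlg k m n d) ((X → k) [⋀^Fin i]→ₗ[k] c.T) where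
  carrier := {F | ∀ (σ : Equiv.Perm X) y, c.R σ (F y) = F (fun j => y j ∘ σ)}
  zero_mem' := fun σ y => by simp
  add_mem' := fun {a b} ha hb σ y => by
    rw [AlternatingMap.add_apply, AlternatingMap.add_apply, map_add, ha σ y, hb σ y]
  smul_mem' := fun a F hF σ y => by
    rw [AlternatingMap.smul_apply, AlternatingMap.smul_apply, c.R_smul, hF σ y]

lemma Alt.eqv {c : Coef k m n d X} {i : ℕ} (F : Alt c i) (σ : Equiv.Perm X) (y : Fin i → X → k) :
    c.R σ (F.1 y) = F.1 (fun j => y j ∘ σ) := F.2 σ y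

variable [Fintype X] [DecidableEq X]

/-- basis tuple -/
def bt (k : Type) [Field k] {i : ℕ} (t : Fin i → X) : Fin i → X → k := fun j => Pi.single (t j) 1

lemma bt_comp {i : ℕ} (t : Fin i → X) (σ : Equiv.Perm X) : 
    (fun j => bt k t j ∘ σ) = bt k (⇑σ⁻¹ ∘ t) := by
  funext j x
  simp only [bt, Function.comp, Pi.single_apply]
  congr 1
  rw [Equiv.Perm.eq_inv_iff_eq]

section ofTup
variable {T : Type} [AddCommGroup T] [Module k T]

/-- alternating map from its values on basis tuples -/
def ofTup (h2 : (2:k) ≠ 0) {i : ℕ} (f : (Fin i → X) → T) 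
    (hf : ∀ a b, a ≠ b → ∀ t, f (t ∘ Equiv.swap a b) = - f t) : (X → k) [⋀^Fin i]→ₗ[k] T :=
  { (∑ t : Fin i → X, ((MultilinearMap.mkPiAlgebra k (Fin i) k).compLinearMap 
      (fun j => LinearMap.proj (t j) : Fin i → (X → k) →ₗ[k] k)).smulRight (f t) : 
        MultilinearMap k (fun _ : Fin i => X → k) T) with
    map_eq_zero_of_eq' := by
      intro v a b hab hne
      simp only [MultilinearMap.toFun_eq_coe, MultilinearMap.sum_apply, MultilinearMap.smulRight_apply, 
        MultilinearMap.compLinearMap_apply, MultilinearMap.mkPiAlgebra_apply, LinearMap.proj_apply]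
      refine Finset.sum_involution (fun t _ => t ∘ Equiv.swap a b) ?_ ?_ (fun _ _ => mem_univ _) ?_
      · intro t _
        have : ∏ j, v j ((t ∘ ⇑(Equiv.swap a b)) j) = ∏ j, v j (t j) := by
          rw [← Equiv.prod_comp (Equiv.swap a b)]
          apply Finset.prod_congr rfl
          intro j _
          simp only [Function.comp, Equiv.swap_apply_self]
          rcases Equiv.swap_apply_eq_iff.1 (rfl : Equiv.swap a b j = _) with _
          by_cases h1 : j = a
          · subst h1; rw [Equiv.swap_apply_left, hab]
          · by_cases h2 : j = b
            · subst h2; rw [Equiv.swap_apply_right, hab]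
            · rw [Equiv.swap_apply_of_ne_of_ne h1 h2]
        rw [this, hf a b hne, smul_neg, add_neg_cancel]
      · intro t _ h1 h3
        apply h1
        have h4 := hf a b hne t
        rw [h3] at h4
        have : (2:k) • f t = 0 := by rw [two_smul]; nth_rewrite 1 [h4]; simp
        rcases smul_eq_zero.1 this with h | h
        · exact absurd h h2
        · rw [h, smul_zero]
      · intro t _
        funext j
        simp }

lemma ofTup_bt (h2 : (2:k) ≠ 0) {i : ℕ} (f : (Fin i → X) → T) (hf) (t : Fin i → X) : 
    ofTup h2 f hf (bt k t) = f t := by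
  change (∑ t : Fin i → X, ((MultilinearMap.mkPiAlgebra k (Fin i) k).compLinearMap 
      (fun j => LinearMap.proj (t j) : Fin i → (X → k) →ₗ[k] k)).smulRight (f t) : 
        MultilinearMap k (fun _ : Fin i => X → k) T) (bt k t) = _
  simp only [MultilinearMap.sum_apply, MultilinearMap.smulRight_apply, 
        MultilinearMap.compLinearMap_apply, MultilinearMap.mkPiAlgebra_apply, LinearMap.proj_apply]
  rw [Finset.sum_eq_single t]
  · simp [bt]
  · intro t' _ h
    obtain ⟨j, hj⟩ := Function.ne_iff.1 h
    rw [Finset.prod_eq_zero (mem_univ j) (by simp [bt, hj]), zero_smul]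
  · intro h; exact absurd (mem_univ _) h

lemma alt_ext_bt {i : ℕ} {F G : (X → k) [⋀^Fin i]→ₗ[k] T} 
    (h : ∀ t : Fin i → X, Function.Injective t → F (bt k t) = G (bt k t)) : F = G := by
  refine Module.Basis.ext_alternating (Pi.basisFun k X) ?_
  intro t ht
  have : (fun j => (Pi.basisFun k X) (t j)) = bt k t := by
    funext j; simp [bt]
  rw [this]
  exact h t ht
end ofTup

lemma mem_Alt_of {c : Coef k m n d X} {i : ℕ} {F : (X → k) [⋀^Fin i]→ₗ[k] c.T}
    (h : ∀ (σ : Equiv.Perm X) (t : Fin i → X), Function.Injective t → c.R σ (F (bt k t)) = F (bt k (⇑σ⁻¹ ∘ t))) : F ∈ Alt c i := by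
  intro σ y
  have : (c.R σ).compAlternatingMap F = F.compLinearMap (LinearMap.funLeft k k σ) := by
    apply alt_ext_bt
    intro t ht
    rw [LinearMap.compAlternatingMap_apply, h σ t ht, AlternatingMap.compLinearMap_apply, ← bt_comp]
    rfl
  exact congrFun (congrArg DFunLike.coe this) y

lemma exists_perm {i : ℕ} (t t0 : Fin i → X) (h : Function.Injective t) (h0 : Function.Injective t0) : 
    ∃ σ : Equiv.Perm X, ∀ j, σ (t j) = t0 j := by
  obtain ⟨σ, hσ⟩ := (Equiv.Perm.isMultiplyPretransitive X i).exists_smul_eq ⟨t, h⟩ ⟨t0, h0⟩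
  exact ⟨σ, fun j => congrFun (congrArg DFunLike.coe hσ) j⟩

lemma bt_perm {T : Type} [AddCommGroup T] [Module k T] {i : ℕ} (F : (X → k) [⋀^Fin i]→ₗ[k] T) (t : Fin i → X) (τ : Equiv.Perm (Fin i)) : 
    F (bt k (t ∘ τ)) = ((Equiv.Perm.sign τ : ℤ) : k) • F (bt k t) := by
  have := F.map_perm (bt k t) τ
  rw [show bt k (t ∘ ⇑τ) = bt k t ∘ ⇑τ from rfl, this, Units.smul_def, Int.cast_smul_eq_zsmul]

lemma sgn_sq {i : ℕ} (τ : Equiv.Perm (Fin i)) : ((Equiv.Perm.sign τ : ℤ) : k) * ((Equiv.Perm.sign τ : ℤ) : k) = 1 := by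
  rcases Int.units_eq_one_or (Equiv.Perm.sign τ) with h | h <;> simp [h]

/-- evaluation at a basis tuple -/
def Alt.ev (c : Coef k m n d X) (i : ℕ) (t : Fin i → X) : Alt c i →ₗ[SAlg k m n d] c.T where
  toFun F := F.1 (bt k t)
  map_add' _ _ := rfl
  map_smul' _ _ := rfl

section
variable (c : Coef k m n d X) {i : ℕ} (t0 : Fin i → X) (h0 : Function.Injective t0)
include h0

lemma Alt.ev_inj : Function.Injective (Alt.ev c i t0) := by
  intro F G h
  apply Subtype.ext
  apply alt_ext_bt
  intro t ht
  obtain ⟨σ, hσ⟩ := exists_perm t t0 ht h0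
  have e : bt k t = bt k (⇑σ⁻¹ ∘ t0) := by
    congr 1; funext j; simp [← hσ]
  rw [e, ← bt_comp, ← Alt.eqv F, ← Alt.eqv G]
  exact congrArg _ h

lemma Alt.ev_range (h2 : (2:k) ≠ 0) (w : c.T) : (∃ F, Alt.ev c i t0 F = w) ↔ 
    ∀ (x : {x : Equiv.Perm X × Equiv.Perm (Fin i) // ∀ j, x.1 (t0 (x.2 j)) = t0 j}), 
      c.R x.1.1 w = ((Equiv.Perm.sign x.1.2 : ℤ) : k) • w := by
  constructor
  · rintro ⟨F, rfl⟩ ⟨⟨σ, τ⟩, h⟩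
    change c.R σ (F.1 (bt k t0)) = _ • F.1 (bt k t0)
    rw [Alt.eqv F, ← bt_perm, bt_comp]
    congr 2
    funext j
    simp only [Function.comp]
    rw [Equiv.Perm.inv_eq_iff_eq]
    exact (h j).symm
  · intro hw
    classical
    have ex : ∀ t : Fin i → X, ∃ σ : Equiv.Perm X, Function.Injective t → ∀ j, σ (t j) = t0 j := by
      intro t
      by_cases ht : Function.Injective t
      · obtain ⟨σ, hσ⟩ := exists_perm t t0 ht h0
        exact ⟨σ, fun _ => hσ⟩
      · exact ⟨1, fun h => absurd h ht⟩
    choose s hs using ex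
    let f : (Fin i → X) → c.T := fun t => if Function.Injective t then c.R (s t) w else 0
    have key : ∀ (t : Fin i → X) (σ : Equiv.Perm X) (τ : Equiv.Perm (Fin i)), (∀ j, σ (t j) = t0 (τ j)) →
        f t = ((Equiv.Perm.sign τ : ℤ) : k) • c.R σ w := by
      intro t σ τ h
      have ht : Function.Injective t := by
        intro a b hab
        have := h a
        rw [hab, h b] at this
        exact (τ.injective (h0 this)).symm
      have h3 := hw ⟨(σ * (s t)⁻¹, τ⁻¹), by
        intro j
        have h4 := hs t ht (τ⁻¹ j)
        simp only [Equiv.Perm.mul_apply]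
        rw [← h4]
        rw [perm_inv_apply_self, h, perm_apply_inv_self]⟩
      have h5 := congrArg (c.R (s t)) h3
      simp only [c.R_R, inv_mul_cancel_right, map_smul, Equiv.Perm.sign_inv] at h5
      rw [h5, smul_smul, sgn_sq, one_smul]
      simp only [f, if_pos ht]
    have hf : ∀ a b, a ≠ b → ∀ t, f (t ∘ Equiv.swap a b) = - f t := by
      intro a b hab t
      by_cases ht : Function.Injective t
      · rw [key (t ∘ Equiv.swap a b) (s t) (Equiv.swap a b) (fun j => hs t ht _), Equiv.Perm.sign_swap hab]
        simp [f, ht]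
      · simp only [f]
        rw [if_neg, if_neg ht, neg_zero]
        intro h
        apply ht
        exact ((Equiv.swap a b).injective_comp t).1 h
    refine ⟨⟨ofTup h2 f hf, ?_⟩, ?_⟩
    · apply mem_Alt_of
      intro σ t ht
      rw [ofTup_bt, ofTup_bt, key (⇑σ⁻¹ ∘ t) (s t * σ) 1]
      · simp [f, ht, c.R_R]
      · intro j
        simp [hs t ht]
    · change ofTup h2 f hf (bt k t0) = w
      rw [ofTup_bt, key t0 1 1 (fun j => rfl), c.R_one]
      simp
end

theorem Alt.acyc {p j : ℕ} [hp : Fact p.Prime] [CharP k p] (h2 : 2 < p) (e : Fin d ≃ Unit × Fin (p ^ (j+1)))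
    (hm : d ≤ m) (hn : d ≤ n) (c : Coef k m n d X) (i : ℕ) (hi : 0 < i) (hi' : i < Fintype.card X) : 
    Acyc (M0cat k m n d) (Alt c i) := by
  obtain ⟨t0⟩ : Nonempty (Fin i ↪ X) := Function.Embedding.nonempty_of_card_le (by simp; omega)
  refine Coef.acyc h2 e c hm hn (Set.range t0) ⟨t0 ⟨0, hi⟩, ⟨_, rfl⟩⟩ ?_ 
    (fun x : {x : Equiv.Perm X × Equiv.Perm (Fin i) // ∀ j, x.1 (t0 (x.2 j)) = t0 j} => x.1.1) ?_ 
    (fun x => ((Equiv.Perm.sign x.1.2 : ℤ) : k)) (Alt.ev c i t0) (Alt.ev_inj c t0 t0.injective)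
    (fun w => Alt.ev_range c t0 t0.injective (two_ne h2) w)
  · by_contra hc
    push Not at hc
    have : Function.Surjective t0 := hc
    have := Fintype.card_le_of_surjective _ this
    simp at this
    omega
  · rintro ⟨⟨σ, τ⟩, h⟩ x
    constructor
    · rintro ⟨j, hj⟩
      refine ⟨τ j, ?_⟩
      apply σ.injective
      rw [h j]; exact hj
    · rintro ⟨j, rfl⟩
      refine ⟨τ⁻¹ j, ?_⟩
      rw [← h (τ⁻¹ j)]
      simp

lemma Alt.subsing (c : Coef k m n d X) (i : ℕ) (hi : Fintype.card X < i) : Subsingleton (Alt c i) := by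
  constructor
  intro F G
  apply Subtype.ext
  apply alt_ext_bt
  intro t ht
  have := Fintype.card_le_of_injective t ht
  simp at this
  omega
end Alt
end Stmt7

open CategoryTheory Finset
set_option synthInstance.maxHeartbeats 1000000
set_option maxHeartbeats 4000000
set_option linter.all false
namespace Stmt7
open CategoryTheory Abelian

section Wedge
variable {k : Type} [Field k] {M T : Type} [AddCommGroup M] [Module k M] [AddCommGroup T] [Module k T]

/-- wedge with a functional -/
def wedge (l : M →ₗ[k] k) {i : ℕ} (φ : M [⋀^Fin i]→ₗ[k] T) : M [⋀^Fin (i+1)]→ₗ[k] T :=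
  AlternatingMap.alternatizeUncurryFin (l.smulRight φ)

lemma wedge_apply (l : M →ₗ[k] k) {i : ℕ} (φ : M [⋀^Fin i]→ₗ[k] T) (y : Fin (i+1) → M) :
    wedge l φ y = ∑ j : Fin (i+1), (-1) ^ (j : ℕ) • l (y j) • φ (Fin.removeNth j y) := by
  unfold wedge
  rw [AlternatingMap.alternatizeUncurryFin_apply]
  rfl

lemma wedge_add (l : M →ₗ[k] k) {i : ℕ} (φ ψ : M [⋀^Fin i]→ₗ[k] T) : wedge l (φ + ψ) = wedge l φ + wedge l ψ := by
  ext y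
  rw [AlternatingMap.add_apply]
  simp only [wedge_apply, AlternatingMap.add_apply, smul_add, Finset.sum_add_distrib]

lemma wedge_zero (l : M →ₗ[k] k) {i : ℕ} : wedge l (0 : M [⋀^Fin i]→ₗ[k] T) = 0 := by
  ext y
  rw [wedge_apply]
  simp

lemma wedge_sub (l : M →ₗ[k] k) {i : ℕ} (φ ψ : M [⋀^Fin i]→ₗ[k] T) : wedge l (φ - ψ) = wedge l φ - wedge l ψ := by
  rw [eq_sub_iff_add_eq, ← wedge_add, sub_add_cancel]

lemma wedge_add_left (l l' : M →ₗ[k] k) {i : ℕ} (φ : M [⋀^Fin i]→ₗ[k] T) : wedge (l + l') φ = wedge l φ + wedge l' φ := by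
  ext y
  rw [AlternatingMap.add_apply]
  simp only [wedge_apply, LinearMap.add_apply, add_smul, smul_add, Finset.sum_add_distrib]

lemma wedge_smul_left (c : k) (l : M →ₗ[k] k) {i : ℕ} (φ : M [⋀^Fin i]→ₗ[k] T) : wedge (c • l) φ = c • wedge l φ := by
  ext y
  rw [AlternatingMap.smul_apply]
  simp only [wedge_apply, LinearMap.smul_apply, Finset.smul_sum]
  refine Finset.sum_congr rfl fun j _ => ?_
  rw [smul_eq_mul, mul_smul, smul_comm]

lemma removeNth_succ_vecCons {i : ℕ} (v : M) (y : Fin (i+1) → M) (j : Fin (i+1)) : 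
    Fin.removeNth j.succ (Matrix.vecCons v y) = Matrix.vecCons v (Fin.removeNth j y) := by
  funext x
  refine Fin.cases ?_ (fun x => ?_) x
  · simp [Fin.removeNth]
  · simp [Fin.removeNth]

lemma wedge_cur (l : M →ₗ[k] k) {i : ℕ} (φ : M [⋀^Fin (i+1)]→ₗ[k] T) (v : M) : 
    (wedge l φ).curryLeft v = l v • φ - wedge l (φ.curryLeft v) := by
  ext y
  rw [AlternatingMap.curryLeft_apply_apply, AlternatingMap.sub_apply, wedge_apply, Fin.sum_univ_succ]
  rw [sub_eq_add_neg]
  congr 1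
  · simp [Fin.removeNth]
  · rw [wedge_apply, ← Finset.sum_neg_distrib]
    refine Finset.sum_congr rfl fun j _ => ?_
    rw [removeNth_succ_vecCons, Matrix.cons_val_succ, AlternatingMap.curryLeft_apply_apply, Fin.val_succ, pow_succ, mul_neg_one, neg_smul]

lemma wedge_cur0 (l : M →ₗ[k] k) (φ : M [⋀^Fin 0]→ₗ[k] T) (v : M) : 
    (wedge l φ).curryLeft v = l v • φ := by
  ext y
  rw [AlternatingMap.curryLeft_apply_apply, wedge_apply, Fin.sum_univ_succ]
  simp

lemma alt_ext_cur {i : ℕ} {φ ψ : M [⋀^Fin (i+1)]→ₗ[k] T} (h : ∀ v, φ.curryLeft v = ψ.curryLeft v) : φ = ψ := by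
  ext y
  have := congrFun (congrArg DFunLike.coe (h (y 0))) (Matrix.vecTail y)
  rw [AlternatingMap.curryLeft_apply_apply, AlternatingMap.curryLeft_apply_apply] at this
  have e : Matrix.vecCons (y 0) (Matrix.vecTail y) = y := Matrix.cons_head_tail y
  rwa [e] at this

lemma wedge_wedge (l : M →ₗ[k] k) {i : ℕ} (φ : M [⋀^Fin i]→ₗ[k] T) : wedge l (wedge l φ) = 0 := by
  induction i with
  | zero =>
    apply alt_ext_cur
    intro v
    rw [wedge_cur, wedge_cur0, ← sub_eq_zero]
    rw [show wedge l (l v • φ) = l v • wedge l φ from ?_]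
    · simp
    · ext y; simp only [wedge_apply, AlternatingMap.smul_apply, Finset.smul_sum]
      refine Finset.sum_congr rfl fun j _ => ?_
      rw [smul_comm (l v), smul_comm (l v)]
  | succ i ih =>
    apply alt_ext_cur
    intro v
    rw [wedge_cur, wedge_cur, wedge_sub, ih]
    rw [show wedge l (l v • φ) = l v • wedge l φ from ?_]
    · simp
    · ext y; simp only [wedge_apply, AlternatingMap.smul_apply, Finset.smul_sum]
      refine Finset.sum_congr rfl fun j _ => ?_
      rw [smul_comm (l v), smul_comm (l v)]

lemma wedge_comp (l : M →ₗ[k] k) {i : ℕ} (φ : M [⋀^Fin i]→ₗ[k] T) {T' : Type} [AddCommGroup T'] [Module k T'] (f : T →ₗ[k] T') :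
    wedge l (f.compAlternatingMap φ) = f.compAlternatingMap (wedge l φ) := by
  ext y
  rw [LinearMap.compAlternatingMap_apply, wedge_apply, wedge_apply, map_sum]
  refine Finset.sum_congr rfl fun j _ => ?_
  rw [map_zsmul, map_smul, LinearMap.compAlternatingMap_apply]

lemma wedge_pre (l : M →ₗ[k] k) {i : ℕ} (φ : M [⋀^Fin i]→ₗ[k] T) {M' : Type} [AddCommGroup M'] [Module k M'] (f : M' →ₗ[k] M) :
    wedge (l ∘ₗ f) (φ.compLinearMap f) = (wedge l φ).compLinearMap f := by
  ext y
  rw [AlternatingMap.compLinearMap_apply, wedge_apply, wedge_apply]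
  rfl

/-- effect of a reflection -/
lemma refl_formula (l : M →ₗ[k] k) (u : M) {i : ℕ} (φ : M [⋀^Fin (i+1)]→ₗ[k] T) : 
    φ.compLinearMap (LinearMap.id - l.smulRight u) = φ - wedge l (φ.curryLeft u) := by
  have hcur : ∀ {i : ℕ} (φ : M [⋀^Fin (i+1)]→ₗ[k] T) (f : M →ₗ[k] M) (v : M), 
      (φ.compLinearMap f).curryLeft v = (φ.curryLeft (f v)).compLinearMap f := by
    intro i φ f v
    ext y
    rw [AlternatingMap.curryLeft_apply_apply, AlternatingMap.compLinearMap_apply, AlternatingMap.compLinearMap_apply, AlternatingMap.curryLeft_apply_apply]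
    congr 1
    funext x
    refine Fin.cases rfl (fun x => rfl) x
  have hcurs : ∀ {i : ℕ} (φ ψ : M [⋀^Fin (i+1)]→ₗ[k] T) (v : M), (φ - ψ).curryLeft v = φ.curryLeft v - ψ.curryLeft v := fun _ _ _ => rfl
  induction i with
  | zero =>
    apply alt_ext_cur
    intro v
    rw [hcur, hcurs, wedge_cur0]
    ext y
    rw [LinearMap.sub_apply, map_sub, LinearMap.smulRight_apply, map_smul]
    rw [AlternatingMap.compLinearMap_apply]
    congr 1
    exact Subsingleton.elim _ _
  | succ i ih =>
    apply alt_ext_cur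
    intro v
    rw [hcur, hcurs, wedge_cur, ih]
    rw [LinearMap.sub_apply, map_sub, LinearMap.smulRight_apply, map_smul, hcurs]
    have e1 : (l v • φ.curryLeft u).curryLeft u = 0 := by
      rw [AlternatingMap.curryLeft_smul, LinearMap.smul_apply, AlternatingMap.curryLeft_same, smul_zero]
    have e2 : (φ.curryLeft v).curryLeft u = - (φ.curryLeft u).curryLeft v := by
      have := AlternatingMap.curryLeft_same φ (u + v)
      simp only [map_add, AlternatingMap.curryLeft_add, LinearMap.add_apply, AlternatingMap.curryLeft_same, zero_add, add_zero] at this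
      exact eq_neg_of_add_eq_zero_right (by rw [add_comm]; exact this)
    rw [e1, LinearMap.id_apply, sub_zero, e2]
    have e3 : wedge l (-(φ.curryLeft u).curryLeft v) = - wedge l ((φ.curryLeft u).curryLeft v) := by
      rw [← zero_sub, wedge_sub, wedge_zero, zero_sub]
    rw [e3]
    abel

lemma refl_even (h2 : (2:k) ≠ 0) (l : M →ₗ[k] k) (u : M) (hu : l u = 2) {i : ℕ} (φ : M [⋀^Fin (i+1)]→ₗ[k] T) 
    (h : ∀ y, φ (fun j => y j - l (y j) • u) = φ y) : φ.curryLeft u = 0 := by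
  have h1 : φ.compLinearMap (LinearMap.id - l.smulRight u) = φ := by ext y; exact h y
  rw [refl_formula, sub_eq_self] at h1
  have h3 : (wedge l (φ.curryLeft u)).curryLeft u = 0 := by rw [h1]; rfl
  have : (2:k) • φ.curryLeft u = 0 := by
    cases i with
    | zero => rw [← hu, ← wedge_cur0, h3]
    | succ i => 
      rw [wedge_cur, AlternatingMap.curryLeft_same, wedge_zero, sub_zero, hu] at h3
      exact h3
  exact (smul_eq_zero.1 this).resolve_left h2

lemma refl_odd (h2 : (2:k) ≠ 0) (l : M →ₗ[k] k) (u : M) {i : ℕ} (φ : M [⋀^Fin i]→ₗ[k] T) 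
    (h : ∀ y, φ (fun j => y j - l (y j) • u) = - φ y) : wedge l φ = 0 := by
  have h1 : φ.compLinearMap (LinearMap.id - l.smulRight u) = - φ := by ext y; exact h y
  have : (2:k) • wedge l φ = 0 := by
    cases i with
    | zero =>
      have h3 : φ = - φ := by
        nth_rewrite 1 [← h1]
        ext y
        rw [AlternatingMap.compLinearMap_apply]
        congr 1
        exact Subsingleton.elim _ _
      rw [two_smul, ← wedge_add]
      nth_rewrite 1 [h3]
      rw [neg_add_cancel, wedge_zero]
    | succ i =>
      rw [refl_formula] at h1
      have h3 : φ + φ = wedge l (φ.curryLeft u) := by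
        rw [sub_eq_iff_eq_add] at h1
        nth_rewrite 1 [h1]
        abel
      rw [two_smul, ← wedge_add, h3, wedge_wedge]
  exact (smul_eq_zero.1 this).resolve_left h2
end Wedge
end Stmt7

open CategoryTheory Finset
set_option synthInstance.maxHeartbeats 1000000
set_option maxHeartbeats 4000000
set_option linter.all false
namespace Stmt7
open CategoryTheory Abelian

section Kos
variable {k : Type} [Field k] {m n d : ℕ} {X : Type}

lemma mem_Alt_iff {c : Coef k m n d X} {i : ℕ} (F : (X → k) [⋀^Fin i]→ₗ[k] c.T) : 
    F ∈ Alt c i ↔ ∀ σ : Equiv.Perm X, (c.R σ).compAlternatingMap F = F.compLinearMap (LinearMap.funLeft k k σ) := by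
  constructor
  · intro h σ
    ext y
    exact h σ y
  · intro h σ y
    exact congrFun (congrArg DFunLike.coe (h σ)) y

/-- contraction with the constant vector -/
def dd (c : Coef k m n d X) (i : ℕ) : Alt c (i+1) →ₗ[SAlg k m n d] Alt c i where
  toFun F := ⟨F.1.curryLeft 1, by
    intro σ y
    rw [AlternatingMap.curryLeft_apply_apply, Alt.eqv F, AlternatingMap.curryLeft_apply_apply]
    congr 1
    funext x
    refine Fin.cases rfl (fun x => rfl) x⟩
  map_add' _ _ := rfl
  map_smul' _ _ := rfl

lemma dd_dd (c : Coef k m n d X) (i : ℕ) (F : Alt c (i+2)) : dd c i (dd c (i+1) F) = 0 := 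
  Subtype.ext (AlternatingMap.curryLeft_same F.1 1)

variable [Fintype X] [DecidableEq X]

variable (k X) in
/-- sum functional -/
def sumf : (X → k) →ₗ[k] k := ∑ x, LinearMap.proj x

lemma sumf_apply (y : X → k) : sumf k X y = ∑ x, y x := by simp [sumf]

/-- Koszul map -/
def kos (c : Coef k m n d X) (i : ℕ) : Alt c i →ₗ[SAlg k m n d] Alt c (i+1) where
  toFun F := ⟨wedge (sumf k X) F.1, by
    rw [mem_Alt_iff]
    intro σ
    rw [← wedge_comp, (mem_Alt_iff F.1).1 F.2 σ, ← wedge_pre]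
    congr 1
    refine LinearMap.ext fun y => ?_
    rw [LinearMap.comp_apply, sumf_apply, sumf_apply, ← Equiv.sum_comp σ]
    rfl⟩
  map_add' F G := Subtype.ext (wedge_add _ _ _)
  map_smul' a F := Subtype.ext (wedge_comp _ F.1 (c.θ a.e))

lemma kos_kos (c : Coef k m n d X) (i : ℕ) (F : Alt c i) : kos c (i+1) (kos c i F) = 0 := 
  Subtype.ext (wedge_wedge _ F.1)

lemma kos_inj0 [Nonempty X] (c : Coef k m n d X) : Function.Injective (kos c 0) := by
  intro F G h
  obtain ⟨x⟩ := ‹Nonempty X›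
  have h1 := congrArg (fun H : Alt c 1 => H.1.curryLeft (Pi.single x 1)) h
  change (wedge (sumf k X) F.1).curryLeft (Pi.single x 1) = (wedge (sumf k X) G.1).curryLeft (Pi.single x 1) at h1
  rw [wedge_cur0, wedge_cur0, sumf_apply] at h1
  simp at h1
  exact h1

/-- reflection functional -/
def rl (x x' : X) : (X → k) →ₗ[k] k := (LinearMap.proj (R := k) (φ := fun _ : X => k) x) - (LinearMap.proj (R := k) (φ := fun _ : X => k) x')

lemma rl_apply (x x' : X) (y : X → k) : rl x x' y = y x - y x' := rfl

lemma swap_refl (x x' : X) (hx : x ≠ x') (y : X → k) : 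
    y ∘ Equiv.swap x x' = y - (rl x x' y) • (Pi.single x 1 - Pi.single x' 1 : X → k) := by
  funext z
  by_cases h1 : z = x
  · subst h1
    simp [hx, rl_apply]
  · by_cases h2 : z = x'
    · subst h2
      simp [h1, rl_apply]
    · simp [rl_apply, h1, h2, Equiv.swap_apply_of_ne_of_ne h1 h2]

lemma refl_u (x x' : X) (hx : x ≠ x') : rl x x' (Pi.single x 1 - Pi.single x' 1 : X → k) = 2 := by
  simp [rl_apply, hx, hx.symm]
  norm_num

section D
variable {p j : ℕ} [hp : Fact p.Prime] [CharP k p] (h2 : 2 < p) (e : Fin d ≃ X × Fin (p ^ (j+1)))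

/-- evaluation at a word -/
def evg (g : X → Fin m) : (coefT (k := k) (m := m) (n := n) h2 e).T →ₗ[k] k where
  toFun F := F g
  map_add' _ _ := rfl
  map_smul' _ _ := rfl

/-- assemble from words -/
def asm {i : ℕ} (φ : (X → Fin m) → ((X → k) [⋀^Fin i]→ₗ[k] k)) : (X → k) [⋀^Fin i]→ₗ[k] (coefT (k := k) (m := m) (n := n) h2 e).T :=
  AlternatingMap.pi φ

lemma asm_apply {i : ℕ} (φ : (X → Fin m) → ((X → k) [⋀^Fin i]→ₗ[k] k)) (y) (g) : asm (n := n) h2 e φ y g = φ g y := rfl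

lemma evg_asm {i : ℕ} (φ : (X → Fin m) → ((X → k) [⋀^Fin i]→ₗ[k] k)) (g) : (evg (n := n) h2 e g).compAlternatingMap (asm h2 e φ) = φ g := rfl

lemma evg_ext {i : ℕ} {F G : (X → k) [⋀^Fin i]→ₗ[k] (coefT (k := k) (m := m) (n := n) h2 e).T} 
    (h : ∀ g, (evg (n := n) h2 e g).compAlternatingMap F = (evg (n := n) h2 e g).compAlternatingMap G) : F = G := by
  ext y
  funext g
  exact congrFun (congrArg DFunLike.coe (h g)) y

lemma D_swap {i : ℕ} (F : Alt (coefT (k := k) (m := m) (n := n) h2 e) (i+1)) (g : X → Fin m) (x x' : X) (hg : g x = g x') : 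
    ((evg (n := n) h2 e g).compAlternatingMap F.1).curryLeft (Pi.single x 1) = 
    ((evg (n := n) h2 e g).compAlternatingMap F.1).curryLeft (Pi.single x' 1) := by
  by_cases hx : x = x'
  · rw [hx]
  rw [← sub_eq_zero, ← map_sub]
  refine refl_even (two_ne h2) (rl x x') _ (refl_u x x' hx) _ ?_
  intro y
  have := congrFun (Alt.eqv F (Equiv.swap x x') y) g
  rw [coefT_R] at this
  have e1 : g ∘ ⇑(Equiv.swap x x')⁻¹ = g := by
    funext z
    rw [Equiv.swap_inv]
    simp only [Function.comp]
    by_cases h1 : z = x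
    · subst h1; rw [Equiv.swap_apply_left, hg]
    · by_cases h2 : z = x'
      · subst h2; rw [Equiv.swap_apply_right, hg]
      · rw [Equiv.swap_apply_of_ne_of_ne h1 h2]
  rw [e1] at this
  simp only [swap_refl x x' hx] at this
  exact this.symm

variable [Nonempty X]

/-- canonical letter -/
def letr (g : X → Fin m) : Fin m := (univ.image g).min' (univ_nonempty.image g)

lemma letr_ex (g : X → Fin m) : ∃ x, g x = letr g := by
  have := (univ.image g).min'_mem (univ_nonempty.image g)
  obtain ⟨x, _, h⟩ := Finset.mem_image.1 this
  exact ⟨x, h⟩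

lemma letr_comp (g : X → Fin m) (σ : Equiv.Perm X) : letr (g ∘ σ) = letr g := by
  unfold letr
  congr 1
  ext v
  simp only [mem_image, mem_univ, true_and, Function.comp]
  exact ⟨fun ⟨a, h⟩ => ⟨σ a, h⟩, fun ⟨a, h⟩ => ⟨σ⁻¹ a, by simpa using h⟩⟩

lemma kos_exact (i : ℕ) (F : Alt (coefT (k := k) (m := m) (n := n) h2 e) (i+1)) (hF : kos _ (i+1) F = 0) : 
    ∃ G, kos _ i G = F := by
  choose x hx using fun g : X → Fin m => letr_ex g
  let G : (X → k) [⋀^Fin i]→ₗ[k] (coefT (k := k) (m := m) (n := n) h2 e).T := 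
    asm h2 e (fun g => ((evg (n := n) h2 e g).compAlternatingMap F.1).curryLeft (Pi.single (x g) 1))
  have hG : G ∈ Alt (coefT (k := k) (m := m) (n := n) h2 e) i := by
    intro σ y
    funext g
    rw [coefT_R]
    simp only [G, asm_apply]
    rw [D_swap h2 e F g (x g) (σ⁻¹ (x (g ∘ ⇑σ⁻¹))) (by 
      have := hx (g ∘ ⇑σ⁻¹)
      rw [letr_comp] at this
      rw [hx g]
      exact this.symm)]
    have := congrFun (Alt.eqv F σ (Matrix.vecCons (Pi.single (x (g ∘ ⇑σ⁻¹)) 1) y)) g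
    rw [coefT_R] at this
    refine this.trans ?_
    change F.1 _ g = F.1 _ g
    refine congrFun (congrArg F.1 ?_) g
    funext z
    refine Fin.cases ?_ (fun x => rfl) z
    funext w
    change (Pi.single (x (g ∘ ⇑σ⁻¹)) 1 : X → k) (σ w) = (Pi.single (σ⁻¹ (x (g ∘ ⇑σ⁻¹))) 1 : X → k) w
    simp only [Pi.single_apply]
    congr 1
    rw [Equiv.Perm.eq_inv_iff_eq]
  refine ⟨⟨G, hG⟩, Subtype.ext ?_⟩
  change wedge (sumf k X) G = F.1
  apply evg_ext
  intro g
  rw [← wedge_comp]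
  have h1 : (evg (n := n) h2 e g).compAlternatingMap G = ((evg (n := n) h2 e g).compAlternatingMap F.1).curryLeft (Pi.single (x g) 1) := rfl
  have h3 : wedge (sumf k X) F.1 = 0 := congrArg Subtype.val hF
  have h4 := wedge_cur (sumf k X) ((evg (n := n) h2 e g).compAlternatingMap F.1) (Pi.single (x g) 1)
  rw [wedge_comp, h3] at h4
  have h5 : sumf k X (Pi.single (x g) 1) = 1 := by rw [sumf_apply]; simp
  rw [h5, one_smul] at h4
  rw [h1, eq_comm, ← sub_eq_zero, ← h4]
  rfl


theorem D_kos {j' : ℕ} (e0 : Fin d ≃ Unit × Fin (p ^ (j'+1))) (hm : d ≤ m) (hn : d ≤ n) (q : ℕ) (hq : Fintype.card X = q + 1) :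
    Sh (M0cat k m n d) q (Alt (coefT (k := k) (m := m) (n := n) h2 e) 0) (Alt (coefT (k := k) (m := m) (n := n) h2 e) (q+1)) := by
  have key : ∀ i, i ≤ q → Sh (M0cat k m n d) i (Alt (coefT (k := k) (m := m) (n := n) h2 e) 0) 
      (LinearMap.range (kos (coefT (k := k) (m := m) (n := n) h2 e) i)) := by
    intro i
    induction i with
    | zero => 
      intro _
      exact Sh.of_equiv (LinearEquiv.ofInjective _ (kos_inj0 _))
    | succ i ih =>
      intro hi
      refine Sh.trans (ih (by omega)) ?_ rfl
      have hac := Alt.acyc h2 e0 hm hn (coefT (k := k) (m := m) (n := n) h2 e) (i+1) (by omega) (by omega)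
      refine Sh.one (Submodule.subtype _) (LinearMap.rangeRestrict (kos (coefT (k := k) (m := m) (n := n) h2 e) (i+1))) 
        (Submodule.subtype_injective _) ?_ (LinearMap.surjective_rangeRestrict _) (fun s => hac _) (fun s => Or.inl (hac _))
      intro F
      constructor
      · intro h
        obtain ⟨G, rfl⟩ := kos_exact h2 e i F (congrArg Subtype.val h)
        exact ⟨⟨_, G, rfl⟩, rfl⟩
      · rintro ⟨⟨_, G, rfl⟩, rfl⟩
        exact Subtype.ext (kos_kos _ _ G)
  refine Sh.trans (key q le_rfl) ?_ (add_zero q)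
  have : LinearMap.range (kos (coefT (k := k) (m := m) (n := n) h2 e) q) = ⊤ := by
    rw [LinearMap.range_eq_top]
    intro F
    refine kos_exact h2 e q F ?_
    haveI := Alt.subsing (coefT (k := k) (m := m) (n := n) h2 e) (q+1+1) (by omega)
    exact Subsingleton.elim _ _
  rw [this]
  exact Sh.of_equiv Submodule.topEquiv
end D
end Kos
end Stmt7

open CategoryTheory Finset
set_option synthInstance.maxHeartbeats 1000000
set_option maxHeartbeats 4000000
set_option linter.all false
namespace Stmt7
open CategoryTheory Abelian

section P1
variable {k : Type} [Field k] {m n d : ℕ}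

/-- rank one operator -/
def rk1 (c : Fin d → BIdx m n) (w : W k m n d) : Module.End k (W k m n d) := (wev k c).smulRight w

lemma rk1_apply (c : Fin d → BIdx m n) (w z : W k m n d) : rk1 c w z = z c • w := rfl

lemma rk1_mem' (χ : Equiv.Perm (Fin d) → k) (c : Fin d → BIdx m n) (hc1 : ∀ σ (z : W k m n d), act k σ z c = χ σ * z c)
    (w : W k m n d) (h : ∀ σ, act k σ w = χ σ • w) : rk1 c w ∈ Schur k m n d := by
  rw [mem_schur]
  intro σ
  refine LinearMap.ext fun z => ?_
  rw [Module.End.mul_apply, Module.End.mul_apply, rk1_apply, rk1_apply, map_smul, hc1, h, smul_smul, mul_comm]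

lemma rk1_wd (c : Fin d → BIdx m n) (w : W k m n d) : rk1 c w (wd k c) = w := by
  rw [rk1_apply, wd_apply, if_pos rfl, one_smul]

lemma rk1_mc (c g g' : Fin d → BIdx m n) (w : W k m n d) : mc (rk1 c w) g g' = if g' = c then w g else 0 := by
  unfold mc
  rw [rk1_apply, wd_apply, w_smul_apply]
  simp only [eq_comm]
  split_ifs <;> simp

section
variable (χ : Equiv.Perm (Fin d) → k) (c : Fin d → BIdx m n) (hc1 : ∀ σ (z : W k m n d), act k σ z c = χ σ * z c)
  (hc2 : ∀ σ, act k σ (wd k c) = χ σ • wd k c)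
  {N : Type} [AddCommGroup N] [Module (SAlg k m n d) N] (f : N →ₗ[SAlg k m n d] (coef0 k m n d).T) 
  (hf : Function.Injective f) (hr : ∀ w, (∃ x, f x = w) ↔ ∀ σ, (coef0 k m n d).R σ w = χ σ • w)
include hc1 hf hr

lemma rk1_mem (x : N) : rk1 c (f x : W k m n d) ∈ Schur k m n d := by
  have h : ∀ σ, act k σ (f x : W k m n d) = χ σ • (f x : W k m n d) := fun σ => (hr (f x)).1 ⟨x, rfl⟩ σ
  exact rk1_mem' χ c hc1 (f x) h

include hc2

lemma rk1_ex : ∃ (x0 : N) (s : N →ₗ[SAlg k m n d] SAlg k m n d), (∀ x, (s x).e = rk1 c (f x : W k m n d)) ∧ 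
    ∀ x, s x • x0 = x := by
  obtain ⟨x0, hx0⟩ := (hr (wd k c)).2 hc2
  refine ⟨x0, { toFun := fun x => SAlg.mk (rk1 c (f x : W k m n d)) (rk1_mem χ c hc1 f hf hr x), map_add' := ?_, map_smul' := ?_ }, ?_, ?_⟩
  · intro x y
    apply SAlg.e_inj
    refine LinearMap.ext fun z => ?_
    change z c • (f (x + y) : W k m n d) = z c • (f x : W k m n d) + z c • (f y : W k m n d)
    rw [map_add]
    exact smul_add (z c) (f x : W k m n d) (f y : W k m n d)
  · intro a x
    apply SAlg.e_inj
    refine LinearMap.ext fun z => ?_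
    change z c • (f (a • x) : W k m n d) = a.e (z c • (f x : W k m n d))
    rw [map_smul]
    exact ((a.e).map_smul (z c) (f x : W k m n d)).symm
  · intro x
    rfl
  · intro x
    apply hf
    rw [map_smul, hx0]
    exact rk1_wd c (f x : W k m n d)

lemma rk1_proj : Module.Projective (SAlg k m n d) N := by
  obtain ⟨x0, s, h1, h2⟩ := rk1_ex χ c hc1 hc2 f hf hr
  exact Module.Projective.of_split s (LinearMap.toSpanSingleton _ _ x0) (LinearMap.ext fun x => h2 x)

variable {p j : ℕ} [hp : Fact p.Prime] [CharP k p] (h2 : 2 < p) (e : Fin d ≃ Unit × Fin (p ^ (j+1)))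

lemma rk1_hom (φ : N →ₗ[SAlg k m n d] (coefT (k := k) (m := m) (n := n) h2 e).T) : 
    ∃ x0 : N, ∀ x g, φ x g = ∑ g' : Unit → Fin m, (if hat e g' = c then (f x : W k m n d) (hat e g) * φ x0 g' else 0) := by
  obtain ⟨x0, s, hs, hx⟩ := rk1_ex χ c hc1 hc2 f hf hr
  refine ⟨x0, fun x g => ?_⟩
  conv_lhs => rw [← hx x, map_smul]
  rw [coefT_smul]
  refine Finset.sum_congr rfl fun g' _ => ?_
  rw [hs]
  rw [rk1_mc c (hat e g) (hat e g') (f x : W k m n d)]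
  split_ifs <;> simp
end
end P1
end Stmt7

open CategoryTheory Finset
set_option synthInstance.maxHeartbeats 1000000
set_option maxHeartbeats 4000000
set_option linter.all false
namespace Stmt7
open CategoryTheory Abelian

section P2
variable {k : Type} [Field k] {m n d : ℕ}

/-- the empty tuple -/
def t00 (d : ℕ) : Fin 0 → Fin d := Fin.elim0
lemma t00_inj : Function.Injective (t00 d) := fun a => a.elim0

lemma P0_range (h2 : (2:k) ≠ 0) (w : (coef0 k m n d).T) : (∃ x, Alt.ev (coef0 k m n d) 0 (t00 d) x = w) ↔ 
    ∀ σ, (coef0 k m n d).R σ w = (1 : k) • w := by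
  rw [Alt.ev_range _ _ t00_inj h2]
  constructor
  · intro h σ
    have := h ⟨(σ, 1), fun j => j.elim0⟩
    simpa using this
  · rintro h ⟨⟨σ, τ⟩, _⟩
    have : τ = 1 := Subsingleton.elim _ _
    subst this
    simpa using h σ

lemma Pd_range (h2 : (2:k) ≠ 0) (w : (coef0 k m n d).T) : (∃ x, Alt.ev (coef0 k m n d) d id x = w) ↔ 
    ∀ σ, (coef0 k m n d).R σ w = ((Equiv.Perm.sign σ : ℤ) : k) • w := by
  rw [Alt.ev_range _ _ Function.injective_id h2]
  constructor
  · intro h σ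
    have := h ⟨(σ, σ⁻¹), fun j => by simp⟩
    simpa using this
  · rintro h ⟨⟨σ, τ⟩, hh⟩
    have : τ = σ⁻¹ := by
      ext j; congr 1
      rw [Equiv.Perm.eq_inv_iff_eq]
      exact hh j
    subst this
    simpa using h σ

/-- constant even word -/
def cev (hm : 0 < m) : Fin d → BIdx m n := fun _ => Sum.inl ⟨0, hm⟩
/-- constant odd word -/
def cod (hn : 0 < n) : Fin d → BIdx m n := fun _ => Sum.inr ⟨0, hn⟩

lemma cev_1 (hm : 0 < m) (σ) (z : W k m n d) : act k σ z (cev hm) = 1 * z (cev hm) := by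
  rw [act_apply, sg_even _ _ (fun _ => rfl)]; rfl
lemma cev_2 (hm : 0 < m) (σ) : act k σ (wd k (cev (n := n) (d := d) hm)) = (1 : k) • wd k (cev hm) := by
  rw [act_wd, sg_even _ _ (fun _ => rfl)]; rfl
lemma cod_1 (hn : 0 < n) (σ) (z : W k m n d) : act k σ z (cod hn) = ((Equiv.Perm.sign σ : ℤ) : k) * z (cod hn) := by
  rw [act_apply, sg_const_odd _ _ (fun _ => rfl)]; rfl
lemma cod_2 (hn : 0 < n) (σ) : act k σ (wd k (cod (m := m) (d := d) hn)) = ((Equiv.Perm.sign σ : ℤ) : k) • wd k (cod hn) := by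
  rw [act_wd, sg_const_odd _ _ (fun _ => rfl)]; rfl

variable {p j : ℕ} [hp : Fact p.Prime] [CharP k p] (h2 : 2 < p) (e : Fin d ≃ Unit × Fin (p ^ (j+1)))

lemma P0_proj (hm : 0 < m) (h2 : (2:k) ≠ 0) : Module.Projective (SAlg k m n d) (Alt (coef0 k m n d) 0) := 
  rk1_proj (fun _ => 1) (cev hm) (cev_1 hm) (cev_2 hm) (Alt.ev (coef0 k m n d) 0 (t00 d)) 
    (Alt.ev_inj _ _ t00_inj) (P0_range h2)

lemma P0_van (hm : 0 < m) (h2 : (2:k) ≠ 0) (t : ℕ) : Van (M0cat k m n d) (Alt (coef0 k m n d) 0) (t+1) := by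
  haveI := P0_proj (n := n) (d := d) hm h2
  exact Van.of_projective t

include h2 in
lemma P0_hom (hm : 0 < m) (φ : Alt (coef0 k m n d) 0 →ₗ[SAlg k m n d] (coefT (k := k) (m := m) (n := n) h2 e).T) : 
    ∃ c : k, ∀ x g, φ x g = c * (x.1 (bt k (t00 d)) : W k m n d) (hat e g) := by
  obtain ⟨x0, h⟩ := rk1_hom (fun _ => 1) (cev hm) (cev_1 hm) (cev_2 hm) (Alt.ev (coef0 k m n d) 0 (t00 d)) 
    (Alt.ev_inj _ _ t00_inj) (P0_range (two_ne h2)) h2 e φ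
  refine ⟨∑ g' : Unit → Fin m, if hat e g' = (cev hm : Fin d → BIdx m n) then φ x0 g' else 0, fun x g => ?_⟩
  rw [h x g, Finset.sum_mul]
  refine Finset.sum_congr rfl fun g' _ => ?_
  split_ifs
  · exact mul_comm _ _
  · rw [zero_mul]

include h2 e in
lemma Pd_acyc (hn : 0 < n) : Acyc (M0cat k m n d) (Alt (coef0 k m n d) d) := by
  intro t
  have hh2 : (2:k) ≠ 0 := two_ne h2
  cases t with
  | succ t => 
    haveI := rk1_proj (fun σ => ((Equiv.Perm.sign σ : ℤ) : k)) (cod hn) (cod_1 hn) (cod_2 hn) (Alt.ev (coef0 k m n d) d id) 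
      (Alt.ev_inj _ _ Function.injective_id) (Pd_range hh2)
    exact Van.of_projective t
  | zero =>
    rw [van_zero_iff]
    intro f
    have key : ∀ φ : Alt (coef0 k m n d) d →ₗ[SAlg k m n d] (coefT (k := k) (m := m) (n := n) h2 e).T, ∀ x g, φ x g = 0 := by
      intro φ
      obtain ⟨x0, h⟩ := rk1_hom (fun σ => ((Equiv.Perm.sign σ : ℤ) : k)) (cod hn) (cod_1 hn) (cod_2 hn) (Alt.ev (coef0 k m n d) d id) 
        (Alt.ev_inj _ _ Function.injective_id) (Pd_range hh2) h2 e φ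
      intro x g
      rw [h x g]
      apply Finset.sum_eq_zero
      intro g' _
      rw [if_neg]
      intro hc
      have := congrFun hc (e.symm ((), ⟨0, pow_pos hp.out.pos _⟩))
      exact Sum.inl_ne_inr this
    refine LinearMap.ext fun x => ?_
    have h3 : (M0equiv h2 e).symm (f x) = 0 := funext fun g => key ((M0equiv h2 e).symm.toLinearMap ∘ₗ f) x g
    exact ((M0equiv h2 e).symm.map_eq_zero_iff).1 h3

include h2 e in
theorem P_acyc (hm : d ≤ m) (hn : d ≤ n) (i : ℕ) (hi : 0 < i) : Acyc (M0cat k m n d) (Alt (coef0 k m n d) i) := by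
  rcases lt_trichotomy i d with h | h | h
  · exact Alt.acyc h2 e hm hn _ i hi (by simpa using h)
  · subst h
    exact Pd_acyc h2 e (by omega)
  · haveI := Alt.subsing (coef0 k m n d) i (by simpa using h)
    exact fun t => Van.of_subsingleton t
end P2
end Stmt7

open CategoryTheory Finset
set_option synthInstance.maxHeartbeats 1000000
set_option maxHeartbeats 4000000
set_option linter.all false
namespace Stmt7
open CategoryTheory Abelian

section Car1
variable {k : Type} [Field k] {d : ℕ} {X : Type} [Fintype X] [DecidableEq X]

lemma swap_bt {i : ℕ} (a b : Fin d) (T : Fin i → Fin d) : 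
    (fun j => bt k T j ∘ Equiv.swap a b) = bt k (⇑(Equiv.swap a b) ∘ T) := by
  rw [bt_comp, Equiv.swap_inv]

lemma bt_update {i : ℕ} (T : Fin i → Fin d) (j : Fin i) (z : Fin d) : 
    bt k (Function.update T j z) = Function.update (bt k T) j (Pi.single z 1) := by
  funext j'
  by_cases h : j' = j
  · subst h; simp [bt]
  · simp [bt, h]

lemma alt_sum_apply {ι V M : Type} [AddCommGroup V] [Module k V] [AddCommGroup M] [Module k M] {i : ℕ} (s : Finset ι) 
    (u : ι → V [⋀^Fin i]→ₗ[k] M) (y : Fin i → V) : (∑ x ∈ s, u x) y = ∑ x ∈ s, u x y := by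
  classical
  induction s using Finset.induction_on with
  | empty => simp
  | insert a s ha ih => rw [Finset.sum_insert ha, Finset.sum_insert ha, AlternatingMap.add_apply, ih]

lemma U_zero {N : ℕ} [NeZero N] (hN : (N : k) = 0) (h2 : (2:k) ≠ 0) (e : Fin d ≃ X × Fin N) {i : ℕ} (U : (Fin d → k) [⋀^Fin i]→ₗ[k] k) 
    (h1 : ∀ y, (∃ j, y j = 1) → U y = 0) (l0 : X)
    (hs : ∀ l, l ≠ l0 → ∀ a y, U (fun j => y j ∘ Equiv.swap (e.symm (l, 0)) (e.symm (l, a))) = U y) 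
    (t : Fin i → X) (ht : Function.Injective t) : 
    ∑ a : Fin N, U (bt k (⇑(Equiv.swap (e.symm (l0, 0)) (e.symm (l0, a))) ∘ (fun j => e.symm (t j, 0)))) = 0 := by
  set T : Fin i → Fin d := fun j => e.symm (t j, 0) with hT
  have hconst : ∀ x : k, ∑ a : Fin N, x = 0 := by intro x; simp [hN]
  by_cases hl : ∃ j, t j = l0
  · obtain ⟨j0, rfl⟩ := hl
    have e1 : ∀ a, ⇑(Equiv.swap (e.symm (t j0, 0)) (e.symm (t j0, a))) ∘ T = Function.update T j0 (e.symm (t j0, a)) := by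
      intro a
      funext j
      by_cases hj : j = j0
      · subst hj; simp [T]
      · rw [Function.update_of_ne hj]
        simp only [T, Function.comp]
        apply Equiv.swap_apply_of_ne_of_ne
        · intro h; have := e.symm.injective h; simp at this; exact hj (ht this)
        · intro h; have := e.symm.injective h; simp at this; exact hj (ht this.1)
    simp only [e1]
    have e2 : ∀ z, U (bt k (Function.update T j0 z)) = U.toMultilinearMap.toLinearMap (bt k T) j0 (Pi.single z 1) := by
      intro z; rw [bt_update]; rfl
    simp only [e2]
    set Λ := U.toMultilinearMap.toLinearMap (bt k T) j0 with hΛ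
    have e3 : Λ 1 = 0 := h1 _ ⟨j0, by simp⟩
    have e4 : (1 : Fin d → k) = ∑ l : X, ∑ a : Fin N, Pi.single (e.symm (l, a)) 1 := by
      rw [← Fintype.sum_prod_type' (fun l a => (Pi.single (e.symm (l, a)) 1 : Fin d → k)), Equiv.sum_comp e.symm (fun z => (Pi.single z 1 : Fin d → k))]
      funext z
      simp [Finset.sum_apply, Pi.single_apply]
    rw [e4, map_sum] at e3
    rw [Finset.sum_eq_single (t j0)] at e3
    · rw [map_sum] at e3; exact e3
    · intro l _ hl
      rw [map_sum]
      have hsl : ∀ a, Λ (Pi.single (e.symm (l, a)) 1) = U (bt k (⇑(Equiv.swap (e.symm (l, 0)) (e.symm (l, a))) ∘ Function.update T j0 (e.symm (l,a)))) := by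
        intro a
        rw [← e2, ← swap_bt, hs l hl]
      by_cases hl' : ∃ j, t j = l
      · obtain ⟨j1, rfl⟩ := hl'
        have hj : j1 ≠ j0 := fun h => hl (by rw [h])
        apply Finset.sum_eq_zero
        intro a _
        have e6 : (⇑(Equiv.swap (e.symm (t j1, 0)) (e.symm (t j1, a))) ∘ Function.update T j0 (e.symm (t j1,a))) = 
            Function.update T j0 (e.symm (t j1,a)) ∘ Equiv.swap j0 j1 := by
          funext j
          simp only [Function.comp]
          by_cases h : j = j0
          · subst h
            rw [Equiv.swap_apply_left, Function.update_self, Equiv.swap_apply_right, Function.update_of_ne hj]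
          · by_cases h' : j = j1
            · subst h'
              rw [Equiv.swap_apply_right, Function.update_self, Function.update_of_ne hj]
              exact Equiv.swap_apply_left _ _
            · rw [Equiv.swap_apply_of_ne_of_ne h h', Function.update_of_ne h]
              apply Equiv.swap_apply_of_ne_of_ne
              · intro h; have := e.symm.injective h; simp at this; exact h' (ht this)
              · intro h; have := e.symm.injective h; simp at this; exact h' (ht this.1)
        have e7 := hsl a
        rw [e6, bt_perm, Equiv.Perm.sign_swap hj.symm, e2] at e7
        have : (2 : k) * Λ (Pi.single (e.symm (t j1, a)) 1) = 0 := by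
          rw [two_mul]; nth_rewrite 1 [e7]; simp
        exact (mul_eq_zero.1 this).resolve_left h2
      · have : ∀ a, Λ (Pi.single (e.symm (l, a)) 1) = Λ (Pi.single (e.symm (l, 0)) 1) := by
          intro a
          rw [hsl a, ← e2]
          congr 2
          funext j
          by_cases hj : j = j0
          · subst hj; simp
          · simp only [Function.comp, Function.update_of_ne hj]
            apply Equiv.swap_apply_of_ne_of_ne
            · intro h; have := e.symm.injective h; simp at this; exact hl' ⟨j, this⟩
            · intro h; have := e.symm.injective h; simp at this; exact hl' ⟨j, this.1⟩
        simp only [this, hconst]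
    · intro h; exact absurd (mem_univ _) h
  · have : ∀ a, ⇑(Equiv.swap (e.symm (l0, 0)) (e.symm (l0, a))) ∘ T = T := by
      intro a
      funext j
      simp only [T, Function.comp]
      apply Equiv.swap_apply_of_ne_of_ne
      · intro h; have := e.symm.injective h; simp at this; exact hl ⟨j, this⟩
      · intro h; have := e.symm.injective h; simp at this; exact hl ⟨j, this.1⟩
    simp only [this, hconst]

/-- block content -/
def bcon {B : Type} [DecidableEq B] {N : ℕ} (e : Fin d ≃ X × Fin N) (h : Fin d → B) : X → B → ℕ := 
  fun l v => (univ.filter fun a : Fin N => h (e.symm (l, a)) = v).card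

lemma swap_blk {N : ℕ} (e : Fin d ≃ X × Fin N) (l : X) (a a' : Fin N) (z : Fin d) : 
    (e (Equiv.swap (e.symm (l, a)) (e.symm (l, a')) z)).1 = (e z).1 := by
  by_cases h1 : z = e.symm (l, a)
  · subst h1; simp
  · by_cases h2 : z = e.symm (l, a')
    · subst h2; simp
    · rw [Equiv.swap_apply_of_ne_of_ne h1 h2]

lemma swap_map {N : ℕ} (e : Fin d ≃ X × Fin N) (l l' : X) (a a' b : Fin N) : 
    Equiv.swap (e.symm (l, a)) (e.symm (l, a')) (e.symm (l', b)) = e.symm (l', if l' = l then Equiv.swap a a' b else b) := by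
  by_cases hl : l' = l
  · subst hl
    simp only [if_true]
    by_cases h1 : b = a
    · subst h1; simp
    · by_cases h2 : b = a'
      · subst h2; simp
      · rw [Equiv.swap_apply_of_ne_of_ne h1 h2, Equiv.swap_apply_of_ne_of_ne]
        · simpa using h1
        · simpa using h2
  · rw [if_neg hl, Equiv.swap_apply_of_ne_of_ne] <;> simp [hl]

lemma bcon_swap {B : Type} [DecidableEq B] {N : ℕ} (e : Fin d ≃ X × Fin N) (h : Fin d → B) (l : X) (a a' : Fin N) : 
    bcon e (h ∘ Equiv.swap (e.symm (l, a)) (e.symm (l, a'))) = bcon e h := by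
  funext l' v
  unfold bcon
  by_cases hl : l' = l
  · refine Finset.card_bij (fun b _ => Equiv.swap a a' b) ?_ ?_ ?_
    · intro b hb
      simp only [mem_filter, mem_univ, true_and, Function.comp, swap_map, hl, if_true] at hb ⊢
      exact hb
    · intro b _ b' _ h; exact (Equiv.swap a a').injective h
    · intro b hb
      refine ⟨Equiv.swap a a' b, ?_, by simp⟩
      simp only [mem_filter, mem_univ, true_and, Function.comp, swap_map, hl, if_true, Equiv.swap_apply_self] at hb ⊢
      exact hb
  · congr 1
    ext b
    simp [swap_map, hl]

lemma class_zero {B : Type} [DecidableEq B] [Fintype B] {N : ℕ} [NeZero N] (hN : (N : k) = 0) (h2 : (2:k) ≠ 0) (e : Fin d ≃ X × Fin N) {i : ℕ} 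
    (u : (Fin d → B) → (Fin d → k) [⋀^Fin i]→ₗ[k] k) 
    (h1 : ∀ h y, (∃ j, y j = 1) → u h y = 0)
    (hs : ∀ h l a y, u (h ∘ Equiv.swap (e.symm (l, 0)) (e.symm (l, a))) (fun j => y j ∘ Equiv.swap (e.symm (l, 0)) (e.symm (l, a))) = u h y)
    (κ : X → B → ℕ) (l0 : X) (v : B) (hκ : (κ l0 v : k) ≠ 0) (t : Fin i → X) (ht : Function.Injective t) : 
    ∑ h ∈ univ.filter (fun h => bcon e h = κ), u h (bt k (fun j => e.symm (t j, 0))) = 0 := by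
  set T : Fin i → Fin d := fun j => e.symm (t j, 0) with hT
  let U : (Fin d → k) [⋀^Fin i]→ₗ[k] k := ∑ h ∈ univ.filter (fun h => bcon e h = κ ∧ h (e.symm (l0, 0)) = v), u h
  have hU : ∀ y, U y = ∑ h : Fin d → B, if bcon e h = κ ∧ h (e.symm (l0, 0)) = v then u h y else 0 := by
    intro y
    simp only [U]
    rw [alt_sum_apply, Finset.sum_filter]
  let E : ∀ (l : X) (a : Fin N), (Fin d → B) ≃ (Fin d → B) := fun l a => Equiv.arrowCongr (Equiv.swap (e.symm (l, 0)) (e.symm (l, a))) (Equiv.refl B)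
  have hE : ∀ l a h, E l a h = h ∘ Equiv.swap (e.symm (l, 0)) (e.symm (l, a)) := fun l a h => by
    change h ∘ ⇑(Equiv.swap (e.symm (l, 0)) (e.symm (l, a))).symm = _
    rw [Equiv.symm_swap]
  have key := U_zero hN h2 e U (fun y hy => by rw [hU]; exact Finset.sum_eq_zero fun h _ => by rw [h1 h y hy, ite_self]) l0 (by
    intro l hl a y
    rw [hU, hU, ← Equiv.sum_comp (E l a)]
    refine Finset.sum_congr rfl fun h _ => ?_
    rw [hE, bcon_swap, hs]
    have : (h ∘ Equiv.swap (e.symm (l, 0)) (e.symm (l, a))) (e.symm (l0, 0)) = h (e.symm (l0, 0)) := by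
      rw [Function.comp, swap_map, if_neg hl.symm]
    rw [this]) t ht
  have h3 : (κ l0 v : k) * ∑ h ∈ univ.filter (fun h => bcon e h = κ), u h (bt k T) = 0 := by
    rw [← key, Finset.mul_sum, Finset.sum_filter]
    have h4 : ∀ h : Fin d → B, (if bcon e h = κ then (κ l0 v : k) * u h (bt k T) else 0) = 
        ∑ a : Fin N, if bcon e h = κ ∧ h (e.symm (l0, a)) = v then u h (bt k T) else 0 := by
      intro h
      by_cases hk : bcon e h = κ
      · rw [if_pos hk]
        simp only [hk, true_and]
        rw [← Finset.sum_filter, Finset.sum_const, ← hk, nsmul_eq_mul]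
        rfl
      · simp [hk]
    simp only [h4]
    rw [Finset.sum_comm]
    refine Finset.sum_congr rfl fun a _ => ?_
    rw [hU, ← Equiv.sum_comp (E l0 a)]
    refine Finset.sum_congr rfl fun h _ => ?_
    rw [hE, bcon_swap]
    have : (h ∘ Equiv.swap (e.symm (l0, 0)) (e.symm (l0, a))) (e.symm (l0, a)) = h (e.symm (l0, 0)) := by
      rw [Function.comp, Equiv.swap_apply_right]
    rw [this]
    congr 1
    rw [← hs h l0 a, swap_bt]
    congr 2
    funext j
    simp [T]
  exact (mul_eq_zero.1 h3).resolve_left hκ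
end Car1
end Stmt7

open CategoryTheory Finset
set_option synthInstance.maxHeartbeats 1000000
set_option maxHeartbeats 4000000
set_option linter.all false
namespace Stmt7
open CategoryTheory Abelian

section Car2
variable {k : Type} [Field k] {m n d : ℕ} {X : Type} [Fintype X] [DecidableEq X]
variable {p : ℕ} [hp : Fact p.Prime] [CharP k p] 

lemma bcon_dvd (e : Fin d ≃ X × Fin (p ^ (0+1))) (h : Fin d → BIdx m n) (hg : ∀ l v, (bcon e h l v : k) = 0) : 
    ∃ f : X → BIdx m n, h = hatb e f := by
  have hp0 : 0 < p ^ (0+1) := pow_pos hp.out.pos _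
  refine ⟨fun l => h (e.symm (l, ⟨0, hp0⟩)), ?_⟩
  funext z
  obtain ⟨⟨l, a⟩, rfl⟩ := e.symm.surjective z
  simp only [hatb, Equiv.apply_symm_apply]
  set v := h (e.symm (l, ⟨0, hp0⟩)) with hv
  have h1 := (CharP.cast_eq_zero_iff k p _).1 (hg l v)
  have h3 : 0 < bcon e h l v := by
    unfold bcon
    rw [Finset.card_pos]
    exact ⟨⟨0, hp0⟩, by simp [hv]⟩
  have h4 : p ≤ bcon e h l v := Nat.le_of_dvd h3 h1
  have h5 : univ.filter (fun a : Fin (p ^ (0+1)) => h (e.symm (l, a)) = v) = univ := by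
    apply Finset.eq_univ_of_card
    apply le_antisymm (Finset.card_le_univ _)
    refine le_trans ?_ h4
    simp
  have := Finset.mem_univ a
  rw [← h5, mem_filter] at this
  exact this.2

lemma bcon_hat (e : Fin d ≃ X × Fin (p ^ (0+1))) (f : X → BIdx m n) (l v) : (bcon e (hatb e f) l v : k) = 0 := by
  unfold bcon
  simp only [hatb, Equiv.apply_symm_apply]
  by_cases h : f l = v
  · simp [h]
  · simp [h]

lemma blk_sum (h2 : 2 < p) (e : Fin d ≃ X × Fin (p ^ (0+1))) [NeZero (p ^ (0+1))] {i : ℕ} 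
    (u : (Fin d → BIdx m n) → (Fin d → k) [⋀^Fin i]→ₗ[k] k) 
    (h1 : ∀ h y, (∃ j, y j = 1) → u h y = 0)
    (hs : ∀ h l a y, u (h ∘ Equiv.swap (e.symm (l, 0)) (e.symm (l, a))) (fun j => y j ∘ Equiv.swap (e.symm (l, 0)) (e.symm (l, a))) = u h y)
    (h3 : ∀ (f : X → BIdx m n) x, bpar (f x) = true → u (hatb e f) = 0)
    (t : Fin i → X) (ht : Function.Injective t) :
    ∑ h, u h (bt k (fun j => e.symm (t j, 0))) = ∑ f : X → Fin m, u (hat e f) (bt k (fun j => e.symm (t j, 0))) := by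
  classical
  set y0 := bt k (fun j => e.symm (t j, 0)) with hy0
  have hN : ((p ^ (0+1) : ℕ) : k) = 0 := by simp
  rw [← Finset.sum_filter_add_sum_filter_not univ (fun h : Fin d → BIdx m n => ∀ l v, (bcon e h l v : k) = 0)]
  have hbad : ∑ h ∈ univ.filter (fun h : Fin d → BIdx m n => ¬ ∀ l v, (bcon e h l v : k) = 0), u h y0 = 0 := by
    rw [← Finset.sum_fiberwise_of_maps_to (fun h hh => Finset.mem_image_of_mem (bcon e) hh)]
    apply Finset.sum_eq_zero
    intro κ hκ
    obtain ⟨h0, hh0, rfl⟩ := Finset.mem_image.1 hκ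
    rw [mem_filter] at hh0
    obtain ⟨_, hb⟩ := hh0
    have hb' := hb
    push Not at hb'
    obtain ⟨l, v, hlv⟩ := hb'
    refine Eq.trans ?_ (class_zero hN (two_ne h2) e u h1 hs (bcon e h0) l v hlv t ht)
    refine Finset.sum_congr ?_ (fun _ _ => rfl)
    ext h
    simp only [mem_filter, mem_univ, true_and]
    constructor
    · exact fun h => h.2
    · intro h; exact ⟨by rw [h]; exact hb, h⟩
  rw [hbad, add_zero]
  refine (Finset.sum_of_injOn (fun f => (hat e f : Fin d → BIdx m n)) ?_ ?_ ?_ ?_).symm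
  · intro f _ f' _ h
    funext x
    have := congrFun h (e.symm (x, 0))
    simpa [hat] using this
  · intro f _
    simp only [coe_filter, mem_univ, true_and]
    exact fun l v => bcon_hat e (fun x => Sum.inl (f x)) l v
  · intro h hh hnot
    obtain ⟨f, rfl⟩ := bcon_dvd e h (mem_filter.1 hh).2
    have : ∃ x, bpar (f x) = true := by
      by_contra hc
      push Not at hc
      apply hnot
      have : ∀ x, ∃ y, f x = Sum.inl y := by
        intro x
        have := hc x
        cases hfx : f x with
        | inl y => exact ⟨y, rfl⟩
        | inr y => rw [hfx] at this; exact absurd rfl this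
      choose F hF using this
      refine ⟨F, by simp, ?_⟩
      funext z
      simp [hat, hatb, hF]
    obtain ⟨x, hx⟩ := this
    rw [h3 f x hx]
    rfl
  · intro f _
    rfl

/-- evaluation at a word, level zero -/
def wv (h : Fin d → BIdx m n) : (coef0 k m n d).T →ₗ[k] k := wev k h

/-- component -/
def fw {i : ℕ} (F : (Fin d → k) [⋀^Fin i]→ₗ[k] (coef0 k m n d).T) (h : Fin d → BIdx m n) : (Fin d → k) [⋀^Fin i]→ₗ[k] k := 
  (wv h).compAlternatingMap F

lemma fw_apply {i : ℕ} (F : (Fin d → k) [⋀^Fin i]→ₗ[k] (coef0 k m n d).T) (h y) : fw F h y = (F y : W k m n d) h := rfl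

/-- assemble -/
def asm0 {i : ℕ} (φ : (Fin d → BIdx m n) → (Fin d → k) [⋀^Fin i]→ₗ[k] k) : (Fin d → k) [⋀^Fin i]→ₗ[k] (coef0 k m n d).T := 
  AlternatingMap.pi φ

lemma fw_asm0 {i : ℕ} (φ : (Fin d → BIdx m n) → (Fin d → k) [⋀^Fin i]→ₗ[k] k) (h) : fw (asm0 φ) h = φ h := rfl

lemma fw_ext {i : ℕ} {F G : (Fin d → k) [⋀^Fin i]→ₗ[k] (coef0 k m n d).T} (H : ∀ h, fw F h = fw G h) : F = G := by
  ext y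
  funext h
  exact congrFun (congrArg DFunLike.coe (H h)) y

lemma fw_eqv {i : ℕ} (F : Alt (coef0 k m n d) i) (σ : Equiv.Perm (Fin d)) (h) (y) : 
    fw F.1 (h ∘ σ) (fun j => y j ∘ σ) = sg k σ (h ∘ σ) * fw F.1 h y := by
  have h1 : (act k σ (F.1 y : W k m n d)) (h ∘ σ) = (F.1 (fun j => y j ∘ σ) : W k m n d) (h ∘ σ) := congrFun (Alt.eqv F σ y) (h ∘ σ)
  refine h1.symm.trans ?_
  refine (act_apply σ (F.1 y : W k m n d) (h ∘ σ)).trans ?_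
  have e : (h ∘ σ) ∘ ⇑σ⁻¹ = h := by funext z; simp
  rw [e]
  rfl

lemma mem_Alt0 {i : ℕ} (F : (Fin d → k) [⋀^Fin i]→ₗ[k] (coef0 k m n d).T)
    (H : ∀ (σ : Equiv.Perm (Fin d)) h y, fw F (h ∘ σ) (fun j => y j ∘ σ) = sg k σ (h ∘ σ) * fw F h y) : F ∈ Alt (coef0 k m n d) i := by
  intro σ y
  funext h
  change (act k σ (F y : W k m n d)) h = fw F h (fun j => y j ∘ σ)
  have := H σ (h ∘ ⇑σ⁻¹) y
  have e : (h ∘ ⇑σ⁻¹) ∘ ⇑σ = h := by funext z; simp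
  rw [e] at this
  rw [this]
  exact (act_apply σ (F y : W k m n d) h)

variable (k m n d) in
/-- cycles -/
def ZZ (i : ℕ) : Submodule (SAlg k m n d) (Alt (coef0 k m n d) i) where
  carrier := {F | ∀ y, (∃ j, y j = 1) → F.1 y = 0}
  zero_mem' := fun y _ => rfl
  add_mem' := fun {F G} hF hG y hy => by
    change F.1 y + G.1 y = 0
    rw [hF y hy, hG y hy, add_zero]
  smul_mem' := fun a F hF y hy => by
    change a • F.1 y = 0
    rw [hF y hy, smul_zero]

/-- section -/
def sst (k : Type) [Field k] (e : Fin d ≃ X × Fin (p ^ (0+1))) : (X → k) →ₗ[k] (Fin d → k) where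
  toFun y := fun z => if ((e z).2 : ℕ) = 0 then y (e z).1 else 0
  map_add' y y' := by funext z; simp only [Pi.add_apply]; split_ifs <;> simp
  map_smul' c y := by funext z; simp only [Pi.smul_apply, RingHom.id_apply]; split_ifs <;> simp

lemma sst_bt (e : Fin d ≃ X × Fin (p ^ (0+1))) [NeZero (p ^ (0+1))] {i : ℕ} (t : Fin i → X) : 
    (fun j => sst k e (bt k t j)) = bt k (fun j => e.symm (t j, 0)) := by
  funext j z
  obtain ⟨⟨l, a⟩, rfl⟩ := e.symm.surjective z
  simp only [sst, bt, LinearMap.coe_mk, AddHom.coe_mk, Equiv.apply_symm_apply, Pi.single_apply, EmbeddingLike.apply_eq_iff_eq, Prod.mk.injEq]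
  have : (a : ℕ) = 0 ↔ a = 0 := by rw [Fin.ext_iff]; rfl
  simp only [this]
  by_cases h1 : a = 0 <;> by_cases h2 : l = t j <;> simp [h1, h2]

/-- lift of a permutation -/
def lft (e : Fin d ≃ X × Fin (p ^ (0+1))) (σ : Equiv.Perm X) : Equiv.Perm (Fin d) := (e.trans (Equiv.prodCongr σ (Equiv.refl _))).trans e.symm

lemma lft_apply (e : Fin d ≃ X × Fin (p ^ (0+1))) (σ : Equiv.Perm X) (z) : e (lft e σ z) = (σ (e z).1, (e z).2) := by simp [lft, Prod.map]

/-- Cartier map on forms -/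
def carf (h2 : 2 < p) (e : Fin d ≃ X × Fin (p ^ (0+1))) {i : ℕ} (F : (Fin d → k) [⋀^Fin i]→ₗ[k] (coef0 k m n d).T) : 
    (X → k) [⋀^Fin i]→ₗ[k] (coefT (k := k) (m := m) (n := n) h2 e).T := asm h2 e (fun g => (fw F (hat e g)).compLinearMap (sst k e))

lemma carf_apply (h2 : 2 < p) (e : Fin d ≃ X × Fin (p ^ (0+1))) {i : ℕ} (F : (Fin d → k) [⋀^Fin i]→ₗ[k] (coef0 k m n d).T) (y g) : 
    carf h2 e F y g = fw F (hat e g) (fun j => sst k e (y j)) := rfl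

lemma carf_mem (h2 : 2 < p) (e : Fin d ≃ X × Fin (p ^ (0+1))) {i : ℕ} (F : Alt (coef0 k m n d) i) : 
    carf h2 e F.1 ∈ Alt (coefT (k := k) (m := m) (n := n) h2 e) i := by
  intro σ y
  funext g
  rw [coefT_R, carf_apply, carf_apply]
  have h1 := fw_eqv F (lft e σ) (hat e (g ∘ ⇑σ⁻¹)) (fun j => sst k e (y j))
  have h3 : (hat e (g ∘ ⇑σ⁻¹) : Fin d → BIdx m n) ∘ ⇑(lft e σ) = hat e g := by
    funext z; simp [hat, lft_apply]
  rw [h3, sg_even _ _ (hat_par e g), one_mul] at h1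
  rw [← h1]
  congr 1
  funext j z
  simp [sst, lft_apply]

lemma carf_smul (h2 : 2 < p) (e : Fin d ≃ X × Fin (p ^ (0+1))) {i : ℕ} (F : ZZ k m n d i) (a : SAlg k m n d) : 
    carf h2 e (a • F.1.1) = a • carf h2 e F.1.1 := by
  haveI : NeZero (p ^ (0+1)) := ⟨(pow_pos hp.out.pos _).ne'⟩
  apply alt_ext_bt
  intro t ht
  funext g
  rw [AlternatingMap.smul_apply, coefT_smul]
  simp only [carf_apply]
  rw [sst_bt]
  have h1 := blk_sum h2 e (fun h => mc a.e (hat e g) h • fw F.1.1 h) ?_ ?_ ?_ t ht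
  · refine Eq.trans ?_ h1
    rw [fw_apply]
    exact end_apply a.e (F.1.1 (bt k (fun j => e.symm (t j, 0))) : W k m n d) (hat e g)
  · intro h y hy
    have : fw F.1.1 h y = 0 := congrFun (F.2 y hy) h
    rw [AlternatingMap.smul_apply, this, smul_zero]
  · intro h l c y
    have hfib := swap_blk e l 0 c
    set σ := Equiv.swap (e.symm (l, 0)) (e.symm (l, c)) with hσ
    simp only [AlternatingMap.smul_apply, smul_eq_mul]
    have h3 : hat (n := n) e g = hat e g ∘ σ := by
      funext z; simp [hat, hfib]
    rw [fw_eqv, h3, mc_perm (a.comm σ), ← h3, sg_even σ (hat e g) (hat_par e g)]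
    have := sg_sq (k := k) σ (h ∘ σ)
    linear_combination (mc a.e (hat e g) h * fw F.1.1 h y) * this
  · intro f x hx
    have : mc a.e (hat e g) (hatb e f) = 0 := by
      refine fib_zero (k := k) h2 e (fun h => mc a.e (hat e g) h) ?_ f x hx
      intro σ hσ h
      have h3 : hat (n := n) e g = hat e g ∘ σ := by
        funext z; simp [hat, hσ]
      rw [smul_eq_mul]
      conv_lhs => rw [h3, mc_perm (a.comm σ), ← h3, sg_even σ (hat e g) (hat_par e g), mul_one]
    simp only [this, zero_smul]

/-- Cartier map -/
def car (h2 : 2 < p) (e : Fin d ≃ X × Fin (p ^ (0+1))) (i : ℕ) : ZZ k m n d i →ₗ[SAlg k m n d] Alt (coefT (k := k) (m := m) (n := n) h2 e) i where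
  toFun F := ⟨carf h2 e F.1.1, carf_mem h2 e F.1⟩
  map_add' F G := rfl
  map_smul' a F := Subtype.ext (carf_smul h2 e F a)

end Car2
end Stmt7

open CategoryTheory Finset
set_option synthInstance.maxHeartbeats 1000000
set_option maxHeartbeats 4000000
set_option linter.all false
namespace Stmt7
open CategoryTheory Abelian

section Kil
variable {k : Type} [Field k] {V T : Type} [AddCommGroup V] [Module k V] [AddCommGroup T] [Module k T]

/-- vectors killing a form -/
def Kil {i : ℕ} (φ : V [⋀^Fin i]→ₗ[k] T) : Submodule k V where
  carrier := {u | ∀ y j, y j = u → φ y = 0}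
  zero_mem' := fun y j h => φ.map_coord_zero j h
  add_mem' := fun {a b} ha hb y j h => by
    have e : y = Function.update y j (a + b) := by rw [← h, Function.update_eq_self]
    rw [e, φ.map_update_add, ha _ j (by simp), hb _ j (by simp), add_zero]
  smul_mem' := fun c a ha y j h => by
    have e : y = Function.update y j (c • a) := by rw [← h, Function.update_eq_self]
    rw [e, φ.map_update_smul, ha _ j (by simp), smul_zero]

lemma kill {i : ℕ} (φ : V [⋀^Fin i]→ₗ[k] T) (y y' : Fin i → V) (h : ∀ j, y j - y' j ∈ Kil φ) : φ y = φ y' := by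
  have key : ∀ s : Finset (Fin i), φ (s.piecewise y' y) = φ y := by
    intro s
    induction s using Finset.induction_on with
    | empty => simp
    | insert j s hj ih =>
      rw [Finset.piecewise_insert, ← ih]
      have e : s.piecewise y' y = Function.update (s.piecewise y' y) j (y j) := by
        conv_lhs => rw [← Function.update_eq_self j (s.piecewise y' y)]
        simp [hj]
      conv_rhs => rw [e]
      rw [eq_comm, ← sub_eq_zero, ← φ.map_update_sub]
      exact h j _ j (by simp)
  rw [← key univ, Finset.piecewise_univ]

lemma cur_kil {i : ℕ} (φ : V [⋀^Fin (i+1)]→ₗ[k] T) (u : V) (h : φ.curryLeft u = 0) : u ∈ Kil φ := by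
  intro y j hj
  have e : Matrix.vecCons u (Matrix.vecTail (y ∘ Equiv.swap 0 j)) = y ∘ Equiv.swap 0 j := by
    funext z
    refine Fin.cases ?_ (fun z => rfl) z
    simp [hj]
  have h1 := congrFun (congrArg DFunLike.coe h) (Matrix.vecTail (y ∘ Equiv.swap 0 j))
  rw [AlternatingMap.curryLeft_apply_apply, e, φ.map_perm] at h1
  have h3 : Equiv.Perm.sign (Equiv.swap 0 j) • φ y = 0 := h1
  exact (smul_eq_zero_iff_eq _).1 h3

lemma kil_iff {i : ℕ} (φ : V [⋀^Fin i]→ₗ[k] T) (u : V) : u ∈ Kil φ ↔ ∀ y, (∃ j, y j = u) → φ y = 0 := 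
  ⟨fun h y ⟨j, hj⟩ => h y j hj, fun h y j hj => h y ⟨j, hj⟩⟩

lemma kil_cur {i : ℕ} (φ : V [⋀^Fin (i+1)]→ₗ[k] T) (u : V) (h : u ∈ Kil φ) : φ.curryLeft u = 0 := by
  ext y
  rw [AlternatingMap.curryLeft_apply_apply]
  exact h _ 0 rfl

lemma wedge_sec {i : ℕ} (φ : V [⋀^Fin i]→ₗ[k] T) (l : V →ₗ[k] k) (u : V) (h : u ∈ Kil φ) (hl : l u = 1) : 
    (wedge l φ).curryLeft u = φ := by
  cases i with
  | zero => rw [wedge_cur0, hl, one_smul]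
  | succ i => rw [wedge_cur, hl, one_smul, kil_cur φ u h, wedge_zero, sub_zero]

variable {X : Type} [Fintype X] [DecidableEq X]

lemma refl_kil (h2 : (2:k) ≠ 0) {i : ℕ} (φ : (X → k) [⋀^Fin i]→ₗ[k] T) (x x' : X) 
    (h : ∀ y, φ (fun j => y j ∘ Equiv.swap x x') = φ y) : (Pi.single x 1 - Pi.single x' 1 : X → k) ∈ Kil φ := by
  by_cases hx : x = x'
  · subst hx; rw [sub_self]; exact zero_mem _
  cases i with
  | zero => intro y j; exact j.elim0
  | succ i =>
    apply cur_kil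
    refine refl_even h2 (rl x x') _ (refl_u x x' hx) _ ?_
    intro y
    rw [← h y]
    simp only [swap_refl x x' hx]

lemma one_kil {N d : ℕ} [NeZero N] (hN : (N : k) = 0) (e : Fin d ≃ X × Fin N) (K : Submodule k (Fin d → k)) 
    (h : ∀ l a, (Pi.single (e.symm (l, a)) 1 - Pi.single (e.symm (l, 0)) 1 : Fin d → k) ∈ K) : (1 : Fin d → k) ∈ K := by
  have e4 : (1 : Fin d → k) = ∑ l : X, ∑ a : Fin N, Pi.single (e.symm (l, a)) 1 := by
    rw [← Fintype.sum_prod_type' (fun l a => (Pi.single (e.symm (l, a)) 1 : Fin d → k)), Equiv.sum_comp e.symm (fun z => (Pi.single z 1 : Fin d → k))]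
    funext z
    simp [Finset.sum_apply, Pi.single_apply]
  rw [e4]
  refine Submodule.sum_mem _ fun l _ => ?_
  have : ∑ a : Fin N, (Pi.single (e.symm (l, a)) 1 : Fin d → k) = ∑ a : Fin N, (Pi.single (e.symm (l, a)) 1 - Pi.single (e.symm (l, 0)) 1 : Fin d → k) := by
    rw [Finset.sum_sub_distrib, Finset.sum_const, Finset.card_univ, Fintype.card_fin, ← Nat.cast_smul_eq_nsmul k, hN, zero_smul, sub_zero]
  rw [this]
  exact Submodule.sum_mem _ fun a _ => h l a
end Kil

section Orb
variable {d : ℕ} {B : Type}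

variable (d B) in
/-- orbit relation -/
def ws : Setoid (Fin d → B) where
  r h h' := ∃ σ : Equiv.Perm (Fin d), h' = h ∘ σ
  iseqv := ⟨fun h => ⟨1, rfl⟩, fun {h h'} ⟨σ, e⟩ => ⟨σ⁻¹, by subst e; funext z; simp⟩, 
    fun {a b c} ⟨σ, e⟩ ⟨τ, e'⟩ => ⟨σ * τ, by subst e e'; rfl⟩⟩

/-- class -/
def cls (h : Fin d → B) : Quotient (ws d B) := Quotient.mk _ h

lemma cls_comp (h : Fin d → B) (σ : Equiv.Perm (Fin d)) : cls (h ∘ σ) = cls h := 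
  (Quotient.sound ⟨σ, rfl⟩ : Quotient.mk (ws d B) h = Quotient.mk (ws d B) (h ∘ σ)).symm

lemma cls_ex {h h' : Fin d → B} (e : cls h = cls h') : ∃ σ : Equiv.Perm (Fin d), h' = h ∘ σ := Quotient.exact e

/-- multiplicity -/
def mul' {X B : Type} [Fintype X] [DecidableEq B] (h : X → B) (v : B) : ℕ := (univ.filter fun z => h z = v).card

lemma mul'_comp {X B : Type} [Fintype X] [DecidableEq B] (h : X → B) (σ : Equiv.Perm X) (v : B) : mul' (h ∘ σ) v = mul' h v := by
  unfold mul'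
  refine Finset.card_bij (fun z _ => σ z) ?_ ?_ ?_
  · intro z hz; simpa using hz
  · intro a _ b _ h; exact σ.injective h
  · intro z hz; exact ⟨σ⁻¹ z, by simpa using hz, by simp⟩

lemma mul'_ex {X Y B : Type} [Fintype X] [Fintype Y] [DecidableEq B] (h : X → B) (h' : Y → B) 
    (H : ∀ v, mul' h v = mul' h' v) : ∃ σ : X ≃ Y, h = h' ∘ σ := by
  have : ∀ v, Nonempty ({z // h z = v} ≃ {z // h' z = v}) := by
    intro v
    rw [← Fintype.card_eq, Fintype.card_subtype, Fintype.card_subtype]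
    exact H v
  let f := fun v => (this v).some
  refine ⟨Equiv.ofFiberEquiv f, ?_⟩
  funext z
  exact (Equiv.ofFiberEquiv_map f z).symm

lemma mul'_pos {X B : Type} [Fintype X] [DecidableEq B] (h : X → B) (z) : 0 < mul' h (h z) := by
  unfold mul'
  rw [Finset.card_pos]
  exact ⟨z, by simp⟩

variable {X : Type} [Fintype X] [DecidableEq X] {m n : ℕ} {p : ℕ}

lemma mul'_hat (e : Fin d ≃ X × Fin (p ^ (0+1))) (g : X → Fin m) (v : Fin m) : 
    mul' (hat e g : Fin d → BIdx m n) (Sum.inl v) = p * mul' g v := by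
  unfold mul'
  have : (univ.filter fun z => (hat e g : Fin d → BIdx m n) z = Sum.inl v) = ((univ.filter fun x => g x = v) ×ˢ (univ : Finset (Fin (p ^ (0+1))))).map e.symm.toEmbedding := by
    ext z
    simp [hat]
  rw [this, Finset.card_map, Finset.card_product]
  simp [mul_comm]

lemma mul'_hat' (e : Fin d ≃ X × Fin (p ^ (0+1))) (g : X → Fin m) (v : Fin n) : 
    mul' (hat e g : Fin d → BIdx m n) (Sum.inr v) = 0 := by
  simp [mul', hat]

lemma hat_orb (hp : 0 < p) (e : Fin d ≃ X × Fin (p ^ (0+1))) (g g' : X → Fin m) (h : cls (hat e g : Fin d → BIdx m n) = cls (hat e g')) : 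
    ∃ τ : Equiv.Perm X, g' = g ∘ τ := by
  obtain ⟨σ, hσ⟩ := cls_ex h
  apply mul'_ex g' g
  intro v
  have := mul'_comp (hat e g : Fin d → BIdx m n) σ (Sum.inl v)
  rw [← hσ, mul'_hat, mul'_hat] at this
  exact Nat.eq_of_mul_eq_mul_left hp this

lemma sum_mul' {X B : Type} [Fintype X] [Fintype B] [DecidableEq B] (h : X → B) : ∑ v, mul' h v = Fintype.card X := by
  unfold mul'
  rw [← Finset.card_eq_sum_card_fiberwise (fun x _ => mem_univ (h x))]
  rfl

lemma good_hat (hp : 0 < p) (e : Fin d ≃ X × Fin (p ^ (0+1))) (h : Fin d → BIdx m n) (h1 : ∀ v, p ∣ mul' h v) 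
    (h2 : ∀ z, bpar (h z) = false) : ∃ g : X → Fin m, cls (hat e g : Fin d → BIdx m n) = cls h := by
  have h0 : ∀ v : Fin n, mul' h (Sum.inr v) = 0 := by
    intro v
    unfold mul'
    rw [Finset.card_eq_zero, Finset.filter_eq_empty_iff]
    intro z _ hz
    have := h2 z
    rw [hz] at this
    exact absurd this (by simp [bpar])
  choose q hq using fun v : Fin m => h1 (Sum.inl v)
  have hc : Fintype.card X = Fintype.card (Σ v : Fin m, Fin (q v)) := by
    rw [Fintype.card_sigma]
    simp only [Fintype.card_fin]
    have h3 := sum_mul' h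
    rw [Fintype.sum_sum_type] at h3
    simp only [h0, hq, Finset.sum_const_zero, add_zero, ← Finset.mul_sum] at h3
    have h4 := Fintype.card_congr e
    rw [h4, Fintype.card_prod] at h3
    simp only [Fintype.card_fin, zero_add, pow_one] at h3
    rw [mul_comm] at h3
    exact (Nat.eq_of_mul_eq_mul_right hp h3).symm
  obtain ⟨E⟩ : Nonempty (X ≃ Σ v : Fin m, Fin (q v)) := ⟨Fintype.equivOfCardEq hc⟩
  refine ⟨fun x => (E x).1, ?_⟩
  have hg : ∀ v, mul' (fun x => (E x).1) v = q v := by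
    intro v
    unfold mul'
    have inj : Function.Injective (fun a : Fin (q v) => E.symm ⟨v, a⟩) := by
      intro a b hab
      have h5 : (⟨v, a⟩ : Σ v : Fin m, Fin (q v)) = ⟨v, b⟩ := E.symm.injective hab
      exact eq_of_heq (Sigma.mk.inj h5).2
    have : (univ.filter fun x => (E x).1 = v) = (univ : Finset (Fin (q v))).map ⟨fun a => E.symm ⟨v, a⟩, inj⟩ := by
      ext x
      simp only [mem_filter, mem_univ, true_and, mem_map, Function.Embedding.coeFn_mk]
      constructor
      · intro hx
        subst hx
        exact ⟨(E x).2, E.symm_apply_apply x⟩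
      · rintro ⟨a, rfl⟩
        rw [E.apply_symm_apply]
    rw [this, Finset.card_map]
    simp
  obtain ⟨σ, hσ⟩ := mul'_ex (hat e (fun x => (E x).1) : Fin d → BIdx m n) h (by
    intro v
    cases v with
    | inl v => rw [mul'_hat, hg, hq]
    | inr v => rw [mul'_hat', h0])
  rw [hσ]
  exact cls_comp h σ
end Orb
end Stmt7

open CategoryTheory Finset
set_option synthInstance.maxHeartbeats 1000000
set_option maxHeartbeats 4000000
set_option linter.all false
namespace Stmt7
open CategoryTheory Abelian

section Car4
lemma wedge_smul {k M T : Type} [Field k] [AddCommGroup M] [Module k M] [AddCommGroup T] [Module k T] (c : k) (l : M →ₗ[k] k) {i : ℕ} (φ : M [⋀^Fin i]→ₗ[k] T) : wedge l (c • φ) = c • wedge l φ := by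
  ext y
  rw [AlternatingMap.smul_apply]
  simp only [wedge_apply, AlternatingMap.smul_apply, Finset.smul_sum]
  refine Finset.sum_congr rfl fun j _ => ?_
  rw [smul_comm c, smul_comm c]

lemma comp_swap {X B : Type} [DecidableEq X] (h : X → B) (z z' : X) (hz : h z = h z') : h ∘ Equiv.swap z z' = h := by
  funext x
  simp only [Function.comp]
  by_cases h1 : x = z
  · subst h1; rw [Equiv.swap_apply_left, hz]
  · by_cases h2 : x = z'
    · subst h2; rw [Equiv.swap_apply_right, hz]
    · rw [Equiv.swap_apply_of_ne_of_ne h1 h2]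

variable {k : Type} [Field k] {m n d : ℕ} {X : Type} [Fintype X] [DecidableEq X]
variable {p : ℕ} [hp : Fact p.Prime] [CharP k p] 

lemma fw_kil (h2 : (2:k) ≠ 0) {i : ℕ} (F : Alt (coef0 k m n d) i) (h : Fin d → BIdx m n) (he : ∀ z, bpar (h z) = false) 
    (z z' : Fin d) (hz : h z = h z') : (Pi.single z 1 - Pi.single z' 1 : Fin d → k) ∈ Kil (fw F.1 h) := by
  refine refl_kil h2 _ z z' fun y => ?_
  have := fw_eqv F (Equiv.swap z z') h y
  rw [comp_swap h z z' hz, sg_even _ _ he, one_mul] at this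
  exact this

lemma hat_one_kil (h2 : 2 < p) (e : Fin d ≃ X × Fin (p ^ (0+1))) {i : ℕ} (F : Alt (coef0 k m n d) i) (g : X → Fin m) : 
    (1 : Fin d → k) ∈ Kil (fw F.1 (hat e g)) := by
  haveI : NeZero (p ^ (0+1)) := ⟨(pow_pos hp.out.pos _).ne'⟩
  refine one_kil (by simp) e _ fun l a => fw_kil (two_ne h2) F _ (hat_par e g) _ _ (by simp [hat])

lemma dd_mem (i : ℕ) (G : Alt (coef0 k m n d) (i+1)) : dd _ i G ∈ ZZ k m n d i := by
  rintro y ⟨j, hj⟩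
  change G.1.curryLeft 1 y = 0
  rw [AlternatingMap.curryLeft_apply_apply]
  exact G.1.map_eq_zero_of_eq _ (i := 0) (j := j.succ) (by simp [hj]) (Fin.succ_ne_zero j).symm

lemma car_dd (h2 : 2 < p) (e : Fin d ≃ X × Fin (p ^ (0+1))) (i : ℕ) (G : Alt (coef0 k m n d) (i+1)) : 
    car h2 e i ⟨dd _ i G, dd_mem i G⟩ = 0 := by
  refine Subtype.ext ?_
  change carf h2 e (dd _ i G).1 = 0
  ext y
  funext g
  rw [carf_apply]
  change fw G.1 (hat e g) (Matrix.vecCons 1 _) = 0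
  exact hat_one_kil h2 e G g _ 0 rfl

lemma fw_hat_zero (h2 : 2 < p) (e : Fin d ≃ X × Fin (p ^ (0+1))) {i : ℕ} (F : Alt (coef0 k m n d) i) 
    (hF : carf h2 e F.1 = 0) (g : X → Fin m) (h : Fin d → BIdx m n) (hh : cls (hat e g) = cls h) : fw F.1 h = 0 := by
  haveI : NeZero (p ^ (0+1)) := ⟨(pow_pos hp.out.pos _).ne'⟩
  have h1 : fw F.1 (hat e g) = 0 := by
    apply alt_ext_bt
    intro T hT
    have ht : (2:k) ≠ 0 := two_ne h2
    rw [kill _ (bt k T) (bt k (fun j => e.symm ((e (T j)).1, 0))) (fun j => fw_kil ht F _ (hat_par e g) _ _ (by simp [hat]))]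
    rw [← sst_bt e (fun j => (e (T j)).1), ← carf_apply h2, hF]
    rfl
  obtain ⟨σ, rfl⟩ := cls_ex hh
  ext y
  have := fw_eqv F σ (hat e g) (fun j => y j ∘ ⇑σ⁻¹)
  have e1 : (fun j => (y j ∘ ⇑σ⁻¹) ∘ ⇑σ) = y := by funext j z; simp
  rw [e1, h1] at this
  rw [this]
  simp

section Hom
open Classical in
/-- functional, even non-divisible letter -/
noncomputable def lA (k : Type) [Field k] (h : Fin d → BIdx m n) (v : BIdx m n) : (Fin d → k) →ₗ[k] k := 
  ((mul' h v : ℕ) : k)⁻¹ • ∑ z ∈ univ.filter (fun z => h z = v), (LinearMap.proj z : (Fin d → k) →ₗ[k] k)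

lemma lA_one (h : Fin d → BIdx m n) (v) (hv : ((mul' h v : ℕ) : k) ≠ 0) : lA k h v 1 = 1 := by
  unfold lA
  rw [LinearMap.smul_apply, LinearMap.sum_apply]
  simp only [LinearMap.proj_apply, Pi.one_apply, Finset.sum_const, nsmul_eq_mul, mul_one, smul_eq_mul]
  have : #(univ.filter (fun z => h z = v)) = mul' h v := by unfold mul'; congr
  rw [this, inv_mul_cancel₀ hv]

lemma lA_comp (h : Fin d → BIdx m n) (v) (σ : Equiv.Perm (Fin d)) : lA k (h ∘ σ) v ∘ₗ LinearMap.funLeft k k σ = lA k h v := by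
  refine LinearMap.ext fun y => ?_
  unfold lA
  simp only [LinearMap.comp_apply, LinearMap.smul_apply, LinearMap.sum_apply, LinearMap.proj_apply, LinearMap.funLeft_apply, mul'_comp]
  congr 1
  refine Finset.sum_bij (fun z _ => σ z) ?_ ?_ ?_ ?_
  · intro z hz; simpa using hz
  · intro a _ b _ h; exact σ.injective h
  · intro z hz; exact ⟨σ⁻¹ z, by simpa using hz, by simp⟩
  · intro z _; rfl

open Classical in
/-- functional, odd letter -/
noncomputable def lO (k : Type) [Field k] (h : Fin d → BIdx m n) (v : BIdx m n) : (Fin d → k) →ₗ[k] k := 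
  if H : ∃ z, h z = v then LinearMap.proj H.choose else 0

open Classical in
/-- the functional -/
noncomputable def wl (k : Type) [Field k] (c : Quotient (ws d (BIdx m n))) (h : Fin d → BIdx m n) : (Fin d → k) →ₗ[k] k := 
  if HA : ∃ v, ∃ h, cls h = c ∧ ((mul' h v : ℕ) : k) ≠ 0 then lA k h HA.choose else 
  if HO : ∃ v, bpar v = true ∧ ∃ h : Fin d → BIdx m n, cls h = c ∧ ∃ z, h z = v then lO k h HO.choose else 0

lemma wl_spec (h2 : 2 < p) (e : Fin d ≃ X × Fin (p ^ (0+1))) {i : ℕ} (F : Alt (coef0 k m n d) i) 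
    (hF : carf h2 e F.1 = 0) (h : Fin d → BIdx m n) : wl k (cls h) h 1 = 1 ∨ fw F.1 h = 0 := by
  unfold wl
  split_ifs with HA HO
  · left
    apply lA_one
    obtain ⟨h', e1, e2⟩ := HA.choose_spec
    obtain ⟨σ, rfl⟩ := cls_ex e1
    rw [mul'_comp]
    exact e2
  · left
    obtain ⟨_, h', e1, z, e2⟩ := HO.choose_spec
    obtain ⟨σ, hσ⟩ := cls_ex e1
    have : ∃ z, h z = HO.choose := ⟨σ⁻¹ z, by refine (congrFun hσ _).trans ?_; simp [e2]⟩
    unfold lO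
    rw [dif_pos this]
    rfl
  · right
    obtain ⟨g, hg⟩ := good_hat hp.out.pos e h (by
      intro v
      by_contra hc
      exact HA ⟨v, h, rfl, fun h0 => hc ((CharP.cast_eq_zero_iff k p _).1 h0)⟩) (by
      intro z
      by_contra hc
      exact HO ⟨h z, by simpa using hc, h, rfl, z, rfl⟩)
    exact fw_hat_zero h2 e F hF g h hg

lemma wl_comp (h2 : (2:k) ≠ 0) {i : ℕ} (F : Alt (coef0 k m n d) i) (h : Fin d → BIdx m n) (σ : Equiv.Perm (Fin d)) : 
    wedge (wl k (cls h) (h ∘ σ) ∘ₗ LinearMap.funLeft k k σ) (fw F.1 h) = wedge (wl k (cls h) h) (fw F.1 h) := by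
  unfold wl
  split_ifs with HA HO
  · rw [lA_comp]
  · obtain ⟨hv, h', e1, z, e2⟩ := HO.choose_spec
    set v := HO.choose
    obtain ⟨τ, hτ⟩ := cls_ex e1
    have H1 : ∃ z, h z = v := ⟨τ⁻¹ z, by refine (congrFun hτ _).trans ?_; simp [e2]⟩
    have H2 : ∃ z, (h ∘ σ) z = v := ⟨σ⁻¹ H1.choose, by simp [H1.choose_spec]⟩
    unfold lO
    rw [dif_pos H1, dif_pos H2]
    have s1 := H1.choose_spec
    have s2 := H2.choose_spec
    set z1 := H1.choose
    set z2 := H2.choose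
    have : (LinearMap.proj z2 ∘ₗ LinearMap.funLeft k k σ : (Fin d → k) →ₗ[k] k) = LinearMap.proj z1 + rl (σ z2) z1 := by
      refine LinearMap.ext fun y => ?_
      simp [rl_apply, LinearMap.funLeft_apply]
    rw [this, wedge_add_left]
    by_cases hz : σ z2 = z1
    · have : (rl (σ z2) z1 : (Fin d → k) →ₗ[k] k) = 0 := LinearMap.ext fun y => by simp [rl_apply, hz]
      rw [this, ← zero_smul k (0 : (Fin d → k) →ₗ[k] k), wedge_smul_left, zero_smul, add_zero]
    · rw [refl_odd h2 (rl (σ z2) z1) (Pi.single (σ z2) 1 - Pi.single z1 1), add_zero]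
      intro y
      have h3 := fw_eqv F (Equiv.swap (σ z2) z1) h y
      have s2' : h (σ z2) = v := s2
      rw [comp_swap h _ _ (s2'.trans s1.symm), sg_swap _ _ hz _ (by rw [s2', hv]) (by rw [s1, hv]), neg_one_mul] at h3
      simp only [swap_refl _ _ hz] at h3
      exact h3
  · rfl

theorem car_ker (h2 : 2 < p) (e : Fin d ≃ X × Fin (p ^ (0+1))) {i : ℕ} (F : ZZ k m n d i) (hF : car h2 e i F = 0) : 
    ∃ G, dd _ i G = F.1 := by
  have hF' : carf h2 e F.1.1 = 0 := congrArg Subtype.val hF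
  refine ⟨⟨asm0 (fun h => wedge (wl k (cls h) h) (fw F.1.1 h)), mem_Alt0 _ ?_⟩, ?_⟩
  · intro σ h y
    rw [fw_asm0, fw_asm0]
    have h1 : (fw F.1.1 (h ∘ σ)).compLinearMap (LinearMap.funLeft k k σ) = sg k σ (h ∘ σ) • fw F.1.1 h := by
      ext y
      exact fw_eqv F.1 σ h y
    have h3 := congrFun (congrArg DFunLike.coe (wedge_pre (wl k (cls (h ∘ σ)) (h ∘ σ)) (fw F.1.1 (h ∘ σ)) (LinearMap.funLeft k k σ))) y
    rw [h1, wedge_smul, cls_comp, wl_comp (two_ne h2)] at h3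
    rw [cls_comp]
    exact h3.symm
  · refine Subtype.ext (fw_ext fun h => ?_)
    change (wedge (wl k (cls h) h) (fw F.1.1 h)).curryLeft 1 = _
    rcases wl_spec h2 e F.1 hF' h with h1 | h1
    · refine wedge_sec _ _ _ ?_ h1
      intro y j hj
      exact congrFun (F.2 y ⟨j, hj⟩) h
    · rw [h1, wedge_zero]
      rfl
end Hom
end Car4
end Stmt7

open CategoryTheory Finset
set_option synthInstance.maxHeartbeats 1000000
set_option maxHeartbeats 4000000
set_option linter.all false
namespace Stmt7
open CategoryTheory Abelian

section Car5
variable {k : Type} [Field k] {m n d : ℕ} {X : Type} [Fintype X] [DecidableEq X]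
variable {p : ℕ} [hp : Fact p.Prime] [CharP k p] 

open Classical in
/-- position vector of a letter -/
noncomputable def posv (k : Type) [Field k] (g : X → Fin m) (b : BIdx m n) : X → k := 
  if H : ∃ x, Sum.inl (g x) = b then Pi.single H.choose 1 else 0

/-- collapse -/
noncomputable def lam (k : Type) [Field k] (h : Fin d → BIdx m n) (g : X → Fin m) : (Fin d → k) →ₗ[k] (X → k) where
  toFun y := ∑ z, y z • posv k g (h z)
  map_add' y y' := by simp only [Pi.add_apply, add_smul, Finset.sum_add_distrib]
  map_smul' c y := by simp only [Pi.smul_apply, smul_eq_mul, mul_smul, RingHom.id_apply, Finset.smul_sum]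

lemma lam_apply (h : Fin d → BIdx m n) (g : X → Fin m) (y) : lam k h g y = ∑ z, y z • posv k g (h z) := rfl

lemma lam_comp (h : Fin d → BIdx m n) (g : X → Fin m) (y) (σ : Equiv.Perm (Fin d)) : lam k (h ∘ σ) g (y ∘ σ) = lam k h g y := by
  rw [lam_apply, lam_apply]
  exact Equiv.sum_comp σ (fun z => y z • posv k g (h z))

lemma lam_hat (e : Fin d ≃ X × Fin (p ^ (0+1))) (g g' : X → Fin m) (y : Fin d → k) : 
    lam k (hat e g : Fin d → BIdx m n) g' y = ∑ x, ∑ a, y (e.symm (x, a)) • posv k g' (Sum.inl (g x) : BIdx m n) := by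
  rw [lam_apply, ← Equiv.sum_comp e.symm, Fintype.sum_prod_type]
  simp [hat]

lemma lam_one (e : Fin d ≃ X × Fin (p ^ (0+1))) (h : Fin d → BIdx m n) (g g' : X → Fin m) (hh : cls (hat e g') = cls h) : 
    lam k h g 1 = 0 := by
  obtain ⟨σ, rfl⟩ := cls_ex hh
  have : (1 : Fin d → k) = (1 : Fin d → k) ∘ σ := rfl
  rw [this, lam_comp, lam_hat]
  apply Finset.sum_eq_zero
  intro x _
  simp only [Pi.one_apply, Finset.sum_const, Finset.card_univ, Fintype.card_fin]
  rw [← Nat.cast_smul_eq_nsmul k]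
  simp

lemma lam_sst (e : Fin d ≃ X × Fin (p ^ (0+1))) (g g' : X → Fin m) (y : X → k) : 
    lam k (hat e g : Fin d → BIdx m n) g' (sst k e y) = ∑ x, y x • posv k g' (Sum.inl (g x) : BIdx m n) := by
  haveI : NeZero (p ^ (0+1)) := ⟨(pow_pos hp.out.pos _).ne'⟩
  rw [lam_hat]
  refine Finset.sum_congr rfl fun x _ => ?_
  rw [Finset.sum_eq_single 0]
  · simp [sst]
  · intro a _ ha
    have : (a : ℕ) ≠ 0 := fun h => ha (Fin.ext h)
    simp [sst, this, ha]
  · simp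

open Classical in
/-- lift on components -/
noncomputable def psi (h2 : 2 < p) (e : Fin d ≃ X × Fin (p ^ (0+1))) {i : ℕ} (G : Alt (coefT (k := k) (m := m) (n := n) h2 e) i) 
    (c : Quotient (ws d (BIdx m n))) (h : Fin d → BIdx m n) : (Fin d → k) [⋀^Fin i]→ₗ[k] k := 
  if H : ∃ g, cls (hat e g) = c then ((evg (n := n) h2 e H.choose).compAlternatingMap G.1).compLinearMap (lam k h H.choose) else 0

lemma D_kil (h2 : 2 < p) (e : Fin d ≃ X × Fin (p ^ (0+1))) {i : ℕ} (G : Alt (coefT (k := k) (m := m) (n := n) h2 e) i) (g : X → Fin m)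
    (x x' : X) (hg : g x = g x') : (Pi.single x 1 - Pi.single x' 1 : X → k) ∈ Kil ((evg (n := n) h2 e g).compAlternatingMap G.1) := by
  refine refl_kil (two_ne h2) _ x x' fun y => ?_
  have := congrFun (Alt.eqv G (Equiv.swap x x') y) g
  rw [coefT_R, Equiv.swap_inv, comp_swap g x x' hg] at this
  exact this.symm

theorem car_surj (h2 : 2 < p) (e : Fin d ≃ X × Fin (p ^ (0+1))) (i : ℕ) : Function.Surjective (car (k := k) (m := m) (n := n) h2 e i) := by
  intro G
  have hmem : asm0 (fun h => psi h2 e G (cls h) h) ∈ Alt (coef0 k m n d) i := by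
    apply mem_Alt0
    intro σ h y
    rw [fw_asm0, fw_asm0, cls_comp]
    unfold psi
    split_ifs with H
    · have : sg k σ (h ∘ σ) = 1 := by
        apply sg_even
        intro z
        obtain ⟨τ, hτ⟩ := cls_ex H.choose_spec
        have := congrFun hτ (σ z)
        simp only [Function.comp] at this ⊢
        rw [this]
        rfl
      rw [this, one_mul]
      simp only [AlternatingMap.compLinearMap_apply, lam_comp]
    · simp
  refine ⟨⟨⟨_, hmem⟩, ?_⟩, ?_⟩
  · rintro y ⟨j, hj⟩
    funext h
    change psi h2 e G (cls h) h y = 0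
    unfold psi
    split_ifs with H
    · rw [AlternatingMap.compLinearMap_apply]
      apply AlternatingMap.map_coord_zero _ j
      simp only [hj]
      exact lam_one e h _ _ H.choose_spec
    · rfl
  · refine Subtype.ext ?_
    change carf h2 e (asm0 (fun h => psi h2 e G (cls h) h)) = G.1
    ext y
    funext g
    rw [carf_apply, fw_asm0]
    have H : ∃ g', cls (hat e g' : Fin d → BIdx m n) = cls (hat e g) := ⟨g, rfl⟩
    unfold psi
    rw [dif_pos H]
    have hs := H.choose_spec
    set g0 := H.choose
    obtain ⟨τ, hτ⟩ := hat_orb hp.out.pos e g0 g hs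
    rw [AlternatingMap.compLinearMap_apply]
    simp only [lam_sst]
    have h1 := congrFun (Alt.eqv G τ (fun j => ∑ x, y j x • posv k g0 (Sum.inl (g x) : BIdx m n))) g
    rw [coefT_R] at h1
    have h3 : g ∘ ⇑τ⁻¹ = g0 := by rw [hτ]; funext z; simp
    rw [h3] at h1
    refine h1.trans ?_
    refine (kill ((evg (n := n) h2 e g).compAlternatingMap G.1) _ _ ?_).symm
    intro j
    have h4 : y j - (∑ x, y j x • posv k g0 (Sum.inl (g x) : BIdx m n)) ∘ ⇑τ = ∑ x, y j x • (Pi.single x 1 - posv k g0 (Sum.inl (g x) : BIdx m n) ∘ τ) := by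
      funext z
      simp [Finset.sum_apply, mul_sub, Finset.sum_sub_distrib, Pi.single_apply]
    rw [h4]
    refine Submodule.sum_mem _ fun x _ => Submodule.smul_mem _ _ ?_
    have Hx : ∃ x', (Sum.inl (g0 x') : BIdx m n) = Sum.inl (g x) := ⟨τ x, by rw [hτ]; rfl⟩
    unfold posv
    rw [dif_pos Hx]
    have hx := Sum.inl_injective Hx.choose_spec
    have h5 : (Pi.single Hx.choose 1 : X → k) ∘ τ = Pi.single (τ⁻¹ Hx.choose) 1 := by
      funext z
      simp only [Function.comp, Pi.single_apply]
      congr 1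
      rw [Equiv.Perm.eq_inv_iff_eq]
    rw [h5]
    apply D_kil
    refine hx.symm.trans (congrFun h3 _).symm
end Car5
end Stmt7

open CategoryTheory Finset
set_option synthInstance.maxHeartbeats 1000000
set_option maxHeartbeats 4000000
set_option linter.all false
namespace Stmt7
open CategoryTheory Abelian

section L0
variable {k : Type} [Field k] {m n d : ℕ} {X : Type} [Fintype X] [DecidableEq X]
variable {p : ℕ} [hp : Fact p.Prime] [CharP k p] 

section K
variable {j : ℕ} (h2 : 2 < p) (e : Fin d ≃ X × Fin (p ^ (j+1)))

lemma D_kos_van [Nonempty X] {j' : ℕ} (e0 : Fin d ≃ Unit × Fin (p ^ (j'+1))) (hm : d ≤ m) (hn : d ≤ n) (q : ℕ) (hq : Fintype.card X = q + 1) (u : ℕ) (hu : u < q) :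
    Van (M0cat k m n d) (Alt (coefT (k := k) (m := m) (n := n) h2 e) (q+1)) u := by
  have key : ∀ i s, i ≤ q → s < i → Van (M0cat k m n d) (LinearMap.range (kos (coefT (k := k) (m := m) (n := n) h2 e) i)) s := by
    intro i
    induction i with
    | zero => intro s _ h; omega
    | succ i ih =>
      intro s hi hs
      have hac := Alt.acyc h2 e0 hm hn (coefT (k := k) (m := m) (n := n) h2 e) (i+1) (by omega) (by omega)
      cases s with
      | zero => exact Van.right_zero (LinearMap.rangeRestrict (kos (coefT (k := k) (m := m) (n := n) h2 e) (i+1))) (LinearMap.surjective_rangeRestrict _) (hac 0)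
      | succ s =>
        refine Van.right (Submodule.subtype (LinearMap.range (kos (coefT (k := k) (m := m) (n := n) h2 e) i))) (LinearMap.rangeRestrict (kos (coefT (k := k) (m := m) (n := n) h2 e) (i+1))) 
          (Submodule.subtype_injective _) ?_ (LinearMap.surjective_rangeRestrict _) (add_comm 1 s) (ih s (by omega) (by omega)) (hac _)
        intro F
        constructor
        · intro h
          obtain ⟨G, rfl⟩ := kos_exact h2 e i F (congrArg Subtype.val h)
          exact ⟨⟨_, G, rfl⟩, rfl⟩
        · rintro ⟨⟨_, G, rfl⟩, rfl⟩
          exact Subtype.ext (kos_kos _ _ G)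
  have : LinearMap.range (kos (coefT (k := k) (m := m) (n := n) h2 e) q) = ⊤ := by
    rw [LinearMap.range_eq_top]
    intro F
    refine kos_exact h2 e q F ?_
    haveI := Alt.subsing (coefT (k := k) (m := m) (n := n) h2 e) (q+1+1) (by omega)
    exact Subsingleton.elim _ _
  have h1 := key q u le_rfl hu
  rw [this] at h1
  exact Van.of_equiv Submodule.topEquiv.symm h1
end K

variable (k m n d) in
/-- boundaries -/
abbrev BB (i : ℕ) := LinearMap.range (dd (coef0 k m n d) i)

/-- boundaries into cycles -/
def bz (i : ℕ) : BB k m n d i →ₗ[SAlg k m n d] ZZ k m n d i := Submodule.inclusion (by rintro _ ⟨G, rfl⟩; exact dd_mem i G)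

lemma bz_inj (i : ℕ) : Function.Injective (bz (k := k) (m := m) (n := n) (d := d) i) := Submodule.inclusion_injective _

lemma bz_exact (h2 : 2 < p) (e : Fin d ≃ X × Fin (p ^ (0+1))) (i : ℕ) : Function.Exact (bz (k := k) (m := m) (n := n) i) (car h2 e i) := by
  intro F
  constructor
  · intro h
    obtain ⟨G, hG⟩ := car_ker h2 e F h
    exact ⟨⟨_, G, rfl⟩, Subtype.ext hG⟩
  · rintro ⟨⟨_, G, rfl⟩, rfl⟩
    exact car_dd h2 e i G

lemma zp_exact (i : ℕ) : Function.Exact (Submodule.subtype (ZZ k m n d (i+1))) (LinearMap.rangeRestrict (dd (coef0 k m n d) i)) := by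
  intro F
  constructor
  · intro h
    refine ⟨⟨F, ?_⟩, rfl⟩
    rintro y ⟨j, hj⟩
    exact cur_kil F.1 1 (congrArg Subtype.val (congrArg Subtype.val h)) y j hj
  · rintro ⟨F, rfl⟩
    refine Subtype.ext (Subtype.ext ?_)
    exact kil_cur F.1.1 1 (fun y j hj => F.2 y ⟨j, hj⟩)

variable (h2 : 2 < p) (e : Fin d ≃ X × Fin (p ^ (0+1))) {j' : ℕ} (e0 : Fin d ≃ Unit × Fin (p ^ (j'+1))) (hm : d ≤ m) (hn : d ≤ n)

include h2 e0 hm hn in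
lemma zb_sh (i : ℕ) : Sh (M0cat k m n d) 1 (ZZ k m n d (i+1)) (BB k m n d i) := by
  have hac := P_acyc (k := k) h2 e0 hm hn (i+1) (by omega)
  exact Sh.one (Submodule.subtype _) (LinearMap.rangeRestrict (dd (coef0 k m n d) i)) (Submodule.subtype_injective _) 
    (zp_exact i) (LinearMap.surjective_rangeRestrict _) (fun s => hac _) (fun s => Or.inl (hac _))

include h2 e0 hm hn in
lemma bb_zero (i : ℕ) : Van (M0cat k m n d) (BB k m n d i) 0 := 
  Van.right_zero (LinearMap.rangeRestrict (dd (coef0 k m n d) i)) (LinearMap.surjective_rangeRestrict _) 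
    (P_acyc (k := k) h2 e0 hm hn (i+1) (by omega) 0)

lemma bb_big (i : ℕ) (hi : d ≤ i) (t : ℕ) : Van (M0cat k m n d) (BB k m n d i) t := by
  haveI : Subsingleton (Alt (coef0 k m n d) (i+1)) := Alt.subsing (coef0 k m n d) (i+1) (by rw [Fintype.card_fin]; omega)
  haveI : Subsingleton (BB k m n d i) := ⟨by
    rintro ⟨_, G, rfl⟩ ⟨_, G', rfl⟩
    rw [Subsingleton.elim G G']⟩
  exact Van.of_subsingleton t

include h2 e e0 hm hn in
lemma zz_big (i : ℕ) (hi : Fintype.card X < i) (h3 : Acyc (M0cat k m n d) (BB k m n d i)) : Acyc (M0cat k m n d) (ZZ k m n d i) := by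
  intro t
  haveI : Subsingleton (Alt (coefT (k := k) (m := m) (n := n) h2 e) i) := Alt.subsing _ i hi
  have hz : Van (M0cat k m n d) (Alt (coefT (k := k) (m := m) (n := n) h2 e) i) t := Van.of_subsingleton t
  exact Van.mid (X := BB k m n d i) (Y := ZZ k m n d i) (Z := Alt (coefT (k := k) (m := m) (n := n) h2 e) i) (bz i) (car h2 e i) (bz_inj i) (bz_exact h2 e i) (car_surj h2 e i) (h3 t) hz

include h2 e e0 hm hn in
lemma bb_acyc (i : ℕ) (hi : Fintype.card X ≤ i) : Acyc (M0cat k m n d) (BB k m n d i) := by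
  have key : ∀ a i, i + a = d + Fintype.card X → Fintype.card X ≤ i → Acyc (M0cat k m n d) (BB k m n d i) := by
    intro a
    induction a with
    | zero =>
      intro i hi _ t
      exact bb_big i (by omega) t
    | succ a ih =>
      intro i hi hi'
      have h3 := ih (i+1) (by omega) (by omega)
      have h4 := zz_big h2 e e0 hm hn (i+1) (by omega) h3
      intro t
      cases t with
      | zero => exact bb_zero h2 e0 hm hn i
      | succ t => exact ((zb_sh h2 e0 hm hn i).van rfl).1 (h4 t)
  rcases le_or_gt i (d + Fintype.card X) with h | h
  · exact key (d + Fintype.card X - i) i (by omega) hi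
  · intro t
    exact bb_big i (by omega) t

/-- an acyclic quotient -/
lemma Sh.sub {A : Type} [Ring A] [HasExt.{1} (ModuleCat.{0} A)] {L : ModuleCat.{0} A} {X Y Z : Type} [AddCommGroup X] [AddCommGroup Y] [AddCommGroup Z] [Module A X] [Module A Y] [Module A Z]
    (f : X →ₗ[A] Y) (g : Y →ₗ[A] Z) (hf : Function.Injective f) (hfg : Function.Exact f g) (hg : Function.Surjective g) (h0 : Acyc L Z) : Sh L 0 Y X := by
  refine Sh.of_pull f fun t => ?_
  obtain ⟨θ, e1, e2, e3, e4⟩ := les L f g hf hfg hg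
  refine ⟨?_, fun x => e1 t (1+t) rfl x (h0 _ _)⟩
  intro a b hab
  have : pull L f (a - b) = 0 := by
    have h5 := pull_add (L := L) f (a - b) b
    rw [sub_add_cancel, hab] at h5
    exact right_eq_add.1 h5
  obtain ⟨z, hz⟩ := e2 t (a - b) this
  rw [h0 t z, pull_zero] at hz
  exact sub_eq_zero.1 hz.symm

include h2 e e0 hm hn in
lemma bz_sh (i : ℕ) (hi : 0 < i) (hi' : i < Fintype.card X) : Sh (M0cat k m n d) 0 (ZZ k m n d i) (BB k m n d i) := 
  Sh.sub (X := BB k m n d i) (Y := ZZ k m n d i) (Z := Alt (coefT (k := k) (m := m) (n := n) h2 e) i) (bz i) (car h2 e i) (bz_inj i) (bz_exact h2 e i) (car_surj h2 e i) (Alt.acyc h2 e0 hm hn _ i hi hi')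

include h2 e e0 hm hn in
lemma bb_van (s i : ℕ) (h : s + i < Fintype.card X) : Van (M0cat k m n d) (BB k m n d i) s := by
  induction s generalizing i with
  | zero => exact bb_zero h2 e0 hm hn i
  | succ s ih => 
    exact ((zb_sh h2 e0 hm hn i).van rfl).1 (((bz_sh h2 e e0 hm hn (i+1) (by omega) (by omega)).van (add_zero s)).2 (ih (i+1) (by omega)))

/-- all zero-cycles -/
def zz0 : Alt (coef0 k m n d) 0 ≃ₗ[SAlg k m n d] ZZ k m n d 0 where
  toFun F := ⟨F, fun y ⟨j, _⟩ => j.elim0⟩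
  invFun F := F.1
  map_add' _ _ := rfl
  map_smul' _ _ := rfl
  left_inv _ := rfl
  right_inv _ := rfl

include h2 hm in
lemma zz0_van (hd : 0 < d) (t : ℕ) : Van (M0cat k m n d) (ZZ k m n d 0) (t+1) := 
  Van.of_equiv zz0.symm (P0_van (by omega) (two_ne h2) t)

include h2 e e0 hm hn in
lemma b0_sh (hd : 0 < d) : Sh (M0cat k m n d) 1 (BB k m n d 0) (Alt (coefT (k := k) (m := m) (n := n) h2 e) 0) := by
  refine Sh.one (X := BB k m n d 0) (Y := ZZ k m n d 0) (Z := Alt (coefT (k := k) (m := m) (n := n) h2 e) 0) (bz 0) (car h2 e 0) (bz_inj 0) (bz_exact h2 e 0) (car_surj h2 e 0) (zz0_van h2 hm hd) ?_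
  intro s
  cases s with
  | zero => right; exact bb_zero h2 e0 hm hn 0
  | succ s => left; exact zz0_van h2 hm hd s

variable (q : ℕ) (hq : Fintype.card X = q + 1)

include h2 e e0 hm hn hq in
lemma b0_sh' : Sh (M0cat k m n d) (q+1) (Alt (coefT (k := k) (m := m) (n := n) h2 e) (q+1)) (BB k m n d 0) := by
  have key : ∀ a i, i + a = q → Sh (M0cat k m n d) (a+1) (Alt (coefT (k := k) (m := m) (n := n) h2 e) (q+1)) (BB k m n d i) := by
    intro a
    induction a with
    | zero => 
      intro i hi
      have hi : i = q := by omega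
      subst hi
      have h3 := Sh.quot (X := BB k m n d (i+1)) (Y := ZZ k m n d (i+1)) (Z := Alt (coefT (k := k) (m := m) (n := n) h2 e) (i+1)) (bz (i+1)) (car h2 e (i+1)) (bz_inj (i+1)) (bz_exact h2 e (i+1)) (car_surj h2 e (i+1)) (bb_acyc h2 e e0 hm hn (i+1) (by omega))
      exact Sh.trans h3 (zb_sh h2 e0 hm hn i) rfl
    | succ a ih =>
      intro i hi
      have h3 := Sh.trans (ih (i+1) (by omega)) (bz_sh h2 e e0 hm hn (i+1) (by omega) (by omega)).symm0 (add_zero _)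
      exact Sh.trans h3 (zb_sh h2 e0 hm hn i) rfl
  exact key q 0 (by omega)

include h2 e e0 hm hn hq in
theorem D0_sh : Sh (M0cat k m n d) (2 * (q+1)) (Alt (coefT (k := k) (m := m) (n := n) h2 e) 0) (Alt (coefT (k := k) (m := m) (n := n) h2 e) 0) := by
  haveI : Nonempty X := Fintype.card_pos_iff.1 (by omega)
  have hd : 0 < d := by
    have := Fintype.card_congr e0
    simp at this
    rw [this]
    exact pow_pos hp.out.pos _
  exact Sh.trans (Sh.trans (D_kos h2 e e0 hm hn q hq) (b0_sh' h2 e e0 hm hn q hq) rfl) (b0_sh h2 e e0 hm hn hd) (by omega)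

include h2 e e0 hm hn hq in
theorem D0_van (t : ℕ) (ht : ¬ 2 * (q+1) ∣ t) : Van (M0cat k m n d) (Alt (coefT (k := k) (m := m) (n := n) h2 e) 0) t := by
  haveI : Nonempty X := Fintype.card_pos_iff.1 (by omega)
  have hd : 0 < d := by
    have := Fintype.card_congr e0
    simp at this
    rw [this]
    exact pow_pos hp.out.pos _
  induction t using Nat.strong_induction_on with
  | _ t ih =>
  rcases le_or_gt (2 * (q+1)) t with h | h
  · obtain ⟨s, rfl⟩ := Nat.exists_eq_add_of_le' h
    refine ((D0_sh h2 e e0 hm hn q hq).van rfl).1 (ih s (by omega) ?_)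
    intro hc
    exact ht (Dvd.dvd.add hc dvd_rfl)
  · have h0 : t ≠ 0 := by rintro rfl; exact ht (dvd_zero _)
    obtain ⟨s, rfl⟩ := Nat.exists_eq_succ_of_ne_zero h0
    refine ((b0_sh h2 e e0 hm hn hd).van rfl).1 ?_
    rcases lt_or_ge s (q+1) with h1 | h1
    · exact bb_van h2 e e0 hm hn s 0 (by omega)
    · obtain ⟨u, rfl⟩ := Nat.exists_eq_add_of_le' h1
      exact ((b0_sh' h2 e e0 hm hn q hq).van rfl).1 (D_kos_van h2 e e0 hm hn q hq u (by omega))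

include h2 e e0 hm in
theorem D0_hom (hd : 0 < d) (φ ψ : Alt (coefT (k := k) (m := m) (n := n) h2 e) 0 →ₗ[SAlg k m n d] (coefT (k := k) (m := m) (n := n) h2 e0).T) 
    (hψ : ψ ≠ 0) : ∃ c : k, ∀ x g, φ x g = c * ψ x g := by
  obtain ⟨a, ha⟩ := P0_hom h2 e0 (show 0 < m by omega) (φ ∘ₗ car h2 e 0 ∘ₗ (zz0 (k := k) (m := m) (n := n) (d := d)).toLinearMap)
  obtain ⟨b, hb⟩ := P0_hom h2 e0 (show 0 < m by omega) (ψ ∘ₗ car h2 e 0 ∘ₗ (zz0 (k := k) (m := m) (n := n) (d := d)).toLinearMap)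
  have hs : ∀ x, ∃ y : Alt (coef0 k m n d) 0, car h2 e 0 (zz0 y) = x := by
    intro x
    obtain ⟨y, hy⟩ := car_surj h2 e 0 x
    exact ⟨y.1, hy⟩
  have hb0 : b ≠ 0 := by
    rintro rfl
    apply hψ
    refine LinearMap.ext fun x => ?_
    obtain ⟨y, rfl⟩ := hs x
    funext g
    refine (hb y g).trans (zero_mul _)
  refine ⟨a / b, fun x g => ?_⟩
  obtain ⟨y, rfl⟩ := hs x
  have h3 := ha y g
  have h4 := hb y g
  simp only [LinearMap.comp_apply, LinearEquiv.coe_coe] at h3 h4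
  rw [h3, h4]
  field_simp
end L0
end Stmt7

open CategoryTheory Finset
set_option synthInstance.maxHeartbeats 1000000
set_option maxHeartbeats 4000000
set_option linter.all false
namespace Stmt7
open CategoryTheory Abelian

section Poly
open MvPolynomial

/-- being a derivation -/
def IsDer {k R : Type} [CommRing k] [CommRing R] [Algebra k R] (A : Module.End k R) : Prop :=
  ∀ f g, A (f * g) = A f * g + f * A g

theorem IsDer.one {k R : Type} [CommRing k] [CommRing R] [Algebra k R] {A : Module.End k R}
    (h : IsDer A) : A 1 = 0 := by
  have := h 1 1
  simpa using this

theorem IsDer.comm {k R : Type} [CommRing k] [CommRing R] [Algebra k R] {A B : Module.End k R}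
    (hA : IsDer A) (hB : IsDer B) : IsDer (A * B - B * A) := by
  intro f g
  simp only [LinearMap.sub_apply, Module.End.mul_apply, hA f g, hB f g, map_add, hA _ _, hB _ _]
  ring

theorem IsDer.ext {σ k : Type} [CommRing k] {A B : Module.End k (MvPolynomial σ k)}
    (hA : IsDer A) (hB : IsDer B) (h : ∀ i, A (X i) = B (X i)) : A = B := by
  refine LinearMap.ext fun f => ?_
  induction f using MvPolynomial.induction_on with
  | C a =>
    have e : (C a : MvPolynomial σ k) = a • (1 : MvPolynomial σ k) := by
      rw [smul_eq_C_mul, mul_one]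
    rw [e, map_smul, map_smul, hA.one, hB.one]
  | add f g hf hg => rw [map_add, map_add, hf, hg]
  | mul_X f i hf => rw [hA, hB, hf, h]

theorem IsDer.zero {k R : Type} [CommRing k] [CommRing R] [Algebra k R] :
    IsDer (0 : Module.End k R) := by
  intro f g; simp

open TensorProduct in
theorem IsDer.pow {k R : Type} [Field k] [CommRing R] [Algebra k R] (p : ℕ) [Fact p.Prime]
    [CharP k p] {A : Module.End k R} (hA : IsDer A) : IsDer (A ^ p) := by
  let a : Module.End k (R ⊗[k] R) := TensorProduct.map A LinearMap.id
  let b : Module.End k (R ⊗[k] R) := TensorProduct.map LinearMap.id A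
  have hab : Commute a b := by
    refine TensorProduct.ext' fun x y => ?_
    simp [a, b]
  have ha : ∀ n x y, (a ^ n) (x ⊗ₜ y) = ((A ^ n) x) ⊗ₜ y := by
    intro n
    induction n with
    | zero => intro x y; simp
    | succ n ih =>
      intro x y
      rw [pow_succ, Module.End.mul_apply, pow_succ, Module.End.mul_apply, ← ih]
      simp [a]
  have hb : ∀ n x y, (b ^ n) (x ⊗ₜ y) = x ⊗ₜ ((A ^ n) y) := by
    intro n
    induction n with
    | zero => intro x y; simp
    | succ n ih =>
      intro x y
      rw [pow_succ, Module.End.mul_apply, pow_succ, Module.End.mul_apply, ← ih]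
      simp [b]
  have hm : ∀ n z, (A ^ n) (LinearMap.mul' k R z) = LinearMap.mul' k R (((a + b) ^ n) z) := by
    intro n
    induction n with
    | zero => intro z; simp
    | succ n ih =>
      intro z
      rw [pow_succ, Module.End.mul_apply, pow_succ, Module.End.mul_apply, ← ih]
      congr 1
      induction z with
      | zero => simp
      | tmul x y => simp [a, b, hA x y]
      | add x y hx hy => rw [map_add, map_add, map_add, map_add, hx, hy]
  intro f g
  haveI : CharP k p := inferInstance
  rcases subsingleton_or_nontrivial (Module.End k (R ⊗[k] R)) with hs | hs
  · have h0 := hm p (f ⊗ₜ g)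
    have e : (a+b)^p = a^p + b^p := Subsingleton.elim _ _
    rw [e, LinearMap.add_apply, map_add, ha, hb] at h0
    simpa using h0
  · haveI : CharP (Module.End k (R ⊗[k] R)) p :=
      charP_of_injective_algebraMap (algebraMap k (Module.End k (R ⊗[k] R))).injective p
    have h0 := hm p (f ⊗ₜ g)
    rw [add_pow_char_of_commute p hab, LinearMap.add_apply, map_add, ha, hb] at h0
    simpa using h0

variable {ι k : Type} [DecidableEq ι] [Field k] {p : ℕ} [Fact p.Prime] [CharP k p]

/-- the variable, zero when out of range -/
noncomputable def px (v : ι) (i : ℕ) : MvPolynomial (ι × Fin p) k :=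
  if h : i < p then X (v, ⟨i, h⟩) else 0

theorem px_ge (v : ι) (i : ℕ) (h : p ≤ i) : (px v i : MvPolynomial (ι × Fin p) k) = 0 :=
  dif_neg (by omega)

theorem X_eq_px (z : ι × Fin p) : (X z : MvPolynomial (ι × Fin p) k) = px z.1 z.2 := by
  rw [px, dif_pos z.2.2]

/-- linear map underlying derivation with given values on variables -/
noncomputable def lder (f : ι → ℕ → MvPolynomial (ι × Fin p) k) :
    Module.End k (MvPolynomial (ι × Fin p) k) :=
  (mkDerivation k (fun z : ι × Fin p => f z.1 z.2)).toLinearMap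

theorem lder_isDer (f : ι → ℕ → MvPolynomial (ι × Fin p) k) : IsDer (lder f) := by
  intro a b
  have := (mkDerivation k (fun z : ι × Fin p => f z.1 z.2)).leibniz a b
  simp only [smul_eq_mul] at this
  show mkDerivation k _ (a * b) = mkDerivation k _ a * b + a * mkDerivation k _ b
  rw [this]; ring

theorem lder_px (f : ι → ℕ → MvPolynomial (ι × Fin p) k) (hf : ∀ v i, p ≤ i → f v i = 0)
    (v : ι) (i : ℕ) : lder f (px v i) = f v i := by
  unfold px
  split_ifs with h
  · exact mkDerivation_X k _ _
  · rw [map_zero, hf v i (by omega)]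

theorem IsDer.ext' {A B : Module.End k (MvPolynomial (ι × Fin p) k)}
    (hA : IsDer A) (hB : IsDer B) (h : ∀ v i, i < p → A (px v i) = B (px v i)) : A = B :=
  hA.ext hB fun z => by rw [X_eq_px]; exact h _ _ z.2.2

variable (ι k p) in
noncomputable def lD : Module.End k (MvPolynomial (ι × Fin p) k) := lder fun v i => px v (i+1)

theorem lD_der : IsDer (lD ι k p) := lder_isDer _
theorem lD_px (v : ι) (i : ℕ) : lD ι k p (px v i) = px v (i+1) :=
  lder_px _ (fun v i h => px_ge _ _ (by omega)) v i

variable (k p) in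
noncomputable def lE (w : ι) : Module.End k (MvPolynomial (ι × Fin p) k) :=
  lder fun v i => if v = w then px v i else 0

theorem lE_der (w : ι) : IsDer (lE k p w) := lder_isDer _
theorem lE_px (w v : ι) (i : ℕ) : lE k p w (px v i) = if v = w then px v i else 0 :=
  lder_px _ (fun v i h => by simp [px_ge v i h]) v i

variable (k p) in
noncomputable def lH (w : ι) : Module.End k (MvPolynomial (ι × Fin p) k) :=
  lder fun v i => if v = w ∧ i ≤ p then - (i : MvPolynomial (ι × Fin p) k) * px v (i-1) else 0

theorem lH_der (w : ι) : IsDer (lH k p w) := lder_isDer _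

theorem p_poly : ((p : ℕ) : MvPolynomial (ι × Fin p) k) = 0 := by
  have : ((p:ℕ) : MvPolynomial (ι × Fin p) k) = C ((p : ℕ) : k) := by simp
  rw [this, CharP.cast_eq_zero, C_0]

theorem lH_px (w v : ι) (i : ℕ) : lH k p w (px v i) =
    if v = w ∧ i ≤ p then - (i : MvPolynomial (ι × Fin p) k) * px v (i-1) else 0 :=
  lder_px _ (fun v i h => by
    split_ifs with hh
    · have : i = p := le_antisymm hh.2 h
      subst this
      rw [p_poly]; simp
    · rfl) v i

theorem lDH (w : ι) : lD ι k p * lH k p w - lH k p w * lD ι k p = lE k p w := by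
  refine (lD_der.comm (lH_der w)).ext' (lE_der w) fun v i hi => ?_
  rw [LinearMap.sub_apply, Module.End.mul_apply, Module.End.mul_apply, lD_px, lH_px, lH_px, lE_px]
  by_cases h : v = w
  · subst h
    rw [if_pos ⟨rfl, hi.le⟩, if_pos ⟨rfl, hi⟩, if_pos rfl]
    have e : lD ι k p (-(i : MvPolynomial (ι × Fin p) k) * px v (i-1)) =
        -(i : MvPolynomial (ι × Fin p) k) * px v i := by
      rcases i with _ | i
      · simp
      · have : (-((i+1 : ℕ) : MvPolynomial (ι × Fin p) k) * px v (i+1-1)) =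
          (-((i+1:ℕ):k)) • (px v (i+1-1) : MvPolynomial (ι × Fin p) k) := by
          rw [smul_eq_C_mul]; simp
        rw [this, map_smul, lD_px, smul_eq_C_mul]; simp
    rw [e]
    simp
    ring
  · simp [h]

theorem lDE (w : ι) : lD ι k p * lE k p w = lE k p w * lD ι k p := by
  rw [← sub_eq_zero]
  refine (lD_der.comm (lE_der w)).ext' IsDer.zero fun v i hi => ?_
  rw [LinearMap.sub_apply, Module.End.mul_apply, Module.End.mul_apply, lD_px, lE_px, lE_px]
  by_cases h : v = w
  · simp [h, lD_px]
  · simp [h]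

theorem lHE (w : ι) : lH k p w * lE k p w = lE k p w * lH k p w := by
  rw [← sub_eq_zero]
  refine ((lH_der w).comm (lE_der w)).ext' IsDer.zero fun v i hi => ?_
  rw [LinearMap.sub_apply, Module.End.mul_apply, Module.End.mul_apply, lH_px, lE_px]
  by_cases h : v = w
  · subst h
    rw [if_pos rfl, if_pos ⟨rfl, hi.le⟩, lH_px, if_pos ⟨rfl, hi.le⟩]
    have : (-(i : MvPolynomial (ι × Fin p) k) * px v (i-1)) =
          (-(i:k)) • (px v (i-1) : MvPolynomial (ι × Fin p) k) := by
          rw [smul_eq_C_mul]; simp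
    rw [this, map_smul, lE_px, if_pos rfl, sub_self]; rfl
  · simp [h]

theorem lD_pow_px (n : ℕ) (v : ι) (i : ℕ) : (lD ι k p ^ n) (px v i) = px v (i+n) := by
  induction n with
  | zero => rfl
  | succ n ih => rw [pow_succ', Module.End.mul_apply, ih, lD_px]; rfl

theorem lD_p : lD ι k p ^ p = 0 := by
  refine (lD_der.pow p).ext' IsDer.zero fun v i hi => ?_
  rw [lD_pow_px, px_ge _ _ (by omega)]; rfl

theorem lE_p (w : ι) : lE k p w ^ p = lE k p w := by
  refine ((lE_der w).pow p).ext' (lE_der w) fun v i hi => ?_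
  have : ∀ n, (lE k p w ^ (n+1)) (px v i) = lE k p w (px v i) := by
    intro n
    induction n with
    | zero => rw [zero_add, pow_one]
    | succ n ih => 
      rw [pow_succ', Module.End.mul_apply, ih, lE_px]
      split_ifs with h
      · rw [lE_px, if_pos h]
      · exact map_zero _
  have hp := (Fact.out : p.Prime).pos
  obtain ⟨q, rfl⟩ : ∃ q, p = q+1 := ⟨p-1, by omega⟩
  exact this q

/-- Weyl-type identity -/
theorem weyl (w : ι) (n : ℕ) : ∀ f, lD ι k p f = 0 →
    (lD ι k p ^ n) ((lH k p w ^ n) f) = (n.factorial : k) • (lE k p w ^ n) f := by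
  have key : ∀ n, lD ι k p * lH k p w ^ (n+1) = lH k p w ^ (n+1) * lD ι k p +
      (n+1) • (lH k p w ^ n * lE k p w) := by
    intro n
    have e1 : lD ι k p * lH k p w = lH k p w * lD ι k p + lE k p w := by
      rw [← lDH w]; abel
    induction n with
    | zero => rw [zero_add, pow_one, pow_zero, one_mul, e1, one_smul]
    | succ n ih =>
      rw [pow_succ (lH k p w) (n+1), ← mul_assoc, ih, add_mul, mul_assoc (lH k p w ^ (n+1)) (lD ι k p), e1,
        mul_add, smul_mul_assoc, mul_assoc (lH k p w ^ n), ← lHE, ← mul_assoc (lH k p w ^ n),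
        ← pow_succ, succ_nsmul _ (n+1)]
      simp only [mul_assoc]; abel
  induction n with
  | zero => intro f hf; simp
  | succ n ih =>
    intro f hf
    have hEf : lD ι k p (lE k p w f) = 0 := by
      have := congrArg (fun A => A f) (lDE (k := k) (p := p) w)
      simpa [hf] using this
    rw [pow_succ (lD ι k p), Module.End.mul_apply, ← Module.End.mul_apply (lD ι k p), key n,
      LinearMap.add_apply, Module.End.mul_apply, hf, map_zero, zero_add, LinearMap.smul_apply,
      map_nsmul, Module.End.mul_apply, ih _ hEf, pow_succ (lE k p w), Module.End.mul_apply,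
      Nat.factorial_succ, ← Nat.cast_smul_eq_nsmul k, smul_smul]
    push_cast; rfl

/-- killing variables -/
noncomputable def kl (s : ι → ℕ → Prop) :
    MvPolynomial (ι × Fin p) k →ₐ[k] MvPolynomial (ι × Fin p) k :=
  open Classical in aeval fun z => if s z.1 z.2 then 0 else X z

theorem kl_px (s : ι → ℕ → Prop) (v i) [Decidable (s v i)] :
    kl (k := k) (p := p) s (px v i) = if s v i then 0 else px v i := by
  unfold px
  split_ifs with h1 h2 h2
  · simp [kl, h2]
  · simp [kl, h2]
  · simp
  · simp

theorem poly_ind {P : MvPolynomial (ι × Fin p) k → Prop} (f) (hC : ∀ a, P (C a))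
    (ha : ∀ f g, P f → P g → P (f + g)) (hm : ∀ f v i, i < p → P f → P (f * px v i)) : P f := by
  induction f using MvPolynomial.induction_on with
  | C a => exact hC a
  | add f g hf hg => exact ha f g hf hg
  | mul_X f i hf => rw [X_eq_px]; exact hm f _ _ i.2.2 hf

theorem IsDer.C {A : Module.End k (MvPolynomial (ι × Fin p) k)} (hA : IsDer A) (a : k) :
    A (MvPolynomial.C a) = 0 := by
  have e : (MvPolynomial.C a : MvPolynomial (ι × Fin p) k) = a • (1 : MvPolynomial (ι × Fin p) k) := by
      rw [smul_eq_C_mul, mul_one]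
  rw [e, map_smul, hA.one, smul_zero]

theorem kl_C (s : ι → ℕ → Prop) (a : k) : kl (k := k) (p := p) s (C a) = C a :=
  (kl s).commutes a

theorem kl_kl (s t : ι → ℕ → Prop) (f) :
    kl (k := k) (p := p) s (kl t f) = kl (fun v i => s v i ∨ t v i) f := by
  classical
  induction f using poly_ind with
  | hC a => simp only [kl_C]
  | ha f g hf hg => simp only [map_add, hf, hg]
  | hm f v i hi hf =>
    rw [map_mul, map_mul, map_mul, hf, kl_px, kl_px]
    by_cases h : t v i
    · simp [h]
    · rw [if_neg h, kl_px]; simp [h]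

theorem kl_E (s : ι → ℕ → Prop) (w : ι) (f) : kl s (lE k p w f) = lE k p w (kl s f) := by
  classical
  induction f using poly_ind with
  | hC a => simp only [kl_C, (lE_der w).C, map_zero]
  | ha f g hf hg => simp only [map_add, hf, hg]
  | hm f v i hi hf =>
    rw [lE_der w, map_add, map_mul, map_mul, hf, map_mul, lE_der w, kl_px, lE_px]
    congr 2
    by_cases h : v = w
    · rw [if_pos h, kl_px]
      split_ifs
      · simp
      · rw [lE_px, if_pos h]
    · rw [if_neg h, map_zero]
      split_ifs
      · simp
      · rw [lE_px, if_neg h]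

theorem kl_E_pow (s : ι → ℕ → Prop) (w : ι) (n) (f) :
    kl s ((lE k p w ^ n) f) = (lE k p w ^ n) (kl s f) := by
  induction n generalizing f with
  | zero => rfl
  | succ n ih => rw [pow_succ, Module.End.mul_apply, ih, kl_E]; rfl

/-- `D` preserves up-closed kill ideals -/
theorem kl_D (s : ι → ℕ → Prop) (hs : ∀ v i, s v i → s v (i+1)) (f) :
    kl s (lD ι k p (kl s f)) = kl s (lD ι k p f) := by
  classical
  have hi : ∀ f, kl (k := k) (p := p) s (kl s f) = kl s f := fun f => by
    rw [kl_kl]; simp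
  induction f using poly_ind with
  | hC a => simp only [kl_C]
  | ha f g hf hg => simp only [map_add, hf, hg]
  | hm f v i hi' hf =>
    rw [map_mul, lD_der, map_add, map_mul, map_mul, hf, hi, hi, lD_der, map_add, map_mul, map_mul]
    congr 2
    rw [kl_px, lD_px, kl_px]
    split_ifs with h1 h2 h2
    · simp
    · exact absurd (hs v i h1) h2
    · rw [lD_px, kl_px, if_pos h2]
    · rw [lD_px, kl_px, if_neg h2]

theorem kl_D0 (s : ι → ℕ → Prop) (hs : ∀ v i, s v i → s v (i+1)) (f) (hf : kl s f = 0) :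
    kl s (lD ι k p f) = 0 := by
  rw [← kl_D s hs, hf, map_zero, map_zero]

theorem kl_Dn0 (s : ι → ℕ → Prop) (hs : ∀ v i, s v i → s v (i+1)) (n f) (hf : kl s f = 0) :
    kl s ((lD ι k p ^ n) f) = 0 := by
  induction n with
  | zero => exact hf
  | succ n ih => rw [pow_succ', Module.End.mul_apply]; exact kl_D0 s hs _ ih

end Poly
end Stmt7

open CategoryTheory Finset
set_option synthInstance.maxHeartbeats 1000000
set_option maxHeartbeats 4000000
set_option linter.all false
namespace Stmt7
open CategoryTheory Abelian

section Poly2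
open MvPolynomial
variable {ι k : Type} [DecidableEq ι] [Field k] {p : ℕ} [Fact p.Prime] [CharP k p]

/-- the kill set of letter `v`, height at least `l` -/
def ks (v : ι) (l : ℕ) : ι → ℕ → Prop := fun w i => w = v ∧ l ≤ i

theorem ks_up (v : ι) (l : ℕ) : ∀ w i, ks v l w i → ks v l w (i+1) :=
  fun w i h => ⟨h.1, by have := h.2; omega⟩

theorem kl_ks_px (v : ι) (l i : ℕ) (h : i < l) :
    kl (k := k) (p := p) (ks v l) (px v i) = px v i := by
  classical
  rw [kl_px, if_neg]
  intro h'; have := h'.2; omega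

theorem kl_ks_px0 (v : ι) (l i : ℕ) (h : l ≤ i) :
    kl (k := k) (p := p) (ks v l) (px v i) = 0 := by
  classical
  rw [kl_px, if_pos ⟨rfl, h⟩]

theorem kl_ks_p (v : ι) (f) : kl (k := k) (p := p) (ks v p) f = f := by
  classical
  induction f using poly_ind with
  | hC a => simp only [kl_C]
  | ha f g hf hg => simp only [map_add, hf, hg]
  | hm f w i hi hf =>
    rw [map_mul, hf, kl_px, if_neg]
    intro h'; have := h'.2; omega

theorem px_ne (v : ι) (l : ℕ) (h : l < p) : (px v l : MvPolynomial (ι × Fin p) k) ≠ 0 := by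
  rw [px, dif_pos h]; exact X_ne_zero _

/-- `x_l a ∈ I_{l+1}` implies `a ∈ I_{l+1}` -/
theorem kl_cancel (v : ι) (l : ℕ) (h : l < p) (a)
    (ha : kl (k := k) (p := p) (ks v (l+1)) (px v l * a) = 0) :
    kl (k := k) (p := p) (ks v (l+1)) a = 0 := by
  rw [map_mul, kl_ks_px _ _ _ (Nat.lt_succ_self l)] at ha
  exact (mul_eq_zero.1 ha).resolve_left (px_ne v l h)

theorem kl_split (v : ι) (l : ℕ) (f) :
    ∃ a, kl (k := k) (p := p) (ks v (l+1)) f = kl (ks v l) f + px v l * a := by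
  classical
  induction f using poly_ind with
  | hC a => exact ⟨0, by simp [kl_C]⟩
  | ha f g hf hg =>
    obtain ⟨a, ha⟩ := hf
    obtain ⟨b, hb⟩ := hg
    exact ⟨a + b, by rw [map_add, map_add, ha, hb]; ring⟩
  | hm f w i hi hf =>
    obtain ⟨a, ha⟩ := hf
    rw [map_mul, map_mul, ha]
    by_cases h : w = v
    · subst h
      rcases lt_trichotomy i l with h | h | h
      · rw [kl_ks_px _ _ _ h, kl_ks_px _ _ _ (by omega)]
        exact ⟨a * px w i, by ring⟩
      · subst h
        rw [kl_ks_px _ _ _ (Nat.lt_succ_self i), kl_ks_px0 _ _ _ le_rfl]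
        exact ⟨kl (ks w i) f + px w i * a, by ring⟩
      · rw [kl_ks_px0 _ _ _ h.le, kl_ks_px0 _ _ _ h]
        exact ⟨0, by ring⟩
    · rw [kl_px, kl_px, if_neg (fun h' => h h'.1), if_neg (fun h' => h h'.1)]
      exact ⟨a * px w i, by ring⟩

theorem lE_mul_px (v : ι) (l : ℕ) (g) :
    lE k p v (px v l * g) = px v l * g + px v l * lE k p v g := by
  rw [lE_der v, lE_px, if_pos rfl]

/-- `f ∈ I_l` with weight `c` splits off `x_l a` with `a` of weight `c-1` -/
theorem split_eig (v : ι) (l : ℕ) (hl : l < p) (c : k) (hc : c ^ p = c) (f)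
    (hf : kl (k := k) (p := p) (ks v l) f = 0) (hE : lE k p v f = c • f) :
    ∃ a, lE k p v a = (c - 1) • a ∧
      kl (k := k) (p := p) (ks v (l+1)) (f - px v l * a) = 0 := by
  obtain ⟨a, ha⟩ := kl_split v l f
  rw [hf, zero_add] at ha
  have hp := (Fact.out : p.Prime).pos
  set E := lE k p v
  set T : Module.End k (MvPolynomial (ι × Fin p) k) := E - (c-1) • 1 with hT
  have hTp : T ^ p = T := by
    haveI : CharP (Module.End k (MvPolynomial (ι × Fin p) k)) p :=
      charP_of_injective_algebraMap (algebraMap k _).injective p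
    rw [hT, sub_pow_char_of_commute p, lE_p, smul_pow, one_pow, sub_pow_char, hc, one_pow]
    exact (Commute.one_right E).smul_right _
  -- T (x_l-multiple) relation
  have hTx : ∀ g, E (px v l * g) - c • (px v l * g) = px v l * T g := by
    intro g
    rw [lE_mul_px, hT]
    simp only [LinearMap.sub_apply, LinearMap.smul_apply, Module.End.one_apply, sub_smul, one_smul,
      smul_eq_C_mul]
    ring
  have hTa : kl (ks v (l+1)) (T a) = 0 := by
    apply kl_cancel v l hl
    have hff : kl (ks v (l+1)) (f - px v l * a) = 0 := by
      rw [map_sub, ha, map_mul, kl_ks_px _ _ _ (Nat.lt_succ_self l)]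
      have := congrArg (kl (ks v (l+1))) ha
      rw [kl_kl, map_mul, kl_ks_px _ _ _ (Nat.lt_succ_self l)] at this
      simp only [or_self] at this
      rw [← this, ← ha, sub_self]
    have h2 : kl (ks v (l+1)) (E (f - px v l * a)) = 0 := by rw [kl_E, hff, map_zero]
    have h3 : px v l * T a = c • (f - px v l * a) - E (f - px v l * a) := by
      rw [← hTx, map_sub, hE, smul_sub]; abel
    rw [h3, map_sub, h2, map_smul, hff]; simp
  refine ⟨a - (T ^ (p-1)) a, ?_, ?_⟩
  · have h0 : T (a - (T^(p-1)) a) = 0 := by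
      rw [map_sub, ← Module.End.mul_apply, ← pow_succ', Nat.sub_add_cancel hp, hTp, sub_self]
    rw [hT, LinearMap.sub_apply, sub_eq_zero] at h0
    exact h0
  · have hTn : ∀ n, kl (ks v (l+1)) ((T ^ (n+1)) a) = 0 := by
      intro n
      induction n with
      | zero => rw [zero_add, pow_one]; exact hTa
      | succ n ih =>
        rw [pow_succ', Module.End.mul_apply, hT, LinearMap.sub_apply, map_sub, kl_E, ← hT, ih,
          LinearMap.smul_apply, map_smul, Module.End.one_apply, ih]; simp
    have h1 : kl (ks v (l+1)) ((T^(p-1)) a) = 0 := by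
      have : 2 ≤ p := (Fact.out : p.Prime).two_le
      have := hTn (p-2)
      rwa [show p-2+1 = p-1 by omega] at this
    have hff : kl (ks v (l+1)) (f - px v l * a) = 0 := by
      rw [map_sub, ha, map_mul, kl_ks_px _ _ _ (Nat.lt_succ_self l)]
      have := congrArg (kl (ks v (l+1))) ha
      rw [kl_kl, map_mul, kl_ks_px _ _ _ (Nat.lt_succ_self l)] at this
      simp only [or_self] at this
      rw [← this, ← ha, sub_self]
    rw [mul_sub, ← sub_add, map_add, hff, map_mul, h1, mul_zero, add_zero]

theorem lD_pow_mul (v : ι) (l n : ℕ) (g) : kl (k := k) (p := p) (ks v (l+1))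
    ((lD ι k p ^ n) (px v l * g)) = px v l * kl (ks v (l+1)) ((lD ι k p ^ n) g) := by
  have key : kl (k := k) (p := p) (ks v (l+1))
    ((lD ι k p ^ n) (px v l * g) - px v l * ((lD ι k p ^ n) g)) = 0 := by
    induction n with
    | zero => simp
    | succ n ih =>
      have h := kl_D0 _ (ks_up v (l+1)) _ ih
      rw [map_sub, lD_der, lD_px] at h
      rw [pow_succ', Module.End.mul_apply, Module.End.mul_apply]
      rw [← sub_sub, sub_right_comm, map_sub, map_mul _ (px v (l+1)), kl_ks_px0 _ _ _ le_rfl, zero_mul,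
        sub_zero] at h
      exact h
  rw [map_sub, sub_eq_zero, map_mul (kl _), kl_ks_px _ _ _ (Nat.lt_succ_self l)] at key
  exact key

theorem E_D_pow (v : ι) (n : ℕ) (f) :
    lE k p v ((lD ι k p ^ n) f) = (lD ι k p ^ n) (lE k p v f) := by
  have h : Commute (lD ι k p) (lE k p v) := lDE v
  have := (h.pow_left n).eq
  exact (congrArg (fun A => A f) this).symm

theorem E_D (v : ι) (f) : lE k p v (lD ι k p f) = lD ι k p (lE k p v f) := by
  have := E_D_pow v 1 f
  rwa [pow_one] at this

/-- freeness modulo `I_l` in weight `c` -/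
def FreeL (v : ι) (k : Type) [Field k] (p : ℕ) (l : ℕ) (c : k) : Prop :=
  ∀ f : MvPolynomial (ι × Fin p) k, lE k p v f = c • f → kl (ks v l) (lD ι k p f) = 0 →
    ∃ g, lE k p v g = c • g ∧ kl (ks v l) (f - (lD ι k p ^ (p-1)) g) = 0

theorem FreeL.pow {v : ι} {l : ℕ} {c : k} (h : FreeL v k p l c) (i : ℕ) (hi : i + 1 < p) :
    ∀ f : MvPolynomial (ι × Fin p) k, lE k p v f = c • f → kl (ks v l) ((lD ι k p ^ (i+1)) f) = 0 →
    ∃ g, lE k p v g = c • g ∧ kl (ks v l) (f - (lD ι k p ^ (p-(i+1))) g) = 0 := by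
  induction i with
  | zero => intro f h1 h2; rw [zero_add, pow_one] at h2; exact h f h1 h2
  | succ i ih =>
    intro f h1 h2
    rw [pow_succ, Module.End.mul_apply] at h2
    obtain ⟨g, hg1, hg2⟩ := ih (by omega) (lD ι k p f) (by rw [E_D, h1, map_smul]) h2
    have e : p - (i+1) = (p - (i+1+1)) + 1 := by omega
    rw [e, pow_succ', Module.End.mul_apply, ← map_sub] at hg2
    obtain ⟨g', hg1', hg2'⟩ := h (f - (lD ι k p ^ (p - (i+1+1))) g)
      (by rw [map_sub, E_D_pow, h1, hg1, map_smul, smul_sub]) hg2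
    refine ⟨g + (lD ι k p ^ (i+1)) g', by rw [map_add, E_D_pow, hg1, hg1', map_smul, smul_add], ?_⟩
    rw [map_add, ← sub_sub, ← Module.End.mul_apply _ _ g', ← pow_add,
      show p - (i+1+1) + (i+1) = p - 1 by omega]
    exact hg2'

theorem im_weyl (v : ι) (f) (hD : lD ι k p f = 0) :
    ((p-1).factorial : k)⁻¹ • (lD ι k p ^ (p-1)) ((lH k p v ^ (p-1)) f) = (lE k p v ^ (p-1)) f := by
  rw [weyl v _ f hD, smul_smul, inv_mul_cancel₀, one_smul]
  intro h0
  rw [CharP.cast_eq_zero_iff k p, (Fact.out : p.Prime).dvd_factorial] at h0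
  have := (Fact.out : p.Prime).pos
  omega

theorem nat_pow_p (j : ℕ) : (-(j:k)) ^ p = -(j : k) := by
  haveI := ‹CharP k p›
  have h1 : ((j:k)) ^ p = j := by
    have := congrArg (ZMod.castHom dvd_rfl k) (ZMod.pow_card (j : ZMod p))
    rwa [map_pow, map_natCast] at this
  have h2 : (frobenius k p) (-(j:k)) = -(frobenius k p (j:k)) := map_neg _ _
  simp only [frobenius_def] at h2
  rw [h2, h1]

theorem freeL (v : ι) : ∀ (u l : ℕ), l + u = p → ∀ j : ℕ, 1 ≤ j → j + 1 ≤ l →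
    FreeL v k p l (-(j:k)) := by
  intro u
  induction u with
  | zero =>
    intro l hl j hj hjl f hE hD
    obtain rfl : l = p := by omega
    rw [kl_ks_p] at hD
    have hj0 : (j:k) ≠ 0 := by
      rw [Ne, CharP.cast_eq_zero_iff k l]
      intro h; have := Nat.le_of_dvd (by omega) h; omega
    have hEn : ∀ n, (lE k l v ^ n) f = (-(j:k))^n • f := by
      intro n
      induction n with
      | zero => simp
      | succ n ih => rw [pow_succ', Module.End.mul_apply, ih, map_smul, hE, smul_smul, pow_succ]
    have h1 : (-(j:k))^(l-1) = 1 := by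
      have := nat_pow_p (k := k) (p := l) j
      have e9 : (-(j:k))^l = (-(j:k))^(l-1) * (-(j:k)) := by
        rw [← pow_succ, Nat.sub_add_cancel (Fact.out : l.Prime).pos]
      rw [e9] at this
      exact mul_right_cancel₀ (neg_ne_zero.2 hj0) (by rw [this, one_mul])
    refine ⟨((l-1).factorial : k)⁻¹ • (lH k l v ^ (l-1)) f, ?_, ?_⟩
    · have h : Commute (lH k l v) (lE k l v) := lHE v
      have := congrArg (fun A => A f) (h.pow_left (l-1)).eq
      simp only [Module.End.mul_apply] at this
      rw [map_smul, ← this, hE, map_smul, smul_comm]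
    · rw [map_smul, im_weyl v f hD, hEn, h1, one_smul, sub_self, map_zero]
  | succ u ih =>
    intro l hl j hj hjl f hE hD
    have hc : (-(j:k)) ^ p = -(j:k) := nat_pow_p j
    obtain ⟨a, ha1, ha2⟩ := split_eig v l (by omega) _ hc _ hD (by rw [E_D, hE, map_smul])
    have ec : (-(j:k) - 1) = -((j+1 : ℕ) : k) := by push_cast; ring
    rw [ec] at ha1
    -- D^{p-1} a ∈ I_{l+1}
    have h1 : kl (ks v (l+1)) ((lD ι k p ^ (p-1)) a) = 0 := by
      apply kl_cancel v l (by omega)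
      have h := kl_Dn0 _ (ks_up v (l+1)) (p-1) _ ha2
      rw [map_sub, ← Module.End.mul_apply _ _ f, ← pow_succ, Nat.sub_add_cancel (Fact.out : p.Prime).pos,
        lD_p, LinearMap.zero_apply, zero_sub, map_neg, neg_eq_zero, lD_pow_mul] at h
      rw [map_mul, kl_ks_px _ _ _ (Nat.lt_succ_self l)]; exact h
    have h2 := (Fact.out : p.Prime).two_le
    obtain ⟨b, hb1, hb2⟩ := (ih (l+1) (by omega) (j+1) (by omega) (by omega)).pow (p-2) (by omega) a ha1
      (by rw [show p-2+1 = p-1 by omega]; exact h1)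
    rw [show p - (p-2+1) = 1 by omega, pow_one] at hb2
    obtain ⟨g, hg1, hg2⟩ := ih (l+1) (by omega) j hj (by omega) (f - px v l * b)
      (by rw [map_sub, lE_mul_px, hE, hb1, ← ec, smul_sub, sub_smul]
          simp only [smul_eq_C_mul, map_sub, map_neg, map_one]; ring)
      (by
        have e : lD ι k p (f - px v l * b) = (lD ι k p f - px v l * a) + px v l * (a - lD ι k p b)
            - px v (l+1) * b := by
          rw [map_sub, lD_der, lD_px]; ring
        rw [e, map_sub, map_add, ha2, map_mul, hb2, map_mul, kl_ks_px0 _ _ _ le_rfl]; ring)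
    refine ⟨g, hg1, ?_⟩
    have hsub : ∀ y, kl (k := k) (p := p) (ks v (l+1)) y = 0 → kl (k := k) (p := p) (ks v l) y = 0 := by
      intro y hy
      have := congrArg (kl (ks v l)) hy
      rw [kl_kl, map_zero] at this
      rw [← this]; congr 2
      funext w i
      simp only [ks, eq_iff_iff]; constructor
      · intro h; exact Or.inl h
      · rintro (h | h); exact h; exact ⟨h.1, by omega⟩
    have := hsub _ hg2
    rw [sub_right_comm, map_sub, map_mul, kl_ks_px0 _ _ _ le_rfl, zero_mul, sub_zero] at this
    exact this

/-- weight zero, one letter -/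
theorem star (v : ι) : ∀ (u l : ℕ), 1 ≤ l → l + u = p → ∀ f, kl (k := k) (p := p) (ks v l) f = 0 →
    lD ι k p f = 0 → lE k p v f = 0 → ∃ g, f = (lD ι k p ^ (p-1)) g := by
  intro u
  induction u with
  | zero =>
    intro l hl1 hl f hf hD hE
    obtain rfl : l = p := by omega
    rw [kl_ks_p] at hf
    exact ⟨0, by rw [hf, map_zero]⟩
  | succ u ih =>
    intro l hl1 hl f hf hD hE
    have hpp := (Fact.out : p.Prime).pos
    obtain ⟨a, ha1, ha2⟩ := split_eig v l (by omega) (0:k) (zero_pow hpp.ne') f hf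
      (by rw [hE, zero_smul])
    have ec : ((0:k) - 1) = -((1:ℕ):k) := by push_cast; ring
    rw [ec] at ha1
    have h1 : kl (ks v (l+1)) (lD ι k p a) = 0 := by
      apply kl_cancel v l (by omega)
      have h := kl_D0 _ (ks_up v (l+1)) _ ha2
      have := lD_pow_mul (k := k) (p := p) v l 1 a
      rw [pow_one] at this
      rw [map_sub, hD, zero_sub, map_neg, neg_eq_zero, this] at h
      rw [map_mul, kl_ks_px _ _ _ (Nat.lt_succ_self l)]; exact h
    obtain ⟨g, hg1, hg2⟩ := freeL v u (l+1) (by omega) 1 le_rfl (by omega) a ha1 h1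
    obtain ⟨g', hg'⟩ := ih (l+1) (by omega) (by omega) (f - (lD ι k p ^ (p-1)) (px v l * g))
      (by
        rw [map_sub, lD_pow_mul]
        rw [map_sub, map_mul, kl_ks_px _ _ _ (Nat.lt_succ_self l), sub_eq_zero] at ha2
        rw [map_sub, sub_eq_zero] at hg2
        rw [ha2, hg2, sub_self])
      (by rw [map_sub, hD, ← Module.End.mul_apply, ← pow_succ', Nat.sub_add_cancel hpp, lD_p]; simp)
      (by rw [map_sub, hE, E_D_pow, lE_mul_px, hg1]; simp)
    exact ⟨g' + px v l * g, by rw [map_add, ← hg']; abel⟩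

/-- killing positive height for letters in `S` -/
def kS (S : Finset ι) : ι → ℕ → Prop := fun w i => w ∈ S ∧ 1 ≤ i

theorem theta_id (v : ι) (f) : px v 0 * lD ι k p (kl (ks v 1) f) =
    px v 1 * kl (ks v 1) (lE k p v f) + px v 0 * kl (ks v 1) (lD ι k p f) := by
  classical
  induction f using poly_ind with
  | hC a => simp only [kl_C, lD_der.C, (lE_der v).C, map_zero]; ring
  | ha f g hf hg => simp only [map_add, mul_add, hf, hg]; ring
  | hm f w i hi hf =>
    rw [map_mul, lD_der, lD_der, lE_der v, map_add, map_add, map_mul, map_mul, map_mul, map_mul,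
      mul_add, ← mul_assoc, hf]
    have key : px v 0 * lD ι k p (kl (ks v 1) (px w i)) =
      px v 1 * kl (ks v 1) (lE k p v (px w i)) + px v 0 * kl (ks v 1) (lD ι k p (px w i)) := by
      rw [lD_px, lE_px]
      by_cases h : w = v
      · subst h
        rw [if_pos rfl]
        rcases Nat.eq_zero_or_pos i with h0 | h0
        · subst h0
          rw [kl_ks_px _ _ _ one_pos, kl_ks_px0 _ _ _ le_rfl, lD_px]; ring
        · rw [kl_ks_px0 _ _ _ h0, kl_ks_px0 _ _ (i+1) (by omega), map_zero]; ring
      · rw [if_neg h, kl_px, kl_px, if_neg (fun h' => h h'.1), if_neg (fun h' => h h'.1), lD_px,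
          map_zero]; ring
    linear_combination (kl (ks v 1) f) * key

theorem T0 (S : Finset ι) : ∀ f, kl (k := k) (p := p) (kS S) f = 0 → lD ι k p f = 0 →
    ∃ g, f = (lD ι k p ^ (p-1)) g := by
  have hpp := (Fact.out : p.Prime).pos
  have hp2 := (Fact.out : p.Prime).two_le
  induction S using Finset.induction_on with
  | empty =>
    intro f hf hD
    refine ⟨0, ?_⟩
    rw [map_zero, ← hf]
    symm
    classical
    clear hf hD
    induction f using poly_ind with
    | hC a => simp only [kl_C]
    | ha f g hf hg => simp only [map_add, hf, hg]
    | hm f w i hi hf =>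
      rw [map_mul, hf, kl_px, if_neg]
      intro h'; simp [kS] at h'
  | insert v S hv ih =>
    intro f hf hD
    have hf' : kl (kS S) (kl (ks v 1) f) = 0 := by
      rw [kl_kl, ← hf]; congr 2; funext w i
      simp only [kS, ks, Finset.mem_insert, eq_iff_iff]; tauto
    set f1 := (lE k p v ^ (p-1)) f with hf1
    have hDf1 : lD ι k p f1 = 0 := by
      have h : Commute (lD ι k p) (lE k p v) := lDE v
      have := congrArg (fun A => A f) (h.pow_right (p-1)).eq
      simp only [Module.End.mul_apply] at this
      rw [hf1, this, hD, map_zero]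
    have hE0 : lE k p v (f - f1) = 0 := by
      rw [map_sub, hf1, ← Module.End.mul_apply, ← pow_succ', Nat.sub_add_cancel hpp, lE_p, sub_self]
    have hD0 : lD ι k p (f - f1) = 0 := by rw [map_sub, hD, hDf1, sub_zero]
    have hDt : lD ι k p (kl (ks v 1) (f - f1)) = 0 := by
      have := theta_id v (f - f1)
      rw [hE0, hD0, map_zero, mul_zero, mul_zero, add_zero] at this
      exact (mul_eq_zero.1 this).resolve_left (px_ne v 0 hpp)
    obtain ⟨g1, hg1⟩ := ih (kl (ks v 1) (f - f1))
      (by rw [map_sub, map_sub, hf', hf1, kl_E_pow, kl_E_pow, hf', map_zero, sub_zero]) hDt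
    obtain ⟨g2, hg2⟩ := star v (p-1) 1 le_rfl (by omega) ((f - f1) - kl (ks v 1) (f - f1))
      (by rw [map_sub, kl_kl]; simp only [or_self, sub_self])
      (by rw [map_sub, hD0, hDt, sub_zero]) (by rw [map_sub, ← kl_E, hE0, map_zero, sub_zero])
    have e3 := im_weyl v f hD
    refine ⟨g1 + g2 + ((p-1).factorial : k)⁻¹ • (lH k p v ^ (p-1)) f, ?_⟩
    rw [map_add, map_add, ← hg1, ← hg2, map_smul, e3]
    abel

/-- `ker D^i = im D^{p-i}` on the positive part -/
theorem T1 [Fintype ι] (i : ℕ) (hi : i + 1 < p) : ∀ f, kl (k := k) (p := p) (kS univ) f = 0 →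
    (lD ι k p ^ (i+1)) f = 0 → ∃ g, f = (lD ι k p ^ (p-(i+1))) g := by
  have hk : ∀ f, kl (k := k) (p := p) (kS univ) (lD ι k p f) = 0 := by
    classical
    intro f
    induction f using poly_ind with
    | hC a => simp only [kl_C, lD_der.C, map_zero]
    | ha f g hf hg => simp only [map_add, hf, hg, add_zero]
    | hm f w i hi hf =>
      rw [lD_der, map_add, map_mul, hf, lD_px, map_mul, kl_px (kS univ) w (i+1),
        if_pos (show kS univ w (i+1) from ⟨mem_univ _, Nat.le_add_left 1 i⟩)]; ring
  induction i with
  | zero => intro f h1 h2; rw [zero_add, pow_one] at h2; exact T0 _ f h1 h2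
  | succ i ih =>
    intro f h1 h2
    rw [pow_succ, Module.End.mul_apply] at h2
    obtain ⟨g, hg⟩ := ih (by omega) (lD ι k p f) (hk f) h2
    have e : p - (i+1) = (p - (i+1+1)) + 1 := by omega
    rw [e, pow_succ', Module.End.mul_apply, ← sub_eq_zero, ← map_sub] at hg
    obtain ⟨g', hg'⟩ := T0 _ (f - (lD ι k p ^ (p - (i+1+1))) g) (by
      obtain ⟨w, hw⟩ : ∃ w, p - (i+1+1) = w + 1 := ⟨p - (i+1+1) - 1, by omega⟩
      rw [hw, pow_succ', Module.End.mul_apply, map_sub, h1, hk, sub_zero]) hg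
    refine ⟨g + (lD ι k p ^ (i+1)) g', ?_⟩
    rw [map_add, ← Module.End.mul_apply _ _ g', ← pow_add, show p - (i+1+1) + (i+1) = p - 1 by omega,
      ← hg']; abel

end Poly2
end Stmt7

open CategoryTheory Finset
set_option synthInstance.maxHeartbeats 1000000
set_option maxHeartbeats 4000000
set_option linter.all false
namespace Stmt7
open CategoryTheory Abelian

section Bridge
open MvPolynomial
variable {ι k : Type} [DecidableEq ι] [Field k] {p : ℕ} [hpf : Fact p.Prime] [CharP k p]
variable {Q : Type} [Fintype Q] [DecidableEq Q]

/-- lowering operator on families indexed by words -/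
def rhoF {T : Type} [AddCommGroup T] (F : (Q → Fin p) → T) : (Q → Fin p) → T :=
  fun ε => ∑ x, if h : (ε x).1 + 1 < p then F (Function.update ε x ⟨(ε x).1 + 1, h⟩) else 0

/-- bidegree weights -/
def bw : ι × Fin p → ℕ × ℕ := fun z => (1, z.2.1)

theorem lD_hom_mono (s : (ι × Fin p) →₀ ℕ) :
    IsWeightedHomogeneous bw (lD ι k p (monomial s 1)) (Finsupp.weight bw s + (0,1)) := by
  have hadd : ∀ s t : (ι × Fin p) →₀ ℕ,
      IsWeightedHomogeneous bw (lD ι k p (monomial s 1)) (Finsupp.weight bw s + (0,1)) →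
      IsWeightedHomogeneous bw (lD ι k p (monomial t 1)) (Finsupp.weight bw t + (0,1)) →
      IsWeightedHomogeneous bw (lD ι k p (monomial (s+t) 1)) (Finsupp.weight bw (s+t) + (0,1)) := by
    intro s t hs ht
    have e : (monomial (s+t) (1:k)) = monomial s 1 * monomial t 1 := by rw [monomial_mul, one_mul]
    rw [e, lD_der]
    refine IsWeightedHomogeneous.add ?_ ?_
    · have := hs.mul (isWeightedHomogeneous_monomial bw t (1:k) rfl)
      rw [map_add]; convert this using 1; abel
    · have := (isWeightedHomogeneous_monomial bw s (1:k) rfl).mul ht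
      rw [map_add]; convert this using 1; abel
  have hzero : IsWeightedHomogeneous bw (lD ι k p (monomial (0 : (ι × Fin p) →₀ ℕ) 1)) (Finsupp.weight bw (0 : (ι × Fin p) →₀ ℕ) + (0,1)) := by
    have : (monomial (0 : (ι × Fin p) →₀ ℕ) (1:k)) = C 1 := rfl
    rw [this, lD_der.C]; exact isWeightedHomogeneous_zero _ _ _
  have hX : ∀ z : ι × Fin p, IsWeightedHomogeneous bw (lD ι k p (monomial (Finsupp.single z 1) 1)) (Finsupp.weight bw (Finsupp.single z 1) + (0,1)) := by
    intro z
    have : (monomial (Finsupp.single z 1) (1:k)) = px z.1 z.2 := X_eq_px z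
    rw [this, lD_px]
    have e2 : Finsupp.weight bw (Finsupp.single z 1) + (0,1) = ((1, z.2.1 + 1) : ℕ × ℕ) := by
      rw [Finsupp.weight_single]; simp [bw]
    rw [e2, px]
    split_ifs with h
    · exact isWeightedHomogeneous_X k bw (z.1, ⟨z.2.1+1, h⟩)
    · exact isWeightedHomogeneous_zero _ _ _
  induction s using Finsupp.induction_linear with
  | zero => exact hzero
  | add s t hs ht => exact hadd s t hs ht
  | single z a =>
    induction a with
    | zero => rw [Finsupp.single_zero]; exact hzero
    | succ a ih => rw [Finsupp.single_add]; exact hadd _ _ ih (hX z)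

theorem lD_hom (f : MvPolynomial (ι × Fin p) k) (μ : ℕ × ℕ) (hf : IsWeightedHomogeneous bw f μ) :
    IsWeightedHomogeneous bw (lD ι k p f) (μ + (0,1)) := by
  rw [f.as_sum, map_sum]
  refine IsWeightedHomogeneous.sum _ _ _ fun s hs => ?_
  have hs' := hf (mem_support_iff.1 hs)
  have e : (monomial s (coeff s f)) = coeff s f • monomial s (1:k) := by
    rw [smul_monomial, smul_eq_mul, mul_one]
  rw [e, map_smul, smul_eq_C_mul, ← hs']
  exact (lD_hom_mono s).C_mul _

theorem lD_hom_pow (b : ℕ) (f : MvPolynomial (ι × Fin p) k) (μ : ℕ × ℕ) (hf : IsWeightedHomogeneous bw f μ) :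
    IsWeightedHomogeneous bw ((lD ι k p ^ b) f) (μ + (0,b)) := by
  induction b with
  | zero =>
    have e : μ + ((0,0):ℕ×ℕ) = μ := add_zero μ
    rw [e]; exact hf
  | succ b ih =>
    rw [pow_succ', Module.End.mul_apply]
    have := lD_hom _ _ ih
    rw [add_assoc] at this
    exact this

theorem comp_D (b : ℕ) (f : MvPolynomial (ι × Fin p) k) (μ : ℕ × ℕ) :
    (lD ι k p ^ b) (weightedHomogeneousComponent bw μ f) =
      weightedHomogeneousComponent bw (μ + (0,b)) ((lD ι k p ^ b) f) := by
  induction f using MvPolynomial.induction_on' with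
  | monomial s a =>
    have h := isWeightedHomogeneous_monomial (bw : ι × Fin p → ℕ × ℕ) s a rfl
    rw [weightedHomogeneousComponent_of_mem h, weightedHomogeneousComponent_of_mem (lD_hom_pow b _ _ h)]
    by_cases h1 : μ = Finsupp.weight bw s
    · simp [h1]
    · rw [if_neg h1, if_neg (fun h' => h1 (add_right_cancel h')), map_zero]
  | add f g hf hg =>
    rw [map_add, map_add, map_add, map_add, hf, hg]

theorem kl_pos [Fintype ι] (μ : ℕ × ℕ) (hμ : 0 < μ.2) (f : MvPolynomial (ι × Fin p) k) 
    (hf : IsWeightedHomogeneous bw f μ) : kl (k := k) (p := p) (kS univ) f = 0 := by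
  classical
  rw [f.as_sum, map_sum]
  refine Finset.sum_eq_zero fun s hs => ?_
  have hs' := hf (mem_support_iff.1 hs)
  obtain ⟨z, hz, hz'⟩ : ∃ z, s z ≠ 0 ∧ 1 ≤ z.2.1 := by
    by_contra hc
    push Not at hc
    have : (Finsupp.weight bw s).2 = 0 := by
      rw [Finsupp.weight_apply, Finsupp.sum, Prod.snd_sum]
      refine Finset.sum_eq_zero fun z hz => ?_
      have := hc z (Finsupp.mem_support_iff.1 hz)
      have h0 : z.2.1 = 0 := by omega
      simp [bw, h0]
    rw [hs'] at this; omega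
  rw [kl, aeval_monomial, Finsupp.prod, Finset.prod_eq_zero (Finsupp.mem_support_iff.2 hz), mul_zero]
  rw [if_pos, zero_pow hz]
  exact ⟨mem_univ _, hz'⟩

/-- monomial of a word -/
noncomputable def mon (k : Type) [Field k] (h : Q → ι × Fin p) : MvPolynomial (ι × Fin p) k := ∏ x, X (h x)

theorem mon_comp (h : Q → ι × Fin p) (σ : Equiv.Perm Q) : mon k (h ∘ σ) = mon k h :=
  Equiv.prod_comp σ (fun x => (X (h x) : MvPolynomial (ι × Fin p) k))

theorem mon_eq (h : Q → ι × Fin p) : mon k h = monomial (∑ x, Finsupp.single (h x) 1) 1 := by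
  rw [mon, monomial_sum_one]; rfl

theorem mon_wt (h : Q → ι × Fin p) : Finsupp.weight bw (∑ x, Finsupp.single (h x) 1) = 
    ((Fintype.card Q, ∑ x, (h x).2.1) : ℕ × ℕ) := by
  rw [map_sum]
  apply Prod.ext
  · rw [Prod.fst_sum]; simp [bw, Finsupp.weight_single]
  · rw [Prod.snd_sum]; simp [bw, Finsupp.weight_single]

theorem der_prod {R : Type} [CommRing R] [Algebra k R] {A : Module.End k R} (hA : IsDer A) (s : Finset Q) (u : Q → R) : 
    A (∏ x ∈ s, u x) = ∑ x ∈ s, (∏ y ∈ s.erase x, u y) * A (u x) := by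
  induction s using Finset.induction_on with
  | empty => simp [hA.one]
  | insert a s ha ih =>
    rw [prod_insert ha, hA, ih, sum_insert ha, erase_insert ha, mul_comm (A (u a)), Finset.mul_sum]
    congr 1
    refine Finset.sum_congr rfl fun x hx => ?_
    have hne : a ≠ x := fun h => ha (h ▸ hx)
    rw [erase_insert_of_ne hne, prod_insert (fun h => ha (mem_of_mem_erase h)), mul_assoc]

theorem D_mon (h : Q → ι × Fin p) : lD ι k p (mon k h) = 
    ∑ x, if hx : (h x).2.1 + 1 < p then mon k (Function.update h x ((h x).1, ⟨(h x).2.1 + 1, hx⟩)) else 0 := by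
  rw [mon, der_prod lD_der]
  refine Finset.sum_congr rfl fun x _ => ?_
  rw [X_eq_px, lD_px, px]
  split_ifs with hx
  · rw [mon, ← mul_prod_erase univ _ (mem_univ x), mul_comm, Function.update_self]
    congr 1
    refine Finset.prod_congr rfl fun y hy => ?_
    rw [Function.update_of_ne (ne_of_mem_erase hy)]
  · rw [mul_zero]

/-- family of a functional -/
noncomputable def fam (ψ : MvPolynomial (ι × Fin p) k →ₗ[k] k) : (Q → Fin p) → (Q → ι) → k := 
  fun ε g => ψ (mon k fun x => (g x, ε x))

theorem rho_fam (ψ : MvPolynomial (ι × Fin p) k →ₗ[k] k) : rhoF (fam (Q := Q) ψ) = fam (ψ ∘ₗ lD ι k p) := by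
  funext ε g
  simp only [rhoF, fam, LinearMap.comp_apply, D_mon, map_sum, Finset.sum_apply]
  refine Finset.sum_congr rfl fun x _ => ?_
  split_ifs with hx
  · simp only [fam]
    congr 2
    funext y
    by_cases h : y = x
    · subst h; simp
    · simp [Function.update_of_ne h]
  · simp

theorem rho_fam_pow (b : ℕ) (ψ : MvPolynomial (ι × Fin p) k →ₗ[k] k) : 
    rhoF^[b] (fam (Q := Q) ψ) = fam (ψ ∘ₗ (lD ι k p ^ b)) := by
  induction b generalizing ψ with
  | zero => rfl
  | succ b ih => rw [Function.iterate_succ, Function.comp, rho_fam, ih, pow_succ']; rfl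

/-- functional of a family -/
noncomputable def fnl (F : (Q → Fin p) → (Q → ι) → k) : MvPolynomial (ι × Fin p) k →ₗ[k] k :=
  open Classical in (basisMonomials (ι × Fin p) k).constr k fun s => if h : ∃ w : Q → ι × Fin p, s = ∑ x, Finsupp.single (w x) 1 then 
    F (fun x => (h.choose x).2) (fun x => (h.choose x).1) else 0

theorem fnl_mono (F : (Q → Fin p) → (Q → ι) → k) (s) (hs : ¬ ∃ w : Q → ι × Fin p, s = ∑ x, Finsupp.single (w x) 1) : 
    fnl F (monomial s 1) = 0 := by
  have := (basisMonomials (ι × Fin p) k).constr_basis k (fun s => open Classical in if h : ∃ w : Q → ι × Fin p, s = ∑ x, Finsupp.single (w x) 1 then 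
    F (fun x => (h.choose x).2) (fun x => (h.choose x).1) else 0) s
  rw [coe_basisMonomials] at this
  rw [fnl, this, dif_neg hs]

theorem fnl_mon (F : (Q → Fin p) → (Q → ι) → k) (hF : ∀ (σ : Equiv.Perm Q) ε g, F (ε ∘ σ) (g ∘ σ) = F ε g) (w : Q → ι × Fin p) : 
    fnl F (mon k w) = F (fun x => (w x).2) (fun x => (w x).1) := by
  have := (basisMonomials (ι × Fin p) k).constr_basis k (fun s => open Classical in if h : ∃ w : Q → ι × Fin p, s = ∑ x, Finsupp.single (w x) 1 then 
    F (fun x => (h.choose x).2) (fun x => (h.choose x).1) else 0) (∑ x, Finsupp.single (w x) 1)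
  rw [coe_basisMonomials] at this
  have hh : ∃ w' : Q → ι × Fin p, ∑ x, Finsupp.single (w x) 1 = ∑ x, Finsupp.single (w' x) 1 := ⟨w, rfl⟩
  rw [fnl, mon_eq, this, dif_pos hh]
  have hm : ∀ (w : Q → ι × Fin p) v, (∑ x, Finsupp.single (w x) 1) v = mul' w v := by
    intro w v
    rw [Finsupp.finsetSum_apply, mul', Finset.card_filter]
    refine Finset.sum_congr rfl fun x _ => ?_
    rw [Finsupp.single_apply]
  obtain ⟨σ, hσ⟩ := mul'_ex w hh.choose (fun v => by rw [← hm, ← hm, ← hh.choose_spec])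
  have := hF σ (fun x => (hh.choose x).2) (fun x => (hh.choose x).1)
  rw [← this]
  conv_rhs => rw [hσ]
  rfl

theorem fam_fnl (F : (Q → Fin p) → (Q → ι) → k) (hF : ∀ (σ : Equiv.Perm Q) ε g, F (ε ∘ σ) (g ∘ σ) = F ε g) : 
    fam (fnl F) = F := by
  funext ε g
  rw [fam, fnl_mon F hF]

theorem rho_p (F : (Q → Fin p) → (Q → ι) → k) (hF : ∀ (σ : Equiv.Perm Q) ε g, F (ε ∘ σ) (g ∘ σ) = F ε g) : 
    rhoF^[p] F = 0 := by
  conv_lhs => rw [← fam_fnl F hF]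
  rw [rho_fam_pow, lD_p]
  funext ε g
  simp [fam]

theorem word_ex {B : Type} [DecidableEq B] (s : B →₀ ℕ) (hc : Multiset.card (Finsupp.toMultiset s) = Fintype.card Q) : 
    ∃ w : Q → B, s = ∑ x, Finsupp.single (w x) 1 := by
  set M := Finsupp.toMultiset s with hM
  have e : Q ≃ M := Fintype.equivOfCardEq (by rw [Multiset.card_coe, hc])
  refine ⟨fun x => (e x).1, ?_⟩
  have h1 : Finsupp.toMultiset (∑ x, Finsupp.single ((e x).1) 1) = M := by
    rw [Finsupp.toMultiset_sum]
    simp only [Finsupp.toMultiset_single, one_smul]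
    rw [Equiv.sum_comp e (fun z : M => ({z.1} : Multiset B)), Finset.sum_eq_multiset_sum]
    conv_rhs => rw [← Multiset.map_univ_coe M]
    rw [← Multiset.sum_map_singleton (Multiset.map (fun x : M => x.1) univ.val), Multiset.map_map]
    rfl
  ext v
  rw [← Finsupp.count_toMultiset, ← Finsupp.count_toMultiset, h1]

theorem rho_exact [Fintype ι] (F : (Q → Fin p) → (Q → ι) → k) (hF : ∀ (σ : Equiv.Perm Q) ε g, F (ε ∘ σ) (g ∘ σ) = F ε g)
    (τ a b : ℕ) (hτ : 0 < τ) (hab : a + b = p) (ha : 0 < a) (hb : 0 < b) (hw : ∀ ε, ∑ x, (ε x).1 ≠ τ → F ε = 0) 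
    (h0 : rhoF^[a] F = 0) : ∃ F' : (Q → Fin p) → (Q → ι) → k, (∀ (σ : Equiv.Perm Q) ε g, F' (ε ∘ σ) (g ∘ σ) = F' ε g) ∧ 
      (∀ ε, ∑ x, (ε x).1 ≠ τ + b → F' ε = 0) ∧ rhoF^[b] F' = F := by
  classical
  set φ := fnl F with hφ
  have hFφ : fam φ = F := fam_fnl F hF
  set μ : ℕ × ℕ := (Fintype.card Q, τ) with hμ
  -- `φ` is supported in bidegree `μ`
  have hs1 : ∀ s : (ι × Fin p) →₀ ℕ, Finsupp.weight bw s ≠ μ → φ (monomial s 1) = 0 := by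
    intro s hs
    by_cases hw' : ∃ w : Q → ι × Fin p, s = ∑ x, Finsupp.single (w x) 1
    · obtain ⟨w, rfl⟩ := hw'
      rw [← mon_eq, hφ, fnl_mon F hF, hw]
      · rfl
      · intro h
        apply hs
        rw [mon_wt, hμ, h]
    · exact fnl_mono F s hw'
  have hs2 : ∀ f ν, IsWeightedHomogeneous bw f ν → ν ≠ μ → φ f = 0 := by
    intro f ν hf hν
    rw [f.as_sum, map_sum]
    refine Finset.sum_eq_zero fun s hs => ?_
    have hs' := hf (mem_support_iff.1 hs)
    have e : (monomial s (coeff s f)) = coeff s f • monomial s (1:k) := by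
      rw [smul_monomial, smul_eq_mul, mul_one]
    rw [e, map_smul, hs1 s (by rw [hs']; exact hν), smul_zero]
  have hmonos : ∀ (A B : MvPolynomial (ι × Fin p) k →ₗ[k] k), (∀ s, A (monomial s 1) = B (monomial s 1)) → A = B := by
    intro A B h
    refine (basisMonomials (ι × Fin p) k).ext fun s => ?_
    rw [coe_basisMonomials]; exact h s
  have hφπ : φ ∘ₗ weightedHomogeneousComponent bw μ = φ := by
    apply hmonos
    intro s
    have h := isWeightedHomogeneous_monomial (bw : ι × Fin p → ℕ × ℕ) s (1:k) rfl
    rw [LinearMap.comp_apply, weightedHomogeneousComponent_of_mem h]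
    split_ifs with h1
    · rfl
    · rw [map_zero, hs1 s (fun h' => h1 h'.symm)]
  have hφD : φ ∘ₗ (lD ι k p ^ a) = 0 := by
    apply hmonos
    intro s
    rw [LinearMap.zero_apply, LinearMap.comp_apply]
    by_cases hw' : ∃ w : Q → ι × Fin p, s = ∑ x, Finsupp.single (w x) 1
    · obtain ⟨w, rfl⟩ := hw'
      rw [← hFφ, rho_fam_pow] at h0
      have := congrFun (congrFun h0 (fun x => (w x).2)) (fun x => (w x).1)
      rw [← mon_eq]
      exact this
    · have h := isWeightedHomogeneous_monomial (bw : ι × Fin p → ℕ × ℕ) s (1:k) rfl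
      refine hs2 _ _ (lD_hom_pow a _ _ h) ?_
      intro he
      apply hw'
      have hcard : Multiset.card (Finsupp.toMultiset s) = Fintype.card Q := by
        have := congrArg Prod.fst he
        simp only [hμ, Prod.fst_add, add_zero] at this
        rw [← this, Finsupp.weight_apply, Finsupp.sum, Prod.fst_sum, Finsupp.card_toMultiset, Finsupp.sum]
        refine Finset.sum_congr rfl fun z _ => ?_
        simp [bw]
      exact word_ex s hcard
  have hker : LinearMap.ker (lD ι k p ^ b) ≤ LinearMap.ker φ := by
    intro f hf
    rw [LinearMap.mem_ker] at hf ⊢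
    have e1 : φ f = φ (weightedHomogeneousComponent bw μ f) := by
      conv_lhs => rw [← hφπ]
      rfl
    have h2 : (lD ι k p ^ b) (weightedHomogeneousComponent bw μ f) = 0 := by
      rw [comp_D, hf, map_zero]
    have h3 := kl_pos μ hτ _ (weightedHomogeneousComponent_isWeightedHomogeneous (w := bw) μ f)
    obtain ⟨b', rfl⟩ : ∃ b', b = b' + 1 := ⟨b-1, by omega⟩
    obtain ⟨g, hg⟩ := T1 b' (by omega) _ h3 h2
    rw [e1, hg, show p - (b'+1) = a by omega]
    exact congrArg (fun A => A g) hφD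
  obtain ⟨ψ, hψ⟩ : ∃ ψ : MvPolynomial (ι × Fin p) k →ₗ[k] k, ψ ∘ₗ (lD ι k p ^ b) = φ := by
    have : φ ∈ LinearMap.range (lD ι k p ^ b).dualMap := by
      rw [LinearMap.range_dualMap_eq_dualAnnihilator_ker, Submodule.mem_dualAnnihilator]
      exact fun w hw => hker hw
    obtain ⟨ψ, hψ⟩ := this
    exact ⟨ψ, hψ⟩
  refine ⟨fam (ψ ∘ₗ weightedHomogeneousComponent bw (μ + (0,b))), ?_, ?_, ?_⟩
  · intro σ ε g
    rw [fam, fam]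
    congr 1
    exact mon_comp (fun x => (g x, ε x)) σ
  · intro ε hε
    funext g
    rw [fam, LinearMap.comp_apply, mon_eq]
    have h := isWeightedHomogeneous_monomial (bw : ι × Fin p → ℕ × ℕ) (∑ x, Finsupp.single (g x, ε x) 1) (1:k) rfl
    rw [weightedHomogeneousComponent_of_mem h, if_neg]
    · exact map_zero _
    · rw [mon_wt]
      intro h'
      exact hε (congrArg Prod.snd h').symm
  · rw [rho_fam_pow]
    conv_rhs => rw [← hFφ, ← hφπ]
    congr 1
    refine LinearMap.ext fun f => ?_
    rw [LinearMap.comp_apply, LinearMap.comp_apply, ← comp_D, LinearMap.comp_apply, ← hψ]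
    rfl

end Bridge
end Stmt7

open CategoryTheory Finset
set_option synthInstance.maxHeartbeats 1000000
set_option maxHeartbeats 4000000
set_option linter.all false
namespace Stmt7
open CategoryTheory Abelian

section Cx
variable {k : Type} [Field k] {m n d : ℕ} {Q : Type}

/-- invariants -/
def Inv (c : Coef k m n d Q) : Submodule (SAlg k m n d) c.T where
  carrier := {F | ∀ σ, c.R σ F = F}
  zero_mem' := fun σ => map_zero _
  add_mem' := fun {a b} ha hb σ => by rw [map_add, ha σ, hb σ]
  smul_mem' := fun a F hF σ => by rw [c.R_smul, hF σ]

/-- equivariant families with prescribed support -/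
def Cx (c : Coef k m n d Q) (p : ℕ) (P : (Q → Fin p) → Prop) : Submodule (SAlg k m n d) ((Q → Fin p) → c.T) where
  carrier := {F | (∀ (σ : Equiv.Perm Q) ε, c.R σ (F ε) = F (ε ∘ σ)) ∧ ∀ ε, ¬ P ε → F ε = 0}
  zero_mem' := ⟨fun σ ε => map_zero _, fun _ _ => rfl⟩
  add_mem' := fun {a b} ha hb => ⟨fun σ ε => by rw [Pi.add_apply, Pi.add_apply, map_add, ha.1, hb.1], 
    fun ε h => by rw [Pi.add_apply, ha.2 ε h, hb.2 ε h, add_zero]⟩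
  smul_mem' := fun a F hF => ⟨fun σ ε => by rw [Pi.smul_apply, Pi.smul_apply, c.R_smul, hF.1], 
    fun ε h => by rw [Pi.smul_apply, hF.2 ε h, smul_zero]⟩

/-- evaluation -/
def Cx.ev (c : Coef k m n d Q) {p : ℕ} (P : (Q → Fin p) → Prop) (ε0 : Q → Fin p) : Cx c p P →ₗ[SAlg k m n d] c.T where
  toFun F := F.1 ε0
  map_add' _ _ := rfl
  map_smul' _ _ := rfl

section
variable (c : Coef k m n d Q) {p : ℕ} (P : (Q → Fin p) → Prop) (ε0 : Q → Fin p) 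
  (hP : ∀ ε, P ε ↔ ∃ σ : Equiv.Perm Q, ε = ε0 ∘ σ)
include hP

lemma Cx.ev_inj : Function.Injective (Cx.ev c P ε0) := by
  intro F G h
  apply Subtype.ext
  funext ε
  by_cases hε : P ε
  · obtain ⟨σ, rfl⟩ := (hP ε).1 hε
    rw [← F.2.1, ← G.2.1]
    exact congrArg _ h
  · rw [F.2.2 ε hε, G.2.2 ε hε]

lemma Cx.ev_range (w : c.T) : (∃ F, Cx.ev c P ε0 F = w) ↔ 
    ∀ (x : {σ : Equiv.Perm Q // ε0 ∘ σ = ε0}), c.R x.1 w = (1:k) • w := by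
  constructor
  · rintro ⟨F, rfl⟩ ⟨σ, h⟩
    change c.R σ (F.1 ε0) = (1:k) • F.1 ε0
    rw [one_smul, F.2.1, h]
  · intro hw
    classical
    have key : ∀ σ τ : Equiv.Perm Q, ε0 ∘ σ = ε0 ∘ τ → c.R σ w = c.R τ w := by
      intro σ τ h
      have h3 := hw ⟨σ * τ⁻¹, by
        funext x
        have := congrFun h (τ⁻¹ x)
        simp only [Function.comp, Equiv.Perm.mul_apply] at this ⊢
        rw [this, perm_apply_inv_self]⟩
      have h5 := congrArg (c.R τ) h3
      simp only [c.R_R, inv_mul_cancel_right, one_smul] at h5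
      exact h5
    let f : (Q → Fin p) → c.T := fun ε => if h : ∃ σ : Equiv.Perm Q, ε = ε0 ∘ σ then c.R h.choose w else 0
    have hf : ∀ σ : Equiv.Perm Q, f (ε0 ∘ σ) = c.R σ w := by
      intro σ
      have h : ∃ σ' : Equiv.Perm Q, ε0 ∘ σ = ε0 ∘ σ' := ⟨σ, rfl⟩
      simp only [f]
      rw [dif_pos h]
      exact key _ _ h.choose_spec.symm
    refine ⟨⟨f, ?_, ?_⟩, ?_⟩
    · intro σ ε
      by_cases h : ∃ τ : Equiv.Perm Q, ε = ε0 ∘ τ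
      · obtain ⟨τ, rfl⟩ := h
        have : (ε0 ∘ τ) ∘ σ = ε0 ∘ ⇑(τ * σ) := rfl
        rw [this, hf, hf, c.R_R]
      · have h' : ¬ ∃ τ : Equiv.Perm Q, ε ∘ σ = ε0 ∘ τ := by
          rintro ⟨τ, hτ⟩
          apply h
          refine ⟨τ * σ⁻¹, ?_⟩
          funext x
          have := congrFun hτ (σ⁻¹ x)
          simp only [Function.comp, Equiv.Perm.mul_apply, perm_apply_inv_self] at this ⊢
          exact this
        simp only [f]
        rw [dif_neg h, dif_neg h', map_zero]
    · intro ε h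
      rw [hP] at h
      simp only [f]
      rw [dif_neg h]
    · change f ε0 = w
      have := hf 1
      rw [c.R_one] at this
      exact this

/-- constant word -/
lemma Cx.const_van {L : SMod k m n d} (hc : ∀ x y, ε0 x = ε0 y) (t : ℕ) (h : Van L (Inv c) t) : Van L (Cx c p P) t := by
  refine Van.of_equiv (LinearEquiv.ofBijective ((Cx.ev c P ε0).codRestrict (Inv c) ?_) ⟨?_, ?_⟩) h
  · intro F σ
    have := (Cx.ev_range c P ε0 hP _).1 ⟨F, rfl⟩ ⟨σ, funext fun x => hc _ _⟩
    rw [one_smul] at this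
    exact this
  · intro F G h
    exact Cx.ev_inj c P ε0 hP (congrArg Subtype.val h)
  · intro w
    obtain ⟨F, hF⟩ := (Cx.ev_range c P ε0 hP w.1).2 (fun x => by rw [one_smul]; exact w.2 _)
    exact ⟨F, Subtype.ext hF⟩

lemma Cx.nonconst_acyc {p' j : ℕ} [hp : Fact p'.Prime] [CharP k p'] (h2 : 2 < p') (e0 : Fin d ≃ Unit × Fin (p' ^ (j+1)))
    (hm : d ≤ m) (hn : d ≤ n) (x y : Q) (hxy : ε0 x ≠ ε0 y) : Acyc (M0cat k m n d) (Cx c p P) := by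
  refine Coef.acyc h2 e0 c hm hn {z | ε0 z = ε0 x} ⟨x, rfl⟩ ⟨y, fun h => hxy h.symm⟩ 
    (fun s : {σ : Equiv.Perm Q // ε0 ∘ σ = ε0} => s.1) ?_ (fun _ => 1) (Cx.ev c P ε0) (Cx.ev_inj c P ε0 hP) (Cx.ev_range c P ε0 hP)
  rintro ⟨σ, hσ⟩ z
  have := congrFun hσ z
  simp only [Function.comp] at this
  simp only [Set.mem_setOf_eq, this]
end

variable [Fintype Q] [DecidableEq Q]

lemma Cx.van_decomp (c : Coef k m n d Q) {p : ℕ} (P : (Q → Fin p) → Prop) {L : SMod k m n d} (t : ℕ)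
    (h : ∀ κ : Fin p → Fin (Fintype.card Q + 1), Van L (Cx c p fun ε => P ε ∧ ∀ v, mul' ε v = (κ v).1) t) : Van L (Cx c p P) t := by
  classical
  refine Van.of_decomp (M := fun κ : Fin p → Fin (Fintype.card Q + 1) => Cx c p fun ε => P ε ∧ ∀ v, mul' ε v = (κ v).1)
    (fun κ => Submodule.inclusion ?_) (fun κ => 
      { toFun := fun F => ⟨fun ε => if ∀ v, mul' ε v = (κ v).1 then F.1 ε else 0, ?_, ?_⟩
        map_add' := ?_
        map_smul' := ?_ }) ?_ h
  · intro F hF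
    exact ⟨hF.1, fun ε h => hF.2 ε fun h' => h h'.1⟩
  · intro σ ε
    have : (∀ v, mul' (ε ∘ σ) v = (κ v).1) ↔ ∀ v, mul' ε v = (κ v).1 := by simp only [mul'_comp]
    simp only [this]
    split_ifs
    · exact F.2.1 σ ε
    · exact map_zero _
  · intro ε h
    change (if ∀ v, mul' ε v = (κ v).1 then F.1 ε else 0) = 0
    split_ifs with h1
    · exact F.2.2 ε fun h2 => h ⟨h2, h1⟩
    · rfl
  · intro F G
    apply Subtype.ext
    funext ε
    change (if ∀ v, mul' ε v = (κ v).1 then F.1 ε + G.1 ε else 0) = (if ∀ v, mul' ε v = (κ v).1 then F.1 ε else 0) + (if ∀ v, mul' ε v = (κ v).1 then G.1 ε else 0)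
    split_ifs
    · rfl
    · rw [add_zero]
  · intro a F
    apply Subtype.ext
    funext ε
    change (if ∀ v, mul' ε v = (κ v).1 then a • F.1 ε else 0) = a • (if ∀ v, mul' ε v = (κ v).1 then F.1 ε else 0)
    split_ifs
    · rfl
    · rw [smul_zero]
  · intro F
    apply Subtype.ext
    funext ε
    rw [AddSubmonoidClass.coe_finsetSum, Finset.sum_apply]
    have hb : ∀ v, mul' ε v < Fintype.card Q + 1 := fun v => Nat.lt_succ_of_le (Finset.card_le_univ _)
    rw [Finset.sum_eq_single (fun v => ⟨mul' ε v, hb v⟩)]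
    · change (if ∀ v, mul' ε v = _ then F.1 ε else 0) = F.1 ε
      rw [if_pos fun v => rfl]
    · intro κ _ hκ
      change (if ∀ v, mul' ε v = _ then F.1 ε else 0) = 0
      rw [if_neg]
      intro h'
      apply hκ
      funext v
      exact Fin.ext (h' v).symm
    · intro h; exact absurd (mem_univ _) h

/-- weight -/
abbrev Cw (c : Coef k m n d Q) (p w : ℕ) := Cx c p fun ε => ∑ x, (ε x).1 = w

theorem Cw.van (c : Coef k m n d Q) (hQ : 0 < Fintype.card Q) {p j : ℕ} [hp : Fact p.Prime] [CharP k p] (h2 : 2 < p) (e0 : Fin d ≃ Unit × Fin (p ^ (j+1)))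
    (hm : d ≤ m) (hn : d ≤ n) (w t : ℕ) (h : ∀ i < p, w = i * Fintype.card Q → Van (M0cat k m n d) (Inv c) t) : 
    Van (M0cat k m n d) (Cw c p w) t := by
  classical
  refine Cx.van_decomp c _ t fun κ => ?_
  by_cases hex : ∃ ε : Q → Fin p, ∑ x, (ε x).1 = w ∧ ∀ v, mul' ε v = (κ v).1
  · obtain ⟨ε0, h0, h0'⟩ := hex
    have hP : ∀ ε : Q → Fin p, ((∑ x, (ε x).1 = w) ∧ ∀ v, mul' ε v = (κ v).1) ↔ ∃ σ : Equiv.Perm Q, ε = ε0 ∘ σ := by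
      intro ε
      constructor
      · rintro ⟨_, h⟩
        exact mul'_ex ε ε0 fun v => by rw [h, h0']
      · rintro ⟨σ, rfl⟩
        refine ⟨?_, fun v => by rw [mul'_comp, h0']⟩
        rw [← h0]
        exact Equiv.sum_comp σ (fun x => (ε0 x).1)
    by_cases hc : ∀ x y, ε0 x = ε0 y
    · refine Cx.const_van c _ ε0 hP hc t ?_
      obtain ⟨x0⟩ := Fintype.card_pos_iff.1 hQ
      refine h (ε0 x0).1 (ε0 x0).2 ?_
      rw [← h0, Finset.sum_congr rfl fun x _ => congrArg Fin.val (hc x x0), Finset.sum_const, Finset.card_univ, smul_eq_mul, mul_comm]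
    · push Not at hc
      obtain ⟨x, y, hxy⟩ := hc
      exact Cx.nonconst_acyc c _ ε0 hP h2 e0 hm hn x y hxy t
  · haveI : Subsingleton (Cx c p fun ε : Q → Fin p => ((∑ x, (ε x).1 = w) ∧ ∀ v, mul' ε v = (κ v).1)) := by
      refine ⟨fun F G => Subtype.ext (funext fun ε => ?_)⟩
      rw [F.2.2 ε (fun h => hex ⟨ε, h⟩), G.2.2 ε (fun h => hex ⟨ε, h⟩)]
    exact Van.of_subsingleton t

end Cx
end Stmt7

open CategoryTheory Finset
set_option synthInstance.maxHeartbeats 1000000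
set_option maxHeartbeats 4000000
set_option linter.all false
namespace Stmt7
open CategoryTheory Abelian

section line
variable {A : Type} [Ring A] [HasExt.{1} (ModuleCat.{0} A)] {L : ModuleCat.{0} A}
variable {C : ℕ → Type} [∀ i, AddCommGroup (C i)] [∀ i, Module A (C i)] (δ : ∀ i, C (i+1) →ₗ[A] C i)
  (hex : ∀ i, Function.Exact (δ (i+1)) (δ i))
include hex

lemma line_van (t : ℕ) : ∀ c, (∀ u v, u + v = t → Van L (C (c+1+u)) v) → Van L (LinearMap.range (δ c)) t := by
  induction t with
  | zero =>
    intro c h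
    exact Van.right_zero (Y := C (c+1)) (Z := LinearMap.range (δ c)) (δ c).rangeRestrict (δ c).surjective_rangeRestrict (h 0 0 rfl)
  | succ t ih =>
    intro c h
    refine Van.right (X := LinearMap.range (δ (c+1))) (Y := C (c+1)) (Z := LinearMap.range (δ c)) (LinearMap.range (δ (c+1))).subtype
      (δ c).rangeRestrict Subtype.val_injective ?_ (δ c).surjective_rangeRestrict (by omega : 1 + t = t+1) (ih (c+1) ?_) (h 0 (t+1) (by omega))
    · intro y
      rw [Subtype.ext_iff]
      change (δ c y = 0) ↔ _
      rw [hex c y]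
      constructor
      · rintro ⟨x, rfl⟩
        exact ⟨⟨_, ⟨x, rfl⟩⟩, rfl⟩
      · rintro ⟨⟨_, ⟨x, rfl⟩⟩, rfl⟩
        exact ⟨x, rfl⟩
    · intro u v huv
      have := h (u+1) v (by omega)
      rw [show c + 1 + (u+1) = c + 1 + 1 + u by omega] at this
      exact this

variable {G : Type} [AddCommGroup G] [Module A G] (V : C 0 →ₗ[A] G) (hV : Function.Surjective V) (hV' : Function.Exact (δ 0) V)
include hV hV'

omit hex in
lemma line_ex : Function.Exact (LinearMap.range (δ 0)).subtype V := by
  intro y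
  rw [hV' y]
  constructor
  · rintro ⟨x, rfl⟩
    exact ⟨⟨_, ⟨x, rfl⟩⟩, rfl⟩
  · rintro ⟨⟨_, ⟨x, rfl⟩⟩, rfl⟩
    exact ⟨x, rfl⟩

lemma line_van0 (t : ℕ) (h : ∀ u v, u + v = t → Van L (C u) v) : Van L G t := by
  cases t with
  | zero => exact Van.right_zero (Y := C 0) (Z := G) V hV (h 0 0 rfl)
  | succ t =>
    refine Van.right (X := LinearMap.range (δ 0)) (Y := C 0) (Z := G) (LinearMap.range (δ 0)).subtype V Subtype.val_injective 
      (line_ex δ V hV hV') hV (by omega : 1 + t = t+1) (line_van δ hex t 0 fun u v huv => ?_) (h 0 (t+1) (by omega))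
    have := h (u+1) v (by omega)
    rw [show u+1 = 0 + 1 + u by omega] at this
    exact this

lemma line_bij (t : ℕ) (h : ∀ u v, u + v = t → Van L (C (u+1)) v) (h' : ∀ u v, 1 + (u + v) = t → Van L (C (u+1)) v) : 
    Function.Bijective (pull L V : HH L G t → HH L (C 0) t) := by
  refine pull_g_bij (X := LinearMap.range (δ 0)) (Y := C 0) (Z := G) (LinearMap.range (δ 0)).subtype V Subtype.val_injective (line_ex δ V hV hV') hV 
    (line_van δ hex t 0 fun u v huv => ?_) (fun s hs => line_van δ hex s 0 fun u v huv => ?_)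
  · have := h u v (by omega)
    rw [show u+1 = 0 + 1 + u by omega] at this
    exact this
  · have := h' u v (by omega)
    rw [show u+1 = 0 + 1 + u by omega] at this
    exact this
end line

section rho
variable {k : Type} [Field k] {m n d : ℕ} {Q : Type} [Fintype Q] [DecidableEq Q] (c : Coef k m n d Q) {p : ℕ}

/-- the lowering operator -/
def rhoL (c : Coef k m n d Q) (p : ℕ) : Module.End (SAlg k m n d) ((Q → Fin p) → c.T) where
  toFun F := rhoF F
  map_add' F G := by
    funext ε
    simp only [rhoF, Pi.add_apply]
    rw [← Finset.sum_add_distrib]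
    refine Finset.sum_congr rfl fun x _ => ?_
    split_ifs <;> simp
  map_smul' a F := by
    funext ε
    simp only [rhoF, Pi.smul_apply, RingHom.id_apply]
    rw [Finset.smul_sum]
    refine Finset.sum_congr rfl fun x _ => ?_
    split_ifs <;> simp

lemma rhoL_pow (b : ℕ) (F : (Q → Fin p) → c.T) : (rhoL c p ^ b) F = rhoF^[b] F := by
  rw [Module.End.pow_apply]; rfl

lemma upd_comp {B : Type} (ε : Q → B) (σ : Equiv.Perm Q) (y : Q) (v : B) : 
    Function.update (ε ∘ σ) y v = Function.update ε (σ y) v ∘ σ := by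
  funext z
  simp only [Function.comp]
  by_cases h : z = y
  · subst h; simp
  · rw [Function.update_of_ne h, Function.update_of_ne (fun h' => h (σ.injective h'))]; rfl

lemma sum_upd (ε : Q → Fin p) (x : Q) (h : (ε x).1 + 1 < p) : 
    ∑ y, (Function.update ε x ⟨(ε x).1 + 1, h⟩ y).1 = ∑ y, (ε y).1 + 1 := by
  rw [← Finset.add_sum_erase univ _ (mem_univ x), ← Finset.add_sum_erase univ (fun y => (ε y).1) (mem_univ x), Function.update_self]
  rw [Finset.sum_congr rfl fun y hy => by rw [Function.update_of_ne (ne_of_mem_erase hy)]]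
  simp only
  omega

lemma rhoF_mem (w : ℕ) (F : (Q → Fin p) → c.T) (hF : F ∈ Cw c p (w+1)) : rhoF F ∈ Cw c p w := by
  refine ⟨?_, ?_⟩
  · intro σ ε
    simp only [rhoF, map_sum]
    rw [← Equiv.sum_comp σ]
    refine Finset.sum_congr rfl fun x _ => ?_
    simp only [Function.comp]
    split_ifs with h
    · rw [hF.1, ← upd_comp]
    · exact map_zero _
  · intro ε hε
    simp only [rhoF]
    refine Finset.sum_eq_zero fun x _ => ?_
    split_ifs with h
    · apply hF.2
      change ¬ (∑ y, (Function.update ε x ⟨(ε x).1 + 1, h⟩ y).1 = w + 1)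
      change ¬ (∑ y, (ε y).1 = w) at hε
      rw [sum_upd]
      omega
    · rfl

lemma rhoF_pow_mem (b w : ℕ) (F : (Q → Fin p) → c.T) (hF : F ∈ Cw c p (w+b)) : rhoF^[b] F ∈ Cw c p w := by
  induction b generalizing F with
  | zero => exact hF
  | succ b ih =>
    rw [Function.iterate_succ_apply]
    exact ih _ (rhoF_mem c (w+b) F hF)

/-- restricted power of the lowering operator -/
def rdel (w w' b : ℕ) (h : w' = w + b) : Cw c p w' →ₗ[SAlg k m n d] Cw c p w :=
  (rhoL c p ^ b).restrict fun F hF => by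
    rw [rhoL_pow]
    subst h
    exact rhoF_pow_mem c b w F hF

lemma rdel_coe (w w' b : ℕ) (h : w' = w + b) (F : Cw c p w') : (rdel c w w' b h F).1 = rhoF^[b] F.1 := by
  rw [← rhoL_pow]; rfl

end rho

section exact
variable {k : Type} [Field k] {m n d : ℕ} {Q : Type} [Fintype Q] [DecidableEq Q] {p j : ℕ} [hp : Fact p.Prime] [CharP k p] 
  (h2 : 2 < p) (e : Fin d ≃ Q × Fin (p ^ (j+1)))

lemma mem_Cw_iff (w : ℕ) (F : (Q → Fin p) → (coefT (k := k) (m := m) (n := n) h2 e).T) : F ∈ Cw (coefT (k := k) (m := m) (n := n) h2 e) p w ↔ 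
    (∀ (σ : Equiv.Perm Q) ε g, F (ε ∘ σ) (g ∘ σ) = F ε g) ∧ ∀ ε, ∑ x, (ε x).1 ≠ w → F ε = 0 := by
  refine and_congr_left fun _ => ⟨fun h σ ε g => ?_, fun h σ ε => ?_⟩
  · rw [← h σ ε, coefT_R]
    congr 1
    funext x
    simp
  · funext g
    rw [coefT_R, ← h σ ε]
    congr 1
    funext x
    simp

theorem rdel_exact (w w' w'' a b : ℕ) (h : w' = w + a) (h' : w'' = w' + b) (hab : a + b = p) (ha : 0 < a) (hb : 0 < b) (hw : 0 < w') : 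
    Function.Exact (rdel (coefT (k := k) (m := m) (n := n) h2 e) w' w'' b h') (rdel (coefT (k := k) (m := m) (n := n) h2 e) (p := p) w w' a h) := by
  intro F
  constructor
  · intro hF
    have h0 : rhoF^[a] F.1 = 0 := by
      rw [← rdel_coe _ w w' a h, hF]; rfl
    have hm := (mem_Cw_iff h2 e w' F.1).1 F.2
    obtain ⟨F', h1, h3, h4⟩ := rho_exact F.1 hm.1 w' a b hw hab ha hb hm.2 h0
    refine ⟨⟨F', (mem_Cw_iff h2 e w'' F').2 ⟨h1, fun ε hε => h3 ε (by omega)⟩⟩, ?_⟩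
    apply Subtype.ext
    rw [rdel_coe]
    exact h4
  · rintro ⟨F', rfl⟩
    apply Subtype.ext
    rw [rdel_coe, rdel_coe, ← Function.iterate_add_apply, hab]
    exact rho_p F'.1 ((mem_Cw_iff h2 e w'' F'.1).1 F'.2).1

/-- weights of the complex -/
def tau (p : ℕ) (c : ℕ) : ℕ := p * (c / 2) + c % 2
/-- exponents of the complex -/
def eps (p : ℕ) (c : ℕ) : ℕ := if c % 2 = 0 then 1 else p - 1

omit [CharP k p] in
lemma tau_succ (c : ℕ) : tau p (c+1) = tau p c + eps p c := by
  have := hp.out.pos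
  unfold tau eps
  rcases Nat.mod_two_eq_zero_or_one c with h | h
  · rw [if_pos h, show (c+1)/2 = c/2 by omega, show (c+1)%2 = 1 by omega, h]
  · rw [if_neg (by omega), show (c+1)/2 = c/2 + 1 by omega, show (c+1)%2 = 0 by omega, h, mul_add]
    omega

/-- the terms of the complex -/
abbrev CC (c : ℕ) := Cw (coefT (k := k) (m := m) (n := n) h2 e) p (tau p c)

/-- the differentials -/
def del (c : ℕ) : CC (k := k) (m := m) (n := n) h2 e (c+1) →ₗ[SAlg k m n d] CC (k := k) (m := m) (n := n) h2 e c :=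
  rdel _ _ _ _ (tau_succ c)

theorem del_exact (c : ℕ) : Function.Exact (del (k := k) (m := m) (n := n) h2 e (c+1)) (del (k := k) (m := m) (n := n) h2 e c) := by
  have := hp.out.pos
  refine rdel_exact h2 e _ _ _ _ _ _ _ ?_ ?_ ?_ ?_
  · unfold eps
    rcases Nat.mod_two_eq_zero_or_one c with h | h
    · rw [if_pos h, if_neg (by omega)]; omega
    · rw [if_neg (by omega), if_pos (by omega)]; omega
  · unfold eps; split_ifs <;> omega
  · unfold eps; split_ifs <;> omega
  · unfold tau
    rcases Nat.mod_two_eq_zero_or_one c with h | h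
    · omega
    · rw [show (c+1)/2 = c/2 + 1 by omega, mul_add]; omega
end exact
end Stmt7

open CategoryTheory Finset
set_option synthInstance.maxHeartbeats 1000000
set_option maxHeartbeats 4000000
set_option linter.all false
namespace Stmt7
open CategoryTheory Abelian

section comb
variable {k : Type} [Field k] {p : ℕ} [hp : Fact p.Prime] [CharP k p] {m : ℕ}
variable {Q Q' : Type} [Fintype Q] [DecidableEq Q] [Fintype Q'] [DecidableEq Q'] (E : Q ≃ Q' × Fin (p^1))

/-- repeat every letter -/
def rlf (g' : Q' → Fin m) : Q → Fin m := fun x => g' (E x).1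

/-- zero word -/
def zw (Q : Type) (p : ℕ) [hp : Fact p.Prime] : Q → Fin p := fun _ => ⟨0, hp.out.pos⟩

omit [DecidableEq Q'] in
lemma mul'_lft (g' : Q' → Fin m) (v : Fin m) : mul' (rlf E g') v = p * mul' g' v := by
  unfold mul'
  have : (univ.filter fun z => rlf E g' z = v) = ((univ.filter fun y => g' y = v) ×ˢ (univ : Finset (Fin (p^1)))).map E.symm.toEmbedding := by
    ext z
    simp only [Finset.mem_map_equiv, Finset.mem_filter, Finset.mem_product, mem_univ, true_and, and_true, Equiv.symm_symm]
    exact Iff.rfl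
  rw [this, Finset.card_map, Finset.card_product, Finset.card_univ, Fintype.card_fin, pow_one, mul_comm]

include E in
lemma exists_lft (g : Q → Fin m) (h : ∀ v, p ∣ mul' g v) : ∃ g' : Q' → Fin m, ∀ v, mul' g v = p * mul' g' v := by
  choose s hs using h
  have hc : Fintype.card Q = Fintype.card Q' * p := by
    rw [Fintype.card_congr E, Fintype.card_prod, Fintype.card_fin, pow_one]
  have hsum : ∑ v, s v = Fintype.card Q' := by
    have h1 := sum_mul' g
    rw [Finset.sum_congr rfl fun v _ => hs v, ← Finset.mul_sum, hc, mul_comm] at h1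
    exact Nat.eq_of_mul_eq_mul_right hp.out.pos h1
  obtain ⟨w, hw⟩ := word_ex (Q := Q') (Finsupp.equivFunOnFinite.symm s) (by
    rw [Finsupp.card_toMultiset, Finsupp.sum_fintype _ _ (fun _ => rfl), ← hsum]; rfl)
  refine ⟨w, fun v => ?_⟩
  rw [hs]
  congr 1
  have := DFunLike.congr_fun hw v
  rw [Finsupp.finsetSum_apply] at this
  change s v = _ at this
  rw [this, mul', Finset.card_filter]
  refine Finset.sum_congr rfl fun x _ => ?_
  rw [Finsupp.single_apply]

/-- unit word -/
def uw (x : Q) : Q → Fin p := Function.update (zw Q p) x ⟨0+1, by have := hp.out.one_lt; omega⟩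

lemma rho_zw {T : Type} [AddCommGroup T] (F : (Q → Fin p) → T) : rhoF F (zw Q p) = ∑ x, F (uw x) := by
  unfold rhoF
  refine Finset.sum_congr rfl fun x _ => ?_
  rw [dif_pos]
  rfl

lemma uw_comp (x : Q) (σ : Equiv.Perm Q) : (uw (p := p) (σ x)) ∘ σ = uw x := by
  rw [uw, ← upd_comp]; rfl

lemma rho_lft (F : (Q → Fin p) → (Q → Fin m) → k) (hF : ∀ (σ : Equiv.Perm Q) ε g, F (ε ∘ σ) (g ∘ σ) = F ε g) (g' : Q' → Fin m) : 
    rhoF F (zw Q p) (rlf E g') = 0 := by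
  rw [rho_zw, Finset.sum_apply, ← Equiv.sum_comp E.symm, Fintype.sum_prod_type]
  refine Finset.sum_eq_zero fun y _ => ?_
  have i0 : Fin (p^1) := ⟨0, by rw [pow_one]; exact hp.out.pos⟩
  have : ∀ i, F (uw (E.symm (y, i))) (rlf E g') = F (uw (E.symm (y, i0))) (rlf E g') := by
    intro i
    have h1 := hF (Equiv.swap (E.symm (y,i)) (E.symm (y,i0))) (uw (E.symm (y, i0))) (rlf E g')
    rw [comp_swap (rlf E g') _ _ (by simp [rlf])] at h1
    rw [← h1]
    congr 1
    conv_lhs => rw [← uw_comp (E.symm (y,i)) (Equiv.swap (E.symm (y,i)) (E.symm (y,i0)))]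
    rw [Equiv.swap_apply_left]
  rw [Finset.sum_congr rfl fun i _ => this i, Finset.sum_const, Finset.card_univ, Fintype.card_fin, nsmul_eq_mul, Nat.cast_pow, CharP.cast_eq_zero, zero_pow one_ne_zero, zero_mul]

/-- selected letter -/
def sel (p : ℕ) (μ : Fin m → ℕ) (v : Fin m) : Prop := ∃ h : (∃ v, ¬ p ∣ μ v), v = h.choose

lemma sum_uw (x : Q) : ∑ y, (uw (p := p) x y).1 = 1 := by
  have := sum_upd (zw Q p) x (by have := hp.out.one_lt; simp only [zw]; omega)
  simp only [zw, Finset.sum_const_zero] at this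
  exact this

lemma rho_sect (F : (Q → Fin m) → k) (hF : ∀ (σ : Equiv.Perm Q) g, F (g ∘ σ) = F g) (h0 : ∀ g', F (rlf E g') = 0) : 
    ∃ F' : (Q → Fin p) → (Q → Fin m) → k, (∀ (σ : Equiv.Perm Q) ε g, F' (ε ∘ σ) (g ∘ σ) = F' ε g) ∧ 
      (∀ ε, ∑ x, (ε x).1 ≠ 1 → F' ε = 0) ∧ rhoF F' (zw Q p) = F := by
  classical
  refine ⟨fun ε g => ∑ x, if (∑ y, (ε y).1 = 1) ∧ (ε x).1 = 1 ∧ sel p (mul' g) (g x) then F g / (mul' g (g x) : k) else 0, ?_, ?_, ?_⟩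
  · intro σ ε g
    have hm : mul' (g ∘ σ) = mul' g := funext fun v => mul'_comp g σ v
    have hs : ∑ y, ((ε ∘ σ) y).1 = ∑ y, (ε y).1 := Equiv.sum_comp σ (fun y => (ε y).1)
    simp only [hm, hs, hF]
    exact Equiv.sum_comp σ (fun x => if (∑ y, (ε y).1 = 1) ∧ (ε x).1 = 1 ∧ sel p (mul' g) (g x) then F g / (mul' g (g x) : k) else 0)
  · intro ε hε
    funext g
    exact Finset.sum_eq_zero fun x _ => if_neg fun h => hε h.1
  · funext g
    rw [rho_zw, Finset.sum_apply]
    have e1 : ∀ x, (∑ y, if (∑ z, (uw (p := p) x z).1 = 1) ∧ (uw (p := p) x y).1 = 1 ∧ sel p (mul' g) (g y) then F g / (mul' g (g y) : k) else 0) = 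
        if sel p (mul' g) (g x) then F g / (mul' g (g x) : k) else 0 := by
      intro x
      rw [Finset.sum_eq_single x]
      · have : (uw (p := p) x x).1 = 1 := by simp [uw]
        simp [this, sum_uw]
      · intro y _ hy
        apply if_neg
        rintro ⟨_, h, _⟩
        simp [uw, Function.update_of_ne hy, zw] at h
      · intro h; exact absurd (mem_univ _) h
    rw [Finset.sum_congr rfl fun x _ => e1 x]
    by_cases h : ∃ v, ¬ p ∣ mul' g v
    · have hsel : ∀ v, sel p (mul' g) v ↔ v = h.choose := fun v => ⟨fun ⟨_, h'⟩ => h', fun h' => ⟨h, h'⟩⟩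
      simp only [hsel]
      rw [← Finset.sum_filter]
      rw [Finset.sum_congr rfl (g := fun _ => F g / (mul' g h.choose : k)) (fun x hx => by rw [(Finset.mem_filter.1 hx).2])]
      rw [Finset.sum_const, nsmul_eq_mul]
      change ((mul' g h.choose : ℕ) : k) * _ = _
      have hne : ((mul' g h.choose : ℕ) : k) ≠ 0 := by
        rw [Ne, CharP.cast_eq_zero_iff k p]
        exact h.choose_spec
      field_simp
    · have hz : F g = 0 := by
        push Not at h
        obtain ⟨g', hg'⟩ := exists_lft E g h
        obtain ⟨σ, hσ⟩ := mul'_ex g (rlf E g') (fun v => by rw [hg', mul'_lft])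
        rw [hσ, hF, h0]
      rw [hz]
      exact Finset.sum_eq_zero fun x _ => if_neg fun ⟨h', _⟩ => h h'
end comb

section VV
variable {k : Type} [Field k] {m n d : ℕ} {p j : ℕ} [hp : Fact p.Prime] [CharP k p] 
variable {Q Q' : Type} [Fintype Q] [DecidableEq Q] [Fintype Q'] [DecidableEq Q'] (E : Q ≃ Q' × Fin (p^1))
  (h2 : 2 < p) (e : Fin d ≃ Q × Fin (p ^ (j+1))) (e' : Fin d ≃ Q' × Fin (p^(j+1+1))) (he : ∀ i, (e' i).1 = (E (e i).1).1)

/-- coefficients, upper level -/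
abbrev cT {Q : Type} [Fintype Q] [DecidableEq Q] {j : ℕ} (h2 : 2 < p) (e : Fin d ≃ Q × Fin (p ^ (j+1))) := coefT (k := k) (m := m) (n := n) h2 e

lemma mem_Inv_iff (F : (cT (k := k) (m := m) (n := n) h2 e).T) : F ∈ Inv (cT (k := k) (m := m) (n := n) h2 e) ↔ ∀ (σ : Equiv.Perm Q) (g : Q → Fin m), F (g ∘ σ) = F g := by
  constructor
  · intro h σ g
    have := congrFun (h σ⁻¹) g
    rw [coefT_R, inv_inv] at this
    exact this
  · intro h σ
    funext g
    rw [coefT_R]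
    exact h σ⁻¹ g

include he in
omit [Fintype Q] [DecidableEq Q] [Fintype Q'] [DecidableEq Q'] hp in
lemma hat_lft (g' : Q' → Fin m) : hat (n := n) e' g' = hat e (rlf E g') := by
  funext i
  simp only [hat, rlf, he]

omit hp [DecidableEq Q] in
lemma mc_lft (a : SAlg k m n d) (σ : Equiv.Perm Q) (g f : Q → Fin m) : 
    mc a.e (hat e (g ∘ σ)) (hat e (f ∘ σ)) = mc a.e (hat e g) (hat e f) := by
  let s : Equiv.Perm (Fin d) := (e.trans (Equiv.prodCongr σ (Equiv.refl _))).trans e.symm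
  have h1 : ∀ f : Q → Fin m, hat (n := n) e (f ∘ σ) = hat e f ∘ s := by
    intro f; funext i; simp [hat, s]
  rw [h1, h1, mc_perm (a.comm s), ← h1, ← h1, sg_even _ _ (hat_par e _), sg_even _ _ (hat_par e _), one_mul, one_mul]

/-- the truncation map -/
def VV : Inv (cT (k := k) (m := m) (n := n) h2 e) →ₗ[SAlg k m n d] Inv (cT (k := k) (m := m) (n := n) h2 e') where
  toFun F := ⟨fun g' => F.1 (rlf E g'), by
    refine (mem_Inv_iff h2 e' _).2 ?_
    intro σ g'
    have := (mem_Inv_iff h2 e F.1).1 F.2 ((E.trans (Equiv.prodCongr σ (Equiv.refl _))).trans E.symm) (rlf E g')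
    have hx : rlf E (g' ∘ σ) = rlf E g' ∘ ((E.trans (Equiv.prodCongr σ (Equiv.refl _))).trans E.symm) := by
      funext x; simp [rlf]
    exact (congrArg (fun g => F.1 g) hx).trans this⟩
  map_add' _ _ := rfl
  map_smul' a F := by
    apply Subtype.ext
    funext g'
    change (a • F.1) (rlf E g') = _
    rw [coefT_smul]
    have hF := (mem_Inv_iff h2 e F.1).1 F.2
    rw [← Equiv.sum_comp (Equiv.arrowCongr E.symm (Equiv.refl (Fin m)))]
    rw [sum_brot k p 1 (fun h : Q' × Fin (p^1) → Fin m => mc a.e (hat e (rlf E g')) (hat e (Equiv.arrowCongr E.symm (Equiv.refl (Fin m)) h)) * F.1 (Equiv.arrowCongr E.symm (Equiv.refl (Fin m)) h))]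
    · change _ = ∑ f' : Q' → Fin m, _
      refine Finset.sum_congr rfl fun f' _ => ?_
      rw [hat_lft E e e' he, hat_lft E e e' he]
      rfl
    · intro h
      let σ : Equiv.Perm Q := (E.trans (brot Q' (p^1))).trans E.symm
      have h1 : Equiv.arrowCongr E.symm (Equiv.refl (Fin m)) (h ∘ brot Q' (p^1)) = Equiv.arrowCongr E.symm (Equiv.refl (Fin m)) h ∘ σ := by
        funext x; simp [σ, Equiv.arrowCongr]
      have h3 : rlf E g' = rlf E g' ∘ σ := by
        funext x; simp [rlf, σ, brot]
      change mc a.e (hat e (rlf E g')) (hat e (Equiv.arrowCongr E.symm (Equiv.refl (Fin m)) (h ∘ brot Q' (p^1)))) * F.1 (Equiv.arrowCongr E.symm (Equiv.refl (Fin m)) (h ∘ brot Q' (p^1))) = mc a.e (hat e (rlf E g')) (hat e (Equiv.arrowCongr E.symm (Equiv.refl (Fin m)) h)) * F.1 (Equiv.arrowCongr E.symm (Equiv.refl (Fin m)) h)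
      rw [h1, hF]
      congr 1
      conv_lhs => rw [h3]
      exact mc_lft e a σ _ _

theorem VV_surj : Function.Surjective (VV (k := k) (m := m) (n := n) E h2 e e' he) := by
  classical
  intro G
  let Φ : (Fin m → ℕ) → k := fun μ => if h : ∃ g' : Q' → Fin m, ∀ v, μ v = p * mul' g' v then G.1 h.choose else 0
  refine ⟨⟨fun g => Φ (mul' g), ?_⟩, ?_⟩
  · refine (mem_Inv_iff h2 e _).2 ?_
    intro σ g
    have hm : mul' (g ∘ σ) = mul' g := funext fun v => mul'_comp g σ v
    change Φ (mul' (g ∘ σ)) = Φ (mul' g)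
    rw [hm]
  · apply Subtype.ext
    funext g'
    change Φ (mul' (rlf E g')) = G.1 g'
    have h : ∃ g'' : Q' → Fin m, ∀ v, mul' (rlf E g') v = p * mul' g'' v := ⟨g', fun v => mul'_lft E g' v⟩
    simp only [Φ]
    rw [dif_pos h]
    obtain ⟨σ, hσ⟩ := mul'_ex h.choose g' (fun v => by
      have := h.choose_spec v
      rw [mul'_lft] at this
      exact (Nat.eq_of_mul_eq_mul_left hp.out.pos this).symm)
    have := (mem_Inv_iff h2 e' G.1).1 G.2 σ g'
    rw [← hσ] at this
    exact this

lemma tau_zero : tau p 0 = 0 := by simp [tau]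
lemma tau_one : tau p 1 = 1 := by simp [tau]
lemma eps_zero : eps p 0 = 1 := by simp [eps]

lemma wt_zero (ε : Q → Fin p) : (∑ x, (ε x).1 = tau p 0) ↔ ε = zw Q p := by
  rw [tau_zero, Finset.sum_eq_zero_iff]
  constructor
  · intro h
    funext x
    exact Fin.ext (h x (mem_univ _))
  · rintro rfl x _
    rfl

/-- zeroth term -/
noncomputable def CC0 : CC (k := k) (m := m) (n := n) h2 e 0 ≃ₗ[SAlg k m n d] Inv (cT (k := k) (m := m) (n := n) h2 e) := by
  have hP : ∀ ε : Q → Fin p, (∑ x, (ε x).1 = tau p 0) ↔ ∃ σ : Equiv.Perm Q, ε = zw Q p ∘ σ := by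
    intro ε
    rw [wt_zero]
    exact ⟨fun h => ⟨1, h⟩, fun ⟨σ, h⟩ => h⟩
  refine LinearEquiv.ofBijective ((Cx.ev (cT (k := k) (m := m) (n := n) h2 e) _ (zw Q p)).codRestrict (Inv (cT (k := k) (m := m) (n := n) h2 e)) ?_) ⟨?_, ?_⟩
  · intro F σ
    exact F.2.1 σ (zw Q p)
  · intro F G h
    exact Cx.ev_inj _ _ (zw Q p) hP (congrArg Subtype.val h)
  · intro w
    obtain ⟨F, hF⟩ := (Cx.ev_range _ _ (zw Q p) hP w.1).2 (fun x => by rw [one_smul]; exact w.2 _)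
    exact ⟨F, Subtype.ext hF⟩

lemma CC0_coe (F : CC (k := k) (m := m) (n := n) h2 e 0) : (CC0 h2 e F).1 = F.1 (zw Q p) := rfl

theorem VV_exact : Function.Exact (del (k := k) (m := m) (n := n) h2 e 0) (VV (k := k) (m := m) (n := n) E h2 e e' he ∘ₗ (CC0 h2 e).toLinearMap) := by
  intro F
  have hdel : ∀ F', (del (k := k) (m := m) (n := n) h2 e 0 F').1 = rhoF F'.1 := by
    intro F'
    rw [del, rdel_coe, eps_zero]; rfl
  constructor
  · intro hF
    have hF' := (mem_Cw_iff h2 e _ F.1).1 F.2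
    obtain ⟨G, h1, h3, h4⟩ := rho_sect (p := p) E (F.1 (zw Q p)) (fun σ g => hF'.1 σ (zw Q p) g) (fun g' => congrFun (congrArg Subtype.val hF) g')
    have hG : G ∈ CC (k := k) (m := m) (n := n) h2 e (0+1) := (mem_Cw_iff h2 e _ G).2 ⟨h1, fun ε hε => h3 ε (by rw [zero_add, tau_one] at hε; exact hε)⟩
    refine ⟨⟨G, hG⟩, ?_⟩
    apply (CC0 h2 e).injective
    apply Subtype.ext
    rw [CC0_coe, CC0_coe, hdel]
    exact h4
  · rintro ⟨F', rfl⟩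
    have hF' := (mem_Cw_iff h2 e _ F'.1).1 F'.2
    apply Subtype.ext
    funext g'
    have := rho_lft E F'.1 hF'.1 g'
    exact (congrFun (congrFun (hdel F') (zw Q p)) (rlf E g')).trans this
end VV
end Stmt7

open CategoryTheory Finset
set_option synthInstance.maxHeartbeats 1000000
set_option maxHeartbeats 4000000
set_option linter.all false
namespace Stmt7
open CategoryTheory Abelian

section lev
variable {k : Type} [Field k] {m n d : ℕ} {p j : ℕ} [hp : Fact p.Prime] [CharP k p] 
variable {Q Q' : Type} [Fintype Q] [DecidableEq Q] [Fintype Q'] [DecidableEq Q'] (E : Q ≃ Q' × Fin (p^1))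
  (h2 : 2 < p) (e : Fin d ≃ Q × Fin (p ^ (j+1))) (e' : Fin d ≃ Q' × Fin (p^(j+1+1))) (he : ∀ i, (e' i).1 = (E (e i).1).1)

lemma tau_eq (h2 : 2 < p) {u i n' : ℕ} (h : tau p u = i * (n' * p)) : u = 2 * (n' * i) := by
  unfold tau at h
  have h1 : u % 2 = 0 := by
    have : p ∣ u % 2 := by
      rw [← Nat.dvd_add_right (Dvd.intro (u/2) rfl : p ∣ p * (u/2)), h]
      exact ⟨i * n', by ring⟩
    exact Nat.eq_zero_of_dvd_of_lt this (by omega)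
  rw [h1, add_zero] at h
  have h3 : u / 2 = n' * i := by
    apply Nat.eq_of_mul_eq_mul_left hp.out.pos
    rw [h]; ring
  omega

variable {j' : ℕ} (e0 : Fin d ≃ Unit × Fin (p ^ (j'+1))) (hm : d ≤ m) (hn : d ≤ n)
  (n' : ℕ) (hn' : 0 < n') (hc : Fintype.card Q = n' * p)
  (H : ∀ t, ¬ 2 * (n' * p) ∣ t → Van (M0cat k m n d) (Inv (cT (k := k) (m := m) (n := n) h2 e)) t)
include e0 hm hn hn' hc H

lemma CC_van (u v : ℕ) (h : ∀ i < p, u = 2 * (n' * i) → ¬ 2 * (n' * p) ∣ v) : Van (M0cat k m n d) (CC (k := k) (m := m) (n := n) h2 e u) v := by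
  refine Cw.van (cT (k := k) (m := m) (n := n) h2 e) (by rw [hc]; exact Nat.mul_pos hn' hp.out.pos) h2 e0 hm hn _ _ ?_
  intro i hi hw
  rw [hc] at hw
  exact H _ (h i hi (tau_eq h2 hw))

lemma VVs : Function.Surjective (VV (k := k) (m := m) (n := n) E h2 e e' he ∘ₗ (CC0 h2 e).toLinearMap) := by
  intro x
  obtain ⟨y, rfl⟩ := VV_surj E h2 e e' he x
  obtain ⟨z, rfl⟩ := (CC0 (k := k) (m := m) (n := n) h2 e).surjective y
  exact ⟨z, rfl⟩

include he in
theorem lev_van (t : ℕ) (ht : ¬ 2 * n' ∣ t) : Van (M0cat k m n d) (Inv (cT (k := k) (m := m) (n := n) h2 e')) t := by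
  refine line_van0 (L := M0cat k m n d) (C := fun c => CC (k := k) (m := m) (n := n) h2 e c) (G := Inv (cT (k := k) (m := m) (n := n) h2 e')) (del h2 e) (del_exact h2 e) 
    (VV (k := k) (m := m) (n := n) E h2 e e' he ∘ₗ (CC0 h2 e).toLinearMap) (VVs E h2 e e' he e0 hm hn n' hn' hc H) (VV_exact E h2 e e' he) t ?_
  intro u v huv
  refine CC_van h2 e e0 hm hn n' hn' hc H u v ?_
  rintro i hi hu ⟨c, hv⟩
  exact ht ⟨i + p * c, by rw [← huv, hu, hv]; ring⟩

theorem lev_bij (q : ℕ) (hq : n' * p ∣ q) : Function.Bijective (pull (M0cat k m n d) (VV (k := k) (m := m) (n := n) E h2 e e' he) : HH (M0cat k m n d) (Inv (cT (k := k) (m := m) (n := n) h2 e')) (2*q) → HH (M0cat k m n d) (Inv (cT (k := k) (m := m) (n := n) h2 e)) (2*q)) := by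
  have h := line_bij (L := M0cat k m n d) (C := fun c => CC (k := k) (m := m) (n := n) h2 e c) (G := Inv (cT (k := k) (m := m) (n := n) h2 e')) (del h2 e) (del_exact h2 e) 
    (VV (k := k) (m := m) (n := n) E h2 e e' he ∘ₗ (CC0 h2 e).toLinearMap) (VVs E h2 e e' he e0 hm hn n' hn' hc H) (VV_exact E h2 e e' he) (2*q) (by
      intro u v huv
      refine CC_van h2 e e0 hm hn n' hn' hc H _ v ?_
      rintro i hi hu ⟨c, hv⟩
      have : v = 2 * (n' * p * c) := by rw [hv]; ring
      omega) (by
      intro u v huv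
      refine CC_van h2 e e0 hm hn n' hn' hc H _ v ?_
      rintro i hi hu ⟨c, hv⟩
      obtain ⟨s, rfl⟩ := hq
      have h3 : n' * (i + p * c) = n' * (p * s) := by
        have : 2 * (n' * (i + p * c)) = 2 * (n' * (p * s)) := by
          calc _ = 2 * (n' * i) + 2 * (n' * p) * c := by ring
            _ = 2 * (n' * p * s) := by rw [← hu, ← hv]; omega
            _ = _ := by ring
        omega
      have h4 := Nat.eq_of_mul_eq_mul_left hn' h3
      have h5 : p ∣ i := by
        rw [← Nat.dvd_add_left (Dvd.intro c rfl : p ∣ p * c), h4]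
        exact Dvd.intro s rfl
      have h6 := Nat.eq_zero_of_dvd_of_lt h5 hi
      rw [h6] at hu
      omega)
  have h0 := pull_bij_of_equiv (L := M0cat k m n d) (CC0 (k := k) (m := m) (n := n) h2 e) (2*q)
  refine (Function.Bijective.of_comp_iff' h0 _).1 ?_
  convert h using 1
  funext x
  exact pull_pull _ _ x
end lev

section tower
/-- tower of index sets -/
def Yt (p : ℕ) : ℕ → Type
  | 0 => Unit
  | b+1 => Yt p b × Fin (p^1)
instance YtF (p : ℕ) : (b : ℕ) → Fintype (Yt p b)
  | 0 => inferInstanceAs (Fintype Unit)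
  | b+1 => haveI := YtF p b; inferInstanceAs (Fintype (Yt p b × Fin (p^1)))
instance YtD (p : ℕ) : (b : ℕ) → DecidableEq (Yt p b)
  | 0 => inferInstanceAs (DecidableEq Unit)
  | b+1 => haveI := YtD p b; inferInstanceAs (DecidableEq (Yt p b × Fin (p^1)))
lemma Yt_card (p b : ℕ) : Fintype.card (Yt p b) = p^b := by
  induction b with
  | zero => rfl
  | succ b ih => 
    change Fintype.card (Yt p b × Fin (p^1)) = _
    rw [Fintype.card_prod, ih, Fintype.card_fin, pow_one, pow_succ]

/-- splitting -/
def YtE (p b : ℕ) : Yt p (b+1) ≃ Yt p b × Fin (p^1) := Equiv.refl _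

variable {k : Type} [Field k] {m n d : ℕ} {p : ℕ} [hp : Fact p.Prime] [CharP k p] 

/-- regroup -/
def reg {d b j : ℕ} (e : Fin d ≃ Yt p (b+1) × Fin (p^(j+1))) : Fin d ≃ Yt p b × Fin (p^(j+1+1)) :=
  (e.trans (Equiv.prodCongr (YtE p b) (Equiv.refl _))).trans ((Equiv.prodAssoc _ _ _).trans (Equiv.prodCongr (Equiv.refl _) 
    (finProdFinEquiv.trans (finCongr (by ring)))))

theorem tower (h2 : 2 < p) (a : ℕ) (e1 : Fin d ≃ Yt p a × Fin (p ^ (0+1))) {j' : ℕ} (e0 : Fin d ≃ Unit × Fin (p ^ (j'+1))) (hm : d ≤ m) (hn : d ≤ n)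
    (H : ∀ t, ¬ 2 * p^a ∣ t → Van (M0cat k m n d) (Inv (cT (k := k) (m := m) (n := n) h2 e1)) t) (j : ℕ) : ∀ b, b + j = a → 
    ∃ e : Fin d ≃ Yt p b × Fin (p ^ (j+1)), (∀ t, ¬ 2 * p^b ∣ t → Van (M0cat k m n d) (Inv (cT (k := k) (m := m) (n := n) h2 e)) t) ∧
    ∃ f : Inv (cT (k := k) (m := m) (n := n) h2 e1) →ₗ[SAlg k m n d] Inv (cT (k := k) (m := m) (n := n) h2 e), Function.Surjective f ∧ 
      Function.Bijective (pull (M0cat k m n d) f : HH (M0cat k m n d) (Inv (cT (k := k) (m := m) (n := n) h2 e)) (2*p^a) → HH (M0cat k m n d) (Inv (cT (k := k) (m := m) (n := n) h2 e1)) (2*p^a)) := by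
  induction j with
  | zero =>
    rintro b rfl
    refine ⟨e1, H, LinearMap.id, Function.surjective_id, ?_⟩
    convert Function.bijective_id using 1
    funext x
    exact pull_id x
  | succ j ih =>
    intro b hb
    obtain ⟨e, he, f, hf, hf'⟩ := ih (b+1) (by omega)
    have hh : ∀ i, (reg e i).1 = (YtE p b (e i).1).1 := fun i => rfl
    have hpb : 0 < p^b := pow_pos hp.out.pos _
    have hc : Fintype.card (Yt p (b+1)) = p^b * p := by rw [Yt_card, pow_succ]
    rw [pow_succ] at he
    refine ⟨reg e, lev_van (YtE p b) h2 e (reg e) hh e0 hm hn (p^b) hpb hc he, VV (YtE p b) h2 e (reg e) hh ∘ₗ f, (VV_surj (YtE p b) h2 e (reg e) hh).comp hf, ?_⟩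
    have h3 := lev_bij (YtE p b) h2 e (reg e) hh e0 hm hn (p^b) hpb hc he (p^a) (by
      rw [← pow_succ]; exact pow_dvd_pow p (by omega))
    convert hf'.comp h3 using 1
    funext x
    exact (pull_pull _ _ x).symm
end tower
end Stmt7

open CategoryTheory Finset
set_option synthInstance.maxHeartbeats 1000000
set_option maxHeartbeats 4000000
set_option linter.all false
namespace Stmt7
open CategoryTheory Abelian

section fin
variable {k : Type} [Field k] {m n d : ℕ} {G : Type} [AddCommGroup G] [Module (SAlg k m n d) G]
  (f : G →ₗ[SAlg k m n d] M0 k m n d) (hf : f ≠ 0) (N : ℕ)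
  (hb : Function.Bijective (pull (M0cat k m n d) f : HH (M0cat k m n d) (M0 k m n d) N → HH (M0cat k m n d) G N))
  (hs : Sh (M0cat k m n d) N G G)
  (hh : ∀ φ : G →ₗ[SAlg k m n d] M0 k m n d, ∃ c : k, ∀ x, φ x = algebraMap k (SAlg k m n d) c • f x)

lemma scal_comm {t : ℕ} (c : k) (x : Ext (M0cat k m n d) (M0cat k m n d) t) : 
    x.comp (Ext.mk₀ (c • 𝟙 (M0cat k m n d))) (add_zero t) = c • x := by
  change _ = (Ext.mk₀ (c • 𝟙 (M0cat k m n d))).comp x (zero_add t)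
  rw [Ext.mk₀_smul, Ext.comp_smul, Ext.smul_comp, Ext.comp_mk₀_id, Ext.mk₀_id_comp]

include hh in
lemma y_form (y : HH (M0cat k m n d) G 0) : ∃ c : k, y = pull (M0cat k m n d) f (Ext.mk₀ (c • 𝟙 (M0cat k m n d))) := by
  obtain ⟨g, rfl⟩ := (Ext.homEquiv₀ (X := ModuleCat.of _ G) (Y := M0cat k m n d)).symm.surjective y
  obtain ⟨c, hc⟩ := hh g.hom
  refine ⟨c, ?_⟩
  unfold pull
  rw [Ext.mk₀_comp_mk₀]
  change Ext.mk₀ g = _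
  congr 1
  ext x
  exact congrArg Subtype.val (hc x)

include hf in
lemma mkf_ne : pull (M0cat k m n d) f (Ext.mk₀ (𝟙 (M0cat k m n d))) ≠ 0 := by
  unfold pull
  rw [Ext.mk₀_comp_mk₀, Category.comp_id]
  intro h
  rw [Ext.mk₀_eq_zero_iff] at h
  exact hf (congrArg ModuleCat.Hom.hom h)

include hf hb hs hh

theorem fin_rank : Module.finrank k (Ext (M0cat k m n d) (M0cat k m n d) N) = 1 := by
  obtain ⟨β, b, z, nat⟩ := hs
  obtain ⟨v, hv⟩ := hb.2 (β 0 N (zero_add N) (pull (M0cat k m n d) f (Ext.mk₀ (𝟙 (M0cat k m n d)))))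
  rw [finrank_eq_one_iff']
  refine ⟨v, ?_, ?_⟩
  · rintro rfl
    rw [pull_zero] at hv
    exact mkf_ne f hf ((b 0 N (zero_add N)).1 (hv.symm.trans (z _ _ _).symm))
  · intro w
    obtain ⟨y, hy⟩ := (b 0 N (zero_add N)).2 (pull (M0cat k m n d) f w)
    obtain ⟨c, rfl⟩ := y_form f hh y
    refine ⟨c, hb.1 ?_⟩
    rw [← hy, ← scal_comm c v, pull_comp, hv, ← nat 0 N (zero_add N) 0 0 N (add_zero 0) (add_zero N) (zero_add N), ← pull_comp, Ext.mk₀_comp_mk₀, Category.id_comp]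

theorem fin_pow (e : Ext (M0cat k m n d) (M0cat k m n d) N) (he : e ≠ 0) (l : ℕ) : extPow e l ≠ 0 := by
  obtain ⟨β, b, z, nat⟩ := hs
  have h1 : ∀ i (x : HH (M0cat k m n d) G (N*i)), x ≠ 0 → x.comp e (rfl : N*i + N = N*(i+1)) ≠ 0 := by
    intro i
    induction i with
    | zero =>
      intro x hx
      obtain ⟨c, rfl⟩ := y_form f hh x
      have hc : c ≠ 0 := by
        rintro rfl
        apply hx
        rw [zero_smul, Ext.mk₀_zero, pull_zero]
      have h3 : (pull (M0cat k m n d) f (Ext.mk₀ (c • 𝟙 (M0cat k m n d)))).comp e (zero_add N) ≠ 0 := by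
        rw [← pull_comp]
        change pull (M0cat k m n d) f (c • e) ≠ 0
        intro h
        refine (smul_ne_zero hc he) (hb.1 (h.trans (pull_zero _).symm))
      intro h
      apply h3
      have : ∀ (t : ℕ) (ht : t = N) (h1 : 0 + N = t), (pull (M0cat k m n d) f (Ext.mk₀ (c • 𝟙 (M0cat k m n d)))).comp e h1 = 0 → (pull (M0cat k m n d) f (Ext.mk₀ (c • 𝟙 (M0cat k m n d)))).comp e (zero_add N) = 0 := by
        rintro t rfl _ h
        exact h
      exact this _ (by ring) rfl h
    | succ i ih =>
      intro x hx
      obtain ⟨x', rfl⟩ := (b (N*i) (N*(i+1)) rfl).2 x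
      have hx' : x' ≠ 0 := by
        rintro rfl
        exact hx (z _ _ _)
      rw [← nat (N*i) (N*(i+1)) rfl N (N*(i+1)) (N*(i+1+1)) rfl rfl rfl]
      intro h
      exact ih x' hx' ((b _ _ _).1 (h.trans (z _ _ _).symm))
  have h2 : ∀ l, pull (M0cat k m n d) f (extPow e l) ≠ 0 := by
    intro l
    induction l with
    | zero => exact mkf_ne f hf
    | succ l ih =>
      change pull (M0cat k m n d) f ((extPow e l).comp e rfl) ≠ 0
      rw [pull_comp]
      exact h1 l _ ih
  intro h
  exact h2 l (by rw [h]; exact pull_zero _)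
end fin

section A0
variable {k : Type} [Field k] {m n d : ℕ} {X : Type} [Fintype X] [DecidableEq X] (c : Coef k m n d X)

/-- degree zero alternating maps -/
noncomputable def A0 (h2 : (2:k) ≠ 0) : Alt c 0 ≃ₗ[SAlg k m n d] Inv c := by
  refine LinearEquiv.ofBijective ((Alt.ev c 0 Fin.elim0).codRestrict (Inv c) ?_) ⟨?_, ?_⟩
  · intro F σ
    have h := F.2 σ (bt k Fin.elim0)
    refine h.trans ?_
    exact congrArg F.1 (Subsingleton.elim _ _)
  · intro F G h
    exact Alt.ev_inj c Fin.elim0 (fun i => i.elim0) (congrArg Subtype.val h)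
  · intro w
    obtain ⟨F, hF⟩ := (Alt.ev_range c Fin.elim0 (fun i => i.elim0) h2 w.1).2 (by
      rintro ⟨⟨σ, τ⟩, h⟩
      have : τ = 1 := Subsingleton.elim _ _
      subst this
      simp only [Equiv.Perm.sign_one, Units.val_one, Int.cast_one, one_smul]
      exact w.2 σ)
    exact ⟨F, Subtype.ext hF⟩

/-- invariants for a one-point set -/
noncomputable def InvTop [Subsingleton X] : Inv c ≃ₗ[SAlg k m n d] c.T := by
  refine LinearEquiv.ofBijective (Inv c).subtype ⟨Subtype.val_injective, fun w => ⟨⟨w, fun σ => ?_⟩, rfl⟩⟩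
  have : σ = 1 := Subsingleton.elim _ _
  rw [this, c.R_one]; rfl

lemma algSmul (a : k) (x : c.T) : algebraMap k (SAlg k m n d) a • x = a • x := by
  change c.θ (algebraMap k (SAlg k m n d) a).e x = a • x
  have : (algebraMap k (SAlg k m n d) a).e = a • 1 := by
    change algebraMap k (Module.End k (W k m n d)) a = _
    rw [Algebra.algebraMap_eq_smul_one]
  rw [this, map_smul, c.θ_one]; rfl
end A0

theorem main (k : Type) [Field k] (p : ℕ) [hp : Fact p.Prime] [CharP k p] (h2 : 2 < p) (a m n : ℕ)
    (hm : p ^ (a+1) ≤ m) (hn : p ^ (a+1) ≤ n) : ∃ (G : Type) (_ : AddCommGroup G) (_ : Module (SAlg k m n (p^(a+1))) G) 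
    (f : G →ₗ[SAlg k m n (p^(a+1))] M0 k m n (p^(a+1))), f ≠ 0 ∧ 
    Function.Bijective (pull (M0cat k m n (p^(a+1))) f : HH (M0cat k m n (p^(a+1))) (M0 k m n (p^(a+1))) (2*p^a) → HH (M0cat k m n (p^(a+1))) G (2*p^a)) ∧ 
    Sh (M0cat k m n (p^(a+1))) (2*p^a) G G ∧ 
    (∀ φ : G →ₗ[SAlg k m n (p^(a+1))] M0 k m n (p^(a+1)), ∃ c : k, ∀ x, φ x = algebraMap k (SAlg k m n (p^(a+1))) c • f x) := by
  have hpa : 0 < p^a := pow_pos hp.out.pos _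
  have hd : 0 < p^(a+1) := pow_pos hp.out.pos _
  have e0 : Fin (p^(a+1)) ≃ Unit × Fin (p^(a+1)) := (Equiv.punitProd _).symm
  have e1 : Fin (p^(a+1)) ≃ Yt p a × Fin (p^(0+1)) := by
    refine Fintype.equivOfCardEq ?_
    rw [Fintype.card_prod, Yt_card, Fintype.card_fin, Fintype.card_fin]; ring
  obtain ⟨q, hq⟩ : ∃ q, p^a = q + 1 := ⟨p^a - 1, by omega⟩
  have hcard : Fintype.card (Yt p a) = q + 1 := by rw [Yt_card, hq]
  have hA : Alt (coefT (k := k) (m := m) (n := n) h2 e1) 0 ≃ₗ[SAlg k m n (p^(a+1))] Inv (coefT (k := k) (m := m) (n := n) h2 e1) := A0 _ (two_ne h2)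
  have hvan : ∀ t, ¬ 2 * p^a ∣ t → Van (M0cat k m n (p^(a+1))) (Inv (cT (k := k) (m := m) (n := n) h2 e1)) t := by
    intro t ht
    rw [hq] at ht
    exact Van.of_equiv hA.symm (D0_van h2 e1 e0 hm hn q hcard t ht)
  obtain ⟨e, -, f, hf, hfb⟩ := tower h2 a e1 e0 hm hn hvan a 0 (zero_add a)
  have eU : Fin (p^(a+1)) ≃ Unit × Fin (p^(a+1)) := e
  haveI : Subsingleton (Yt p 0) := inferInstanceAs (Subsingleton Unit)
  let T : Inv (cT (k := k) (m := m) (n := n) h2 e) ≃ₗ[SAlg k m n (p^(a+1))] (coefT (k := k) (m := m) (n := n) h2 e).T := InvTop _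
  let M : (coefT (k := k) (m := m) (n := n) h2 e).T ≃ₗ[SAlg k m n (p^(a+1))] M0 k m n (p^(a+1)) := M0equiv (k := k) (m := m) (n := n) h2 (show Fin (p^(a+1)) ≃ Unit × Fin (p^(a+1)) from e)
  let F : Alt (coefT (k := k) (m := m) (n := n) h2 e1) 0 →ₗ[SAlg k m n (p^(a+1))] M0 k m n (p^(a+1)) := (T.trans M).toLinearMap ∘ₗ f ∘ₗ hA.toLinearMap
  have hF : Function.Surjective F := (T.trans M).surjective.comp (hf.comp hA.surjective)
  have hF0 : F ≠ 0 := by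
    intro h
    let w : (coefT (k := k) (m := m) (n := n) h2 e).T := fun _ => (1:k)
    obtain ⟨x, hx⟩ := hF (M w)
    rw [h] at hx
    have h3 : w = 0 := M.injective (hx.symm.trans (map_zero M).symm)
    have := congrFun h3 (fun _ => ⟨0, by omega⟩)
    exact one_ne_zero this
  refine ⟨Alt (coefT (k := k) (m := m) (n := n) h2 e1) 0, inferInstance, inferInstance, F, hF0, ?_, ?_, ?_⟩
  · have h3 := ((pull_bij_of_equiv (L := M0cat k m n (p^(a+1))) hA (2*p^a)).comp hfb).comp (pull_bij_of_equiv (L := M0cat k m n (p^(a+1))) (T.trans M) (2*p^a))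
    convert h3 using 1
    funext x
    change _ = pull _ _ (pull _ _ (pull _ _ x))
    rw [pull_pull, pull_pull]
  · have := D0_sh (k := k) (m := m) (n := n) h2 e1 e0 hm hn q hcard
    rw [hq]; exact this
  · intro φ
    obtain ⟨c, hc⟩ := D0_hom (k := k) (m := m) (n := n) h2 e1 (show Fin (p^(a+1)) ≃ Unit × Fin (p^(a+1)) from e) hm hd (M.symm.toLinearMap ∘ₗ φ) (M.symm.toLinearMap ∘ₗ F) (by
      intro h
      apply hF0
      ext1 x
      have := LinearMap.congr_fun h x
      exact M.symm.injective (this.trans (map_zero M.symm).symm))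
    refine ⟨c, fun x => ?_⟩
    apply M.symm.injective
    rw [map_smul, algSmul]
    funext g
    exact hc x g

theorem statement7 (k : Type) [Field k] (p : ℕ) [Fact p.Prime] [CharP k p] [ExpChar k p]
    [PerfectRing k p] (hp2 : 2 < p) (r : ℕ) (hr : 1 ≤ r) (m n : ℕ)
    (hm : p ^ r ≤ m) (hn : p ^ r ≤ n) :
    (Module.finrank k
        (Ext (M0cat k m n (p ^ r)) (M0cat k m n (p ^ r)) (2 * p ^ (r - 1))) = 1) ∧
    (∀ e : Ext (M0cat k m n (p ^ r)) (M0cat k m n (p ^ r)) (2 * p ^ (r - 1)),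
      e ≠ 0 → ∀ ℓ : ℕ, 1 ≤ ℓ → extPow e ℓ ≠ 0) ∧
    (∃ N : ℕ, 0 < N ∧ ∃ e : Ext (M0cat k m n (p ^ r)) (M0cat k m n (p ^ r)) N,
      ∀ ℓ : ℕ, 1 ≤ ℓ → extPow e ℓ ≠ 0) := by
  obtain ⟨a, rfl⟩ : ∃ a, r = a + 1 := ⟨r - 1, by omega⟩
  rw [Nat.add_sub_cancel]
  obtain ⟨G, i1, i2, f, hf, hb, hs, hh⟩ := main k p hp2 a m n hm hn
  have h1 := fin_rank f hf (2*p^a) hb hs hh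
  have h2 := fin_pow f hf (2*p^a) hb hs hh
  refine ⟨h1, fun e he l _ => h2 e he l, 2*p^a, Nat.mul_pos two_pos (pow_pos (Fact.out : p.Prime).pos _), ?_⟩
  haveI : Nontrivial (Ext (M0cat k m n (p ^ (a+1))) (M0cat k m n (p ^ (a+1))) (2 * p ^ a)) := Module.nontrivial_of_finrank_pos (R := k) (by rw [h1]; exact one_pos)
  obtain ⟨e, he⟩ := exists_ne (0 : Ext (M0cat k m n (p ^ (a+1))) (M0cat k m n (p ^ (a+1))) (2 * p ^ a))
  exact ⟨e, fun l _ => h2 e he l⟩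

end Stmt7
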